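/- arXiv:0902.2413 — 2 statements merged into one kernel-verified Lean document; each statement's English description precedes it below -/
import Mathlib

section
/- Assume U : cl(Λ)×cl(Λ) → [0,∞) is symmetric and continuous, and assume ε_g > 0. Then for every ε > ε_g the limit s̄_I(ε) := lim_{N→∞} (1/N)·ln λ^⊗N({ q ∈ Λ^N : I_N(q) < N²ε }) exists, satisfies s̄_I(ε) ≤ 0, and ε ↦ s̄_I(ε) is nondecreasing and right-continuous on (ε_g, ∞). -/
open MeasureTheory Real Filter Set
open scoped BigOperators ENNReal

noncomputable section

abbrev Euc : Type := EuclideanSpace ℝ (Fin 3)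

/-- The `N`-fold product of the normalized Lebesgue measure `λ` on `Λ`. -/
def piNormLeb (Λ : Set Euc) (N : ℕ) : Measure (Fin N → Euc) :=
  ((volume Λ) ^ N)⁻¹ • volume.restrict (Set.univ.pi fun _ => Λ)

/-- Interaction energy `I_N(q) = ∑_{i<j} U(q_i, q_j)`. -/
def interaction (U : Euc → Euc → ℝ) (N : ℕ) (q : Fin N → Euc) : ℝ :=
  ∑ i : Fin N, ∑ j : Fin N, if (i : ℕ) < (j : ℕ) then U (q i) (q j) else 0

/-- The bilinear pairing `⟨ρ,ρ'⟩ = ∬ ½ U(x,y) ρ(dx) ρ'(dy)`. -/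
def pairing (U : Euc → Euc → ℝ) (ρ ρ' : Measure Euc) : ℝ :=
  ∫ x, ∫ y, U x y / 2 ∂ρ' ∂ρ

/-- A Borel probability measure concentrated on `cl(Λ)`. -/
def IsProbOn (Λ : Set Euc) (ρ : Measure Euc) : Prop :=
  IsProbabilityMeasure ρ ∧ ρ ((closure Λ)ᶜ) = 0

/-- `ε_g`, the infimum of `⟨ρ,ρ⟩` over Borel probability measures on `cl(Λ)`. -/
def groundEnergy (U : Euc → Euc → ℝ) (Λ : Set Euc) : ℝ :=
  sInf { e : ℝ | ∃ ρ : Measure Euc, IsProbOn Λ ρ ∧ e = pairing U ρ ρ }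

namespace MeanFieldLDP

/-- The energy `∑_{i<j} U (q i, q j)` of a configuration `q`. -/
def pairEnergy {X : Type*} (U : X × X → ℝ) {N : ℕ} (q : Fin N → X) : ℝ :=
  ∑ i : Fin N, ∑ j : Fin N, if (i : ℕ) < (j : ℕ) then U (q i, q j) else 0

/-- The mean-field energy `½ ∬ U dρ dρ`. -/
def meanEnergy {X : Type*} [MeasurableSpace X] (U : X × X → ℝ) (ρ : Measure X) : ℝ :=
  (∫ p, U p ∂(ρ.prod ρ)) / 2

lemma sum_lt_const (N : ℕ) (c : ℝ) :
    (∑ i : Fin N, ∑ j : Fin N, if (i : ℕ) < (j : ℕ) then c else 0) = N * (N - 1) / 2 * c := by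
  have h (i : Fin N) : (∑ j : Fin N, if (i : ℕ) < (j : ℕ) then c else 0) = (N - 1 - i : ℝ) * c := by
    have h1 := Fin.card_Ioi i
    rw [← Finset.sum_filter, Finset.sum_const, nsmul_eq_mul]
    have h2 : (Finset.univ.filter fun j : Fin N => (i : ℕ) < (j : ℕ)) = Finset.Ioi i := by
      ext j; simp
    rw [h2, h1]
    have := i.2
    rw [Nat.sub_sub, Nat.cast_sub (by omega)]
    push_cast
    ring
  simp_rw [h]
  rw [← Finset.sum_mul, Fin.sum_univ_eq_sum_range (fun i : ℕ => (N - 1 - i : ℝ))]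
  congr 1
  clear h
  induction N with
  | zero => simp
  | succ n ih =>
    have e : ∀ x ∈ Finset.range n, (((n + 1 : ℕ) : ℝ) - 1 - x) = (n - 1 - x) + 1 := by
      intro x _; push_cast; ring
    rw [Finset.sum_range_succ, Finset.sum_congr rfl e, Finset.sum_add_distrib, ih]
    simp
    ring

lemma abs_pairEnergy_le {X : Type*} {U : X × X → ℝ} {K : ℝ} (hK : ∀ p, |U p| ≤ K)
    {N : ℕ} (q : Fin N → X) :
    |pairEnergy U q| ≤ N ^ 2 * K := by
  unfold pairEnergy
  calc _ ≤ ∑ i : Fin N, ∑ j : Fin N, K := by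
        refine (Finset.abs_sum_le_sum_abs _ _).trans (Finset.sum_le_sum fun i _ => ?_)
        refine (Finset.abs_sum_le_sum_abs _ _).trans (Finset.sum_le_sum fun j _ => ?_)
        split_ifs
        · exact hK _
        · simpa using (abs_nonneg _).trans (hK (q i, q j))
    _ = _ := by simp; ring

lemma pairEnergy_sub_const {X : Type*} (U : X × X → ℝ) (c : ℝ) {N : ℕ} (q : Fin N → X) :
    pairEnergy (fun p => U p - c) q = pairEnergy U q - N * (N - 1) / 2 * c := by
  rw [← sum_lt_const]
  unfold pairEnergy
  simp_rw [← Finset.sum_sub_distrib]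
  refine Finset.sum_congr rfl fun i _ => Finset.sum_congr rfl fun j _ => ?_
  split_ifs <;> simp

section Moments

variable {X : Type*} [MeasurableSpace X] {ρ : Measure X} [IsProbabilityMeasure ρ]

lemma measurable_pairEnergy {U : X × X → ℝ} (hU : Measurable U) (N : ℕ) :
    Measurable (pairEnergy U : (Fin N → X) → ℝ) := by
  unfold pairEnergy
  refine Finset.measurable_sum _ fun i _ => Finset.measurable_sum _ fun j _ => ?_
  split_ifs <;> fun_prop

lemma map_pair_pi {N : ℕ} {i j : Fin N} (hij : i ≠ j) :
    (Measure.pi fun _ : Fin N => ρ).map (fun q => (q i, q j)) = ρ.prod ρ := by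
  have h := (ProbabilityTheory.iIndepFun_pi (μ := fun _ : Fin N => ρ)
    (X := fun _ x => x) (fun _ => aemeasurable_id)).indepFun hij
  rw [h.map_prod_eq_prod_map_map (measurable_pi_apply i).aemeasurable
    (measurable_pi_apply j).aemeasurable]
  congr 1
  · exact (measurePreserving_eval (fun _ : Fin N => ρ) i).map_eq
  · exact (measurePreserving_eval (fun _ : Fin N => ρ) j).map_eq

lemma integral_pairEnergy {U : X × X → ℝ} (hU : Measurable U) {K : ℝ} (hK : ∀ p, |U p| ≤ K)
    (N : ℕ) :
    ∫ q, pairEnergy U q ∂(Measure.pi fun _ : Fin N => ρ) = N * (N - 1) * meanEnergy U ρ := by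
  have hint (i j : Fin N) : Integrable (fun q : Fin N → X => U (q i, q j))
      (Measure.pi fun _ : Fin N => ρ) :=
    Integrable.of_bound (Measurable.aestronglyMeasurable (by fun_prop)) K (ae_of_all _ fun q => hK _)
  have hterm (i j : Fin N) : ∫ q, (if (i : ℕ) < (j : ℕ) then U (q i, q j) else 0)
      ∂(Measure.pi fun _ : Fin N => ρ) =
      if (i : ℕ) < (j : ℕ) then 2 * meanEnergy U ρ else 0 := by
    split_ifs with h
    · have hij : i ≠ j := by rintro rfl; omega
      rw [meanEnergy, ← map_pair_pi hij,
        integral_map (Measurable.aemeasurable (by fun_prop)) hU.aestronglyMeasurable]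
      ring
    · simp
  have hint' (i j : Fin N) : Integrable (fun q : Fin N → X =>
      if (i : ℕ) < (j : ℕ) then U (q i, q j) else 0) (Measure.pi fun _ : Fin N => ρ) := by
    split_ifs
    · exact hint i j
    · exact integrable_zero _ _ _
  unfold pairEnergy
  rw [integral_finsetSum _ fun i _ => integrable_finsetSum _ fun j _ => hint' i j]
  simp_rw [integral_finsetSum _ fun j _ => hint' _ j, hterm]
  rw [sum_lt_const]
  ring

lemma integral_mul_eq_zero_of_centered {k : X × X → ℝ} (hk : Measurable k) {K : ℝ}
    (hK : ∀ p, |k p| ≤ K) (hcent : ∀ᵐ y ∂ρ, ∫ x, k (x, y) ∂ρ = 0) {N : ℕ} {i j l m : Fin N}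
    (hij : j ≠ i) (hil : l ≠ i) (him : m ≠ i) :
    ∫ q, k (q i, q j) * k (q l, q m) ∂(Measure.pi fun _ : Fin N => ρ) = 0 := by
  obtain _ | n := N
  · exact i.elim0
  obtain ⟨j, rfl⟩ := Fin.exists_succAbove_eq hij
  obtain ⟨l, rfl⟩ := Fin.exists_succAbove_eq hil
  obtain ⟨m, rfl⟩ := Fin.exists_succAbove_eq him
  rw [← ((measurePreserving_piFinSuccAbove (fun _ : Fin (n + 1) => ρ) i).symm).integral_comp']
  simp only [MeasurableEquiv.piFinSuccAbove_symm_apply, Fin.insertNthEquiv_apply,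
    Fin.insertNth_apply_same, Fin.insertNth_apply_succAbove]
  rw [integral_prod_symm _
    (Integrable.of_bound (Measurable.aestronglyMeasurable (by fun_prop)) (K * K)
      (ae_of_all _ fun p => ?_))]
  · refine integral_eq_zero_of_ae ?_
    have := (Measure.quasiMeasurePreserving_eval (fun _ : Fin n => ρ) j).ae hcent
    filter_upwards [this] with q hq
    simp only [Function.eval] at hq
    simp [integral_mul_const, hq]
  · rw [Real.norm_eq_abs, abs_mul]
    exact mul_le_mul (hK _) (hK _) (abs_nonneg _) ((abs_nonneg _).trans (hK (p.1, p.1)))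

lemma integral_sq_pairEnergy_le {k : X × X → ℝ} (hk : Measurable k) {K : ℝ}
    (hK : ∀ p, |k p| ≤ K) (hsymm : ∀ x y, k (x, y) = k (y, x))
    (hcent : ∀ᵐ y ∂ρ, ∫ x, k (x, y) ∂ρ = 0) (N : ℕ) :
    ∫ q, pairEnergy k q ^ 2 ∂(Measure.pi fun _ : Fin N => ρ) ≤ N ^ 2 * K ^ 2 := by
  set P : Finset (Fin N × Fin N) := Finset.univ.filter fun p => (p.1 : ℕ) < (p.2 : ℕ) with hP
  have hsum (q : Fin N → X) : pairEnergy k q = ∑ p ∈ P, k (q p.1, q p.2) := by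
    rw [pairEnergy, hP, Finset.sum_filter, ← Finset.univ_product_univ, Finset.sum_product]
  have hb (q : Fin N → X) (p r : Fin N × Fin N) :
      |k (q p.1, q p.2) * k (q r.1, q r.2)| ≤ K ^ 2 := by
    rw [abs_mul, sq]
    exact mul_le_mul (hK _) (hK _) (abs_nonneg _) ((abs_nonneg _).trans (hK (q p.1, q p.1)))
  have hint (p r : Fin N × Fin N) : Integrable (fun q : Fin N → X =>
      k (q p.1, q p.2) * k (q r.1, q r.2)) (Measure.pi fun _ : Fin N => ρ) :=
    Integrable.of_bound (Measurable.aestronglyMeasurable (by fun_prop)) (K ^ 2)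
      (ae_of_all _ fun q => hb q p r)
  have hzero {p r : Fin N × Fin N} (hp : p ∈ P) (hr : r ∈ P) (hpr : p ≠ r) :
      ∫ q, k (q p.1, q p.2) * k (q r.1, q r.2) ∂(Measure.pi fun _ : Fin N => ρ) = 0 := by
    obtain ⟨i, j⟩ := p
    obtain ⟨l, m⟩ := r
    simp only [hP, Finset.mem_filter, Finset.mem_univ, true_and] at hp hr
    simp only [ne_eq, Prod.mk.injEq, Fin.ext_iff] at hpr
    by_cases h : l ≠ i ∧ m ≠ i
    · exact integral_mul_eq_zero_of_centered hk hK hcent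
          (by simp only [ne_eq, Fin.ext_iff]; omega) h.1 h.2
    · have e : (fun q : Fin N → X => k (q i, q j) * k (q l, q m)) =
          fun q => k (q j, q i) * k (q l, q m) := by
        funext q
        rw [hsymm]
      rw [e]
      refine integral_mul_eq_zero_of_centered hk hK hcent ?_ ?_ ?_ <;>
      · simp only [ne_eq, Fin.ext_iff] at h ⊢
        omega
  calc ∫ q, pairEnergy k q ^ 2 ∂(Measure.pi fun _ : Fin N => ρ)
      = ∑ p ∈ P, ∑ r ∈ P,
        ∫ q, k (q p.1, q p.2) * k (q r.1, q r.2) ∂(Measure.pi fun _ : Fin N => ρ) := by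
        simp_rw [hsum, sq, Finset.sum_mul_sum]
        rw [integral_finsetSum _ fun p _ => integrable_finsetSum _ fun r _ => hint p r]
        simp_rw [integral_finsetSum _ fun r _ => hint _ r]
    _ ≤ ∑ p ∈ P, ∑ r ∈ P, if p = r then K ^ 2 else 0 := by
        refine Finset.sum_le_sum fun p hp => Finset.sum_le_sum fun r hr => ?_
        split_ifs with h
        · refine (integral_mono (hint p r) (integrable_const (K ^ 2)) fun q => ?_).trans (by simp)
          exact (le_abs_self _).trans (hb q p r)
        · exact (hzero hp hr h).le
    _ ≤ ∑ p ∈ P, K ^ 2 := by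
        refine Finset.sum_le_sum fun p hp => ?_
        simp [hp]
    _ ≤ N ^ 2 * K ^ 2 := by
        rw [Finset.sum_const, nsmul_eq_mul]
        gcongr
        have : P.card ≤ N ^ 2 := by
          refine (Finset.card_filter_le _ _).trans ?_
          simp [sq]
        exact_mod_cast this

lemma sq_div_le_measureReal_pos {Ω : Type*} [MeasurableSpace Ω] {μ : Measure Ω}
    [IsProbabilityMeasure μ] {Z : Ω → ℝ} (hZ : Measurable Z) {m M : ℝ} (hm : 0 < m) (hM : 0 < M)
    (hint : Integrable Z μ) (hint2 : Integrable (fun ω => Z ω ^ 2) μ)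
    (h1 : m ≤ ∫ ω, Z ω ∂μ) (h2 : ∫ ω, Z ω ^ 2 ∂μ ≤ M) :
    m ^ 2 / M ≤ μ.real {ω | 0 < Z ω} := by
  have hS : MeasurableSet {ω | 0 < Z ω} := measurableSet_lt measurable_const hZ
  have key : ∫ ω, 2 * m * M * Z ω ∂μ ≤
      ∫ ω, (m ^ 2 * Z ω ^ 2 + M ^ 2 * ({ω | 0 < Z ω}.indicator (fun _ => (1 : ℝ)) ω)) ∂μ := by
    refine integral_mono (hint.const_mul _)
      ((hint2.const_mul _).add (((integrable_const (1 : ℝ)).indicator hS).const_mul _)) fun ω => ?_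
    by_cases h : 0 < Z ω
    · simp only [indicator, mem_ofPred_eq, h, if_true]
      nlinarith [sq_nonneg (m * Z ω - M)]
    · simp only [indicator, mem_ofPred_eq, h, if_false]
      have : m * M * Z ω ≤ 0 := mul_nonpos_of_nonneg_of_nonpos (by positivity) (not_lt.1 h)
      nlinarith [sq_nonneg (m * Z ω)]
  rw [integral_add (hint2.const_mul _) (((integrable_const (1 : ℝ)).indicator hS).const_mul _),
    integral_const_mul, integral_const_mul, integral_const_mul, integral_indicator_const _ hS,
    smul_eq_mul, mul_one] at key
  rw [div_le_iff₀ hM]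
  have e1 : m ^ 2 * ∫ ω, Z ω ^ 2 ∂μ ≤ m ^ 2 * M := by gcongr
  have e2 : 2 * m * M * m ≤ 2 * m * M * ∫ ω, Z ω ∂μ := by gcongr
  have : M * m ^ 2 ≤ M * (μ.real {ω | 0 < Z ω} * M) := by nlinarith
  exact le_of_mul_le_mul_left this hM

end Moments

section LowerBound

variable {X : Type*} [MeasurableSpace X] {ρ : Measure X} [IsProbabilityMeasure ρ]

/-- If `ρ` has mean-field energy below `ε`, or equal to `ε` with constant potential, then i.i.d.
configurations sampled from `ρ` have energy below `N² ε` with probability bounded away from `0`. -/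
lemma exists_pos_le_measureReal_pairEnergy_lt {U : X × X → ℝ} (hU : Measurable U) {K : ℝ}
    (hK : ∀ p, |U p| ≤ K) (hsymm : ∀ x y, U (x, y) = U (y, x)) {ε : ℝ} (hε : 0 < ε)
    (h : meanEnergy U ρ < ε ∨
      meanEnergy U ρ = ε ∧ ∀ᵐ y ∂ρ, ∫ x, U (x, y) ∂ρ = 2 * ε) :
    ∃ c > 0, ∀ N : ℕ, 1 ≤ N → c ≤ (Measure.pi fun _ : Fin N => ρ).real
      {q | pairEnergy U q < (N : ℝ) ^ 2 * ε} := by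
  have hK0 : 0 ≤ K := by
    obtain ⟨x⟩ : Nonempty X := nonempty_of_isProbabilityMeasure ρ
    exact (abs_nonneg _).trans (hK (x, x))
  have hmeas (N : ℕ) := measurable_pairEnergy hU N
  have hbd (N : ℕ) (q : Fin N → X) := abs_le.1 (abs_pairEnergy_le hK q)
  have hI (N : ℕ) : Integrable (fun q : Fin N → X => pairEnergy U q)
      (Measure.pi fun _ : Fin N => ρ) :=
    Integrable.of_bound (hmeas N).aestronglyMeasurable (N ^ 2 * K)
      (ae_of_all _ fun q => abs_pairEnergy_le hK q)
  have hmean (N : ℕ) : ∫ q, ((N : ℝ) ^ 2 * ε - pairEnergy U q) ∂(Measure.pi fun _ : Fin N => ρ) =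
      N ^ 2 * ε - N * (N - 1) * meanEnergy U ρ := by
    rw [integral_sub (integrable_const _) (hI N), integral_pairEnergy hU hK]
    simp
  have hsqb (N : ℕ) (q : Fin N → X) :
      ((N : ℝ) ^ 2 * ε - pairEnergy U q) ^ 2 ≤ (N ^ 2 * (ε + K)) ^ 2 := by
    have := hbd N q
    have h0 : 0 ≤ (N : ℝ) ^ 2 * ε := by positivity
    apply sq_le_sq'
    · nlinarith
    · nlinarith
  have hI2 (N : ℕ) : Integrable (fun q : Fin N → X => ((N : ℝ) ^ 2 * ε - pairEnergy U q) ^ 2)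
      (Measure.pi fun _ : Fin N => ρ) := by
    refine Integrable.of_bound (((hmeas N).const_sub _).pow_const 2).aestronglyMeasurable
      ((N ^ 2 * (ε + K)) ^ 2) (ae_of_all _ fun q => ?_)
    rw [Real.norm_of_nonneg (sq_nonneg _)]
    exact hsqb N q
  have hset (N : ℕ) : {q : Fin N → X | pairEnergy U q < (N : ℝ) ^ 2 * ε} =
      {q | 0 < (N : ℝ) ^ 2 * ε - pairEnergy U q} := by
    ext q
    simp
  simp_rw [hset]
  obtain h | ⟨h, hpot⟩ := h
  · refine ⟨(min (ε - meanEnergy U ρ) ε) ^ 2 / (ε + K) ^ 2, by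
      have : 0 < min (ε - meanEnergy U ρ) ε := lt_min (by linarith) hε
      positivity, fun N hN => ?_⟩
    have hN' : (1 : ℝ) ≤ N := by exact_mod_cast hN
    have hm : 0 < min (ε - meanEnergy U ρ) ε := lt_min (by linarith) hε
    have := sq_div_le_measureReal_pos (μ := Measure.pi fun _ : Fin N => ρ)
      ((hmeas N).const_sub ((N : ℝ) ^ 2 * ε))
      (m := N ^ 2 * min (ε - meanEnergy U ρ) ε) (M := (N ^ 2 * (ε + K)) ^ 2) (by positivity)
      (by positivity) ((integrable_const _).sub (hI N)) (hI2 N) ?_ ?_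
    · refine le_trans (le_of_eq ?_) this
      field_simp
    · rw [hmean]
      have h1 := min_le_left (ε - meanEnergy U ρ) ε
      have h2 := min_le_right (ε - meanEnergy U ρ) ε
      have h3 : meanEnergy U ρ ≤ ε - min (ε - meanEnergy U ρ) ε := by linarith
      have h4 : (N : ℝ) * (N - 1) * meanEnergy U ρ ≤
          N * (N - 1) * (ε - min (ε - meanEnergy U ρ) ε) :=
        mul_le_mul_of_nonneg_left h3 (mul_nonneg (by linarith) (by linarith))
      nlinarith [mul_nonneg (by linarith : (0 : ℝ) ≤ N)
        (by linarith : 0 ≤ ε - min (ε - meanEnergy U ρ) ε)]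
    · refine (integral_mono (hI2 N) (integrable_const _) (hsqb N)).trans (by simp)
  · refine ⟨ε ^ 2 / (2 * ε ^ 2 + 2 * (K + 2 * ε) ^ 2), by positivity, fun N hN => ?_⟩
    have hN' : (1 : ℝ) ≤ N := by exact_mod_cast hN
    have hk : ∀ p, |U p - 2 * ε| ≤ K + 2 * ε := fun p => by
      refine (abs_sub _ _).trans ?_
      rw [abs_of_pos (by positivity : 0 < 2 * ε)]
      linarith [hK p]
    have hcent : ∀ᵐ y ∂ρ, ∫ x, (U (x, y) - 2 * ε) ∂ρ = 0 := by
      filter_upwards [hpot] with y hy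
      rw [integral_sub (Integrable.of_bound (Measurable.aestronglyMeasurable (by fun_prop)) K
        (ae_of_all _ fun x => hK _)) (integrable_const _), hy]
      simp
    have hvar := integral_sq_pairEnergy_le (ρ := ρ) (hU.sub_const (2 * ε)) hk
      (fun x y => by rw [hsymm]) hcent N
    have hkI : Integrable (fun q : Fin N → X => pairEnergy (fun p => U p - 2 * ε) q ^ 2)
        (Measure.pi fun _ : Fin N => ρ) := by
      refine Integrable.of_bound
        ((measurable_pairEnergy (hU.sub_const (2 * ε)) N).pow_const 2).aestronglyMeasurable
        ((N ^ 2 * (K + 2 * ε)) ^ 2) (ae_of_all _ fun q => ?_)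
      rw [Real.norm_of_nonneg (sq_nonneg _)]
      exact sq_le_sq' (abs_le.1 (abs_pairEnergy_le hk q)).1 (abs_le.1 (abs_pairEnergy_le hk q)).2
    have := sq_div_le_measureReal_pos (μ := Measure.pi fun _ : Fin N => ρ)
      ((hmeas N).const_sub ((N : ℝ) ^ 2 * ε))
      (m := N * ε) (M := N ^ 2 * (2 * ε ^ 2 + 2 * (K + 2 * ε) ^ 2)) (by positivity)
      (by positivity) ((integrable_const _).sub (hI N)) (hI2 N) ?_ ?_
    · refine le_trans (le_of_eq ?_) this
      field_simp
    · rw [hmean, h]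
      nlinarith
    · calc ∫ q, ((N : ℝ) ^ 2 * ε - pairEnergy U q) ^ 2 ∂(Measure.pi fun _ : Fin N => ρ)
          ≤ ∫ q, (2 * (N * ε) ^ 2 + 2 * pairEnergy (fun p => U p - 2 * ε) q ^ 2)
            ∂(Measure.pi fun _ : Fin N => ρ) := by
            refine integral_mono (hI2 N) ((integrable_const _).add (hkI.const_mul 2)) fun q => ?_
            simp only [pairEnergy_sub_const]
            nlinarith [sq_nonneg (N * ε + (pairEnergy U q - N * (N - 1) / 2 * (2 * ε)))]
        _ ≤ _ := by
            rw [integral_add (integrable_const _) (hkI.const_mul 2)]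
            simp only [integral_const, probReal_univ, smul_eq_mul, one_mul]
            rw [integral_const_mul]
            nlinarith

lemma pi_withDensity {μ : Measure X} [IsProbabilityMeasure μ] {f : X → ℝ≥0∞} (hf : Measurable f)
    [SigmaFinite (μ.withDensity f)] (N : ℕ) :
    (Measure.pi fun _ : Fin N => μ.withDensity f) =
      (Measure.pi fun _ : Fin N => μ).withDensity fun q => ∏ i, f (q i) := by
  refine Measure.pi_eq fun s hs => ?_
  rw [withDensity_apply _ (MeasurableSet.univ_pi hs), ← lintegral_indicator (MeasurableSet.univ_pi hs)]
  have hind : ((univ.pi s).indicator fun q : Fin N → X => ∏ i, f (q i)) =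
      fun q => ∏ i, (s i).indicator f (q i) := by
    funext q
    by_cases hq : q ∈ univ.pi s
    · rw [indicator_of_mem hq]
      exact Finset.prod_congr rfl fun i _ => (indicator_of_mem (hq i (mem_univ i)) f).symm
    · rw [indicator_of_notMem hq]
      obtain ⟨i, hi⟩ : ∃ i, q i ∉ s i := by simpa using hq
      exact (Finset.prod_eq_zero (Finset.mem_univ i) (indicator_of_notMem hi f)).symm
  have hm (i : Fin N) : Measurable ((s i).indicator f) := hf.indicator (hs i)
  rw [hind, ProbabilityTheory.lintegral_prod_eq_prod_lintegral_of_indepFun Finset.univ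
    (fun i (q : Fin N → X) => (s i).indicator f (q i))
    (ProbabilityTheory.iIndepFun_pi (μ := fun _ : Fin N => μ) fun i => (hm i).aemeasurable)
    fun i => (hm i).comp (measurable_pi_apply i)]
  refine Finset.prod_congr rfl fun i _ => ?_
  rw [withDensity_apply _ (hs i), ← lintegral_indicator (hs i)]
  exact (measurePreserving_eval (fun _ : Fin N => μ) i).lintegral_comp (hm i)

/-- Weak law of large numbers on finite product spaces. -/
lemma tendsto_pi_measureReal_sum_ge {g : X → ℝ} (hg : Measurable g) (hgi : Integrable g ρ) {a : ℝ}
    (ha : ∫ x, g x ∂ρ < a) :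
    Tendsto (fun N : ℕ => (Measure.pi fun _ : Fin N => ρ).real {q | N * a ≤ ∑ i, g (q i)})
      atTop (nhds 0) := by
  set P : Measure (ℕ → X) := Measure.infinitePi fun _ => ρ with hP
  have hmp (n : ℕ) : MeasurePreserving (fun ω : ℕ → X => ω n) P ρ :=
    measurePreserving_eval_infinitePi (fun _ => ρ) n
  have hindep := ProbabilityTheory.iIndepFun_infinitePi (P := fun _ : ℕ => ρ)
    (X := fun _ => g) fun _ => hg
  have hint0 : ∫ ω, g (ω 0) ∂P = ∫ x, g x ∂ρ := by
    rw [← (hmp 0).map_eq, integral_map (hmp 0).measurable.aemeasurable hg.aestronglyMeasurable]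
  have hslln := ProbabilityTheory.strong_law_ae_real (μ := P) (fun n ω => g (ω n))
    ((hmp 0).integrable_comp_of_integrable hgi) (fun i j hij => hindep.indepFun hij)
    (fun n => ⟨(hg.comp (hmp n).measurable).aemeasurable,
      (hg.comp (hmp 0).measurable).aemeasurable, by
        have h1 := Measure.map_map (μ := P) hg (hmp n).measurable
        have h2 := Measure.map_map (μ := P) hg (hmp 0).measurable
        rw [(hmp n).map_eq] at h1
        rw [(hmp 0).map_eq] at h2
        exact h1.symm.trans h2⟩)
  have hprob := tendstoInMeasure_of_tendsto_ae (fun n =>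
    Measurable.aestronglyMeasurable (by fun_prop)) hslln
  rw [tendstoInMeasure_iff_dist] at hprob
  have hlim := hprob (a - ∫ x, g x ∂ρ) (by linarith)
  have hlim' := (ENNReal.tendsto_toReal ENNReal.zero_ne_top).comp hlim
  simp only [ENNReal.toReal_zero] at hlim'
  refine tendsto_of_tendsto_of_tendsto_of_le_of_le' tendsto_const_nhds hlim'
    (Eventually.of_forall fun N => measureReal_nonneg) ?_
  filter_upwards [eventually_ge_atTop 1] with N hN
  have hmap : P.map (fun ω (i : Fin N) => ω i) = Measure.pi fun _ : Fin N => ρ := by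
    rw [hP, Measure.map_infinitePi_infinitePi_of_inj Fin.val_injective, Measure.infinitePi_eq_pi]
  rw [← hmap, map_measureReal_apply (by fun_prop)
    (measurableSet_le measurable_const (by fun_prop))]
  refine ENNReal.toReal_mono (measure_ne_top _ _) (measure_mono fun ω hω => ?_)
  simp only [mem_preimage, mem_ofPred_eq] at hω ⊢
  rw [Fin.sum_univ_eq_sum_range (fun i => g (ω i))] at hω
  have hN' : (0 : ℝ) < N := by exact_mod_cast hN
  rw [hint0, Real.dist_eq]
  refine le_trans ?_ (le_abs_self _)
  gcongr
  rwa [le_div_iff₀ hN', mul_comm]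

/-- Change of measure: an event of non-vanishing probability under `ρ^N` has exponentially lower
bounded probability under `μ^N`, with rate any bound for the relative entropy. -/
lemma eventually_exp_le_measureReal {μ : Measure X} [IsProbabilityMeasure μ] {f : X → ℝ≥0∞}
    (hf : Measurable f) (hρ : ρ = μ.withDensity f) {g : X → ℝ} (hg : Measurable g)
    (hgi : Integrable g ρ) (hfg : ∀ x, f x ≤ ENNReal.ofReal (Real.exp (g x))) {a : ℝ}
    (ha : ∫ x, g x ∂ρ < a) {c : ℝ} (hc : 0 < c) {A : ∀ N : ℕ, Set (Fin N → X)}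
    (hA : ∀ N, MeasurableSet (A N))
    (hAc : ∀ N : ℕ, 1 ≤ N → c ≤ (Measure.pi fun _ : Fin N => ρ).real (A N)) :
    ∀ᶠ N : ℕ in atTop, Real.exp (-(N * a)) ≤ (Measure.pi fun _ : Fin N => μ).real (A N) := by
  obtain ⟨b, hb, hba⟩ := exists_between ha
  have hexp : Tendsto (fun N : ℕ => Real.exp (-(N * (a - b)))) atTop (nhds 0) := by
    refine Real.tendsto_exp_neg_atTop_nhds_zero.comp ?_
    exact tendsto_natCast_atTop_atTop.atTop_mul_const (by linarith)
  filter_upwards [eventually_ge_atTop 1, (tendsto_pi_measureReal_sum_ge hg hgi hb).eventually_lt_const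
    (half_pos hc), hexp.eventually_lt_const (half_pos hc)] with N hN h1 h2
  set B : Set (Fin N → X) := {q | N * b ≤ ∑ i, g (q i)} with hB
  have hBm : MeasurableSet B := measurableSet_le measurable_const (by fun_prop)
  have h3 : c / 2 ≤ (Measure.pi fun _ : Fin N => ρ).real (A N \ B) := by
    have := hAc N hN
    have h4 : (Measure.pi fun _ : Fin N => ρ).real (A N) ≤
      (Measure.pi fun _ : Fin N => ρ).real (A N \ B) + (Measure.pi fun _ : Fin N => ρ).real B :=
      (measureReal_mono (by intro x hx; by_cases h : x ∈ B <;> simp [hx, h])).trans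
        (measureReal_union_le _ _)
    linarith
  have h5 : (Measure.pi fun _ : Fin N => ρ) (A N \ B) ≤
      ENNReal.ofReal (Real.exp (N * b)) * (Measure.pi fun _ : Fin N => μ) (A N) := by
    have hpi : (Measure.pi fun _ : Fin N => ρ) =
        (Measure.pi fun _ : Fin N => μ).withDensity fun q => ∏ i, f (q i) := by
      subst hρ
      exact pi_withDensity hf N
    rw [hpi, withDensity_apply _ ((hA N).diff hBm)]
    calc ∫⁻ q in A N \ B, ∏ i, f (q i) ∂(Measure.pi fun _ : Fin N => μ)
        ≤ ∫⁻ q in A N \ B, ENNReal.ofReal (Real.exp (N * b)) ∂(Measure.pi fun _ : Fin N => μ) := by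
          refine setLIntegral_mono measurable_const fun q hq => ?_
          have hq' : ∑ i, g (q i) < N * b := not_le.1 hq.2
          calc ∏ i, f (q i) ≤ ∏ i, ENNReal.ofReal (Real.exp (g (q i))) :=
                Finset.prod_le_prod' fun i _ => hfg _
            _ = ENNReal.ofReal (Real.exp (∑ i, g (q i))) := by
                rw [Real.exp_sum, ENNReal.ofReal_prod_of_nonneg fun i _ => (Real.exp_pos _).le]
            _ ≤ _ := ENNReal.ofReal_le_ofReal (Real.exp_le_exp.2 hq'.le)
      _ = ENNReal.ofReal (Real.exp (N * b)) * (Measure.pi fun _ : Fin N => μ) (A N \ B) :=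
          setLIntegral_const _ _
      _ ≤ _ := by gcongr; exact sdiff_subset
  have h6 : (Measure.pi fun _ : Fin N => ρ).real (A N \ B) ≤
      Real.exp (N * b) * (Measure.pi fun _ : Fin N => μ).real (A N) := by
    have := ENNReal.toReal_mono (ENNReal.mul_ne_top ENNReal.ofReal_ne_top (measure_ne_top _ _)) h5
    rwa [ENNReal.toReal_mul, ENNReal.toReal_ofReal (Real.exp_pos _).le] at this
  have h7 : Real.exp (-(N * a)) = Real.exp (-(N * (a - b))) * Real.exp (-(N * b)) := by
    rw [← Real.exp_add]
    ring_nf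
  rw [h7]
  calc _ ≤ c / 2 * Real.exp (-(N * b)) := by gcongr
    _ ≤ (Real.exp (N * b) * (Measure.pi fun _ : Fin N => μ).real (A N)) * Real.exp (-(N * b)) := by
        gcongr
        exact h3.trans h6
    _ = _ := by
        rw [mul_right_comm, ← Real.exp_add]
        simp

end LowerBound

section Density

variable {X : Type*} [MeasurableSpace X]

/-- `ρ` has a density with respect to `μ` dominated by `exp g` with `∫ g dρ < a`; this expresses that
the relative entropy of `ρ` with respect to `μ` is less than `a`. -/
def HasEntropyLT (μ ρ : Measure X) (a : ℝ) : Prop :=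
  ∃ f : X → ℝ≥0∞, Measurable f ∧ ρ = μ.withDensity f ∧ ∃ g : X → ℝ, Measurable g ∧
    Integrable g ρ ∧ (∀ x, f x ≤ ENNReal.ofReal (Real.exp (g x))) ∧ ∫ x, g x ∂ρ < a

variable {μ ρ : Measure X} [IsProbabilityMeasure ρ]

/-- A measure whose potential is not constant can be perturbed so as to lower its energy strictly,
at an arbitrarily small cost in entropy. -/
lemma exists_meanEnergy_lt_of_not_ae_const {U : X × X → ℝ} (hU : Measurable U) {K : ℝ}
    (hK : ∀ p, |U p| ≤ K) (hsymm : ∀ x y, U (x, y) = U (y, x)) {a : ℝ}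
    (hent : HasEntropyLT μ ρ a)
    (hV : ¬ ∀ᵐ y ∂ρ, ∫ x, U (x, y) ∂ρ = 2 * meanEnergy U ρ) :
    ∃ ρ' : Measure X, IsProbabilityMeasure ρ' ∧ HasEntropyLT μ ρ' a ∧
      meanEnergy U ρ' < meanEnergy U ρ := by
  obtain ⟨f, hf, hρ, g, hg, hgi, hfg, ha⟩ := hent
  set E := meanEnergy U ρ with hE
  set V : X → ℝ := fun y => ∫ x, U (x, y) ∂ρ with hVdef
  have hVm : Measurable V :=
    (StronglyMeasurable.integral_prod_left' (μ := ρ) (f := U) hU.stronglyMeasurable).measurable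
  have hUi : Integrable U (ρ.prod ρ) :=
    Integrable.of_bound hU.aestronglyMeasurable K (ae_of_all _ fun p => hK p)
  have hVK (y : X) : |V y| ≤ K := by
    have := norm_integral_le_of_norm_le_const (μ := ρ) (f := fun x => U (x, y)) (C := K)
      (ae_of_all _ fun x => hK _)
    simpa using this
  set h : X → ℝ := fun y => 2 * E - V y with hh
  have hhm : Measurable h := hVm.const_sub _
  set C : ℝ := 2 * |E| + K + 1 with hC
  have hK0 : 0 ≤ K := by
    obtain ⟨x⟩ : Nonempty X := nonempty_of_isProbabilityMeasure ρ
    exact (abs_nonneg _).trans (hK (x, x))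
  have hC0 : 0 < C := by positivity
  have hhC (y : X) : |h y| ≤ C := by
    refine (abs_sub _ _).trans ?_
    rw [abs_mul, abs_two]
    linarith [hVK y]
  have hhi : Integrable h ρ :=
    Integrable.of_bound hhm.aestronglyMeasurable C (ae_of_all _ fun y => hhC y)
  have hVi : Integrable V ρ :=
    Integrable.of_bound hVm.aestronglyMeasurable K (ae_of_all _ fun y => hVK y)
  have hVE : ∫ y, V y ∂ρ = 2 * E := by
    rw [hE, meanEnergy, integral_prod_symm _ hUi]
    ring
  have hh0 : ∫ y, h y ∂ρ = 0 := by
    simp only [hh]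
    rw [integral_sub (integrable_const _) hVi, hVE]
    simp
  have hh2i : Integrable (fun y => h y ^ 2) ρ := by
    refine Integrable.of_bound (hhm.pow_const 2).aestronglyMeasurable (C ^ 2) (ae_of_all _ fun y => ?_)
    rw [Real.norm_of_nonneg (sq_nonneg _)]
    exact sq_le_sq' (abs_le.1 (hhC y)).1 (abs_le.1 (hhC y)).2
  have hh2 : 0 < ∫ y, h y ^ 2 ∂ρ := by
    refine lt_of_le_of_ne (integral_nonneg fun y => sq_nonneg _) fun h0 => hV ?_
    rw [eq_comm, integral_eq_zero_iff_of_nonneg (fun y => sq_nonneg _) hh2i] at h0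
    filter_upwards [h0] with y hy
    have : h y = 0 := by simpa using hy
    simp only [hh] at this
    linarith
  have hghi : Integrable (fun y => h y * g y) ρ :=
    hgi.bdd_mul hhm.aestronglyMeasurable (ae_of_all _ fun y => hhC y)
  set D : ℝ := ∫ p, U p * (h p.1 * h p.2) ∂(ρ.prod ρ) with hD
  have hcost : Tendsto (fun t : ℝ => ∫ x, g x ∂ρ + t * ∫ x, h x * g x ∂ρ + Real.log (1 + t * C))
      (nhdsWithin 0 (Ioi 0)) (nhds (∫ x, g x ∂ρ)) := by
    have hc : ContinuousAt
        (fun t : ℝ => ∫ x, g x ∂ρ + t * ∫ x, h x * g x ∂ρ + Real.log (1 + t * C)) 0 := by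
      refine ContinuousAt.add (by fun_prop) (ContinuousAt.log (by fun_prop) (by simp))
    have := hc.tendsto
    simp only [zero_mul, add_zero, Real.log_one] at this
    exact this.mono_left nhdsWithin_le_nhds
  have hsmall : Tendsto (fun t : ℝ => t * (D / 2)) (nhdsWithin 0 (Ioi 0)) (nhds 0) := by
    have hc : ContinuousAt (fun t : ℝ => t * (D / 2)) 0 := by fun_prop
    have := hc.tendsto
    simp only [zero_mul] at this
    exact this.mono_left nhdsWithin_le_nhds
  have hsmall' : Tendsto (fun t : ℝ => t * C) (nhdsWithin 0 (Ioi 0)) (nhds 0) := by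
    have hc : ContinuousAt (fun t : ℝ => t * C) 0 := by fun_prop
    have := hc.tendsto
    simp only [zero_mul] at this
    exact this.mono_left nhdsWithin_le_nhds
  obtain ⟨t, ht1, ht2, ht3, ht0⟩ := ((hcost.eventually_lt_const ha).and
    ((hsmall.eventually_lt_const hh2).and ((hsmall'.eventually_lt_const one_pos).and
      self_mem_nhdsWithin))).exists
  have ht0 : 0 < t := ht0
  have hth (y : X) : |t * h y| ≤ t * C := by
    rw [abs_mul, abs_of_pos ht0]
    exact mul_le_mul_of_nonneg_left (hhC y) ht0.le
  have hpos (y : X) : 0 ≤ 1 + t * h y := by linarith [(abs_le.1 (hth y)).1]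
  have hle (y : X) : 1 + t * h y ≤ 1 + t * C := by linarith [(abs_le.1 (hth y)).2]
  have hdm : Measurable fun y => ENNReal.ofReal (1 + t * h y) := by fun_prop
  set ρ' : Measure X := ρ.withDensity fun y => ENNReal.ofReal (1 + t * h y) with hρ'
  have hintegral (F : X → ℝ) : ∫ x, F x ∂ρ' = ∫ x, (1 + t * h x) * F x ∂ρ := by
    rw [hρ', integral_withDensity_eq_integral_toReal_smul hdm (ae_of_all _ fun _ => by simp)]
    refine integral_congr_ae (ae_of_all _ fun x => ?_)
    simp [ENNReal.toReal_ofReal (hpos x)]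
  have hprob : IsProbabilityMeasure ρ' := by
    have hi : Integrable (fun y => 1 + t * h y) ρ := (integrable_const _).add (hhi.const_mul t)
    constructor
    rw [hρ', withDensity_apply _ MeasurableSet.univ, Measure.restrict_univ,
      ← ofReal_integral_eq_lintegral_ofReal hi (ae_of_all _ hpos),
      integral_add (integrable_const _) (hhi.const_mul t),
      integral_const_mul, hh0]
    simp
  have hgi' : Integrable g ρ' := by
    rw [hρ', integrable_withDensity_iff_integrable_smul' hdm (ae_of_all _ fun _ => by simp)]
    refine ((hgi.add (hghi.const_mul t)).congr (ae_of_all _ fun x => ?_))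
    simp only [ENNReal.toReal_ofReal (hpos x), smul_eq_mul, Pi.add_apply]
    ring
  refine ⟨ρ', hprob, ⟨fun y => f y * ENNReal.ofReal (1 + t * h y), hf.mul hdm, ?_,
    fun y => g y + Real.log (1 + t * C), hg.add_const _, hgi'.add (integrable_const _),
    fun y => ?_, ?_⟩, ?_⟩
  · rw [hρ', hρ]
    exact (withDensity_mul μ hf hdm).symm
  · rw [Real.exp_add, Real.exp_log (by positivity), ENNReal.ofReal_mul (Real.exp_pos _).le]
    exact mul_le_mul' (hfg y) (ENNReal.ofReal_le_ofReal (hle y))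
  · rw [integral_add hgi' (integrable_const _), hintegral]
    have : ∫ x, (1 + t * h x) * g x ∂ρ = ∫ x, g x ∂ρ + t * ∫ x, h x * g x ∂ρ := by
      rw [← integral_const_mul, ← integral_add hgi (hghi.const_mul t)]
      exact integral_congr_ae (ae_of_all _ fun x => by ring)
    rw [this]
    simpa using ht1
  · have hUh1 : Integrable (fun p : X × X => U p * h p.1) (ρ.prod ρ) :=
      Integrable.of_bound (Measurable.aestronglyMeasurable (by fun_prop)) (K * C)
        (ae_of_all _ fun p => by
          rw [Real.norm_eq_abs, abs_mul]
          exact mul_le_mul (hK _) (hhC _) (abs_nonneg _) hK0)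
    have hUh2 : Integrable (fun p : X × X => U p * h p.2) (ρ.prod ρ) :=
      Integrable.of_bound (Measurable.aestronglyMeasurable (by fun_prop)) (K * C)
        (ae_of_all _ fun p => by
          rw [Real.norm_eq_abs, abs_mul]
          exact mul_le_mul (hK _) (hhC _) (abs_nonneg _) hK0)
    have hUhh : Integrable (fun p : X × X => U p * (h p.1 * h p.2)) (ρ.prod ρ) :=
      Integrable.of_bound (Measurable.aestronglyMeasurable (by fun_prop)) (K * (C * C))
        (ae_of_all _ fun p => by
          rw [Real.norm_eq_abs, abs_mul, abs_mul]
          exact mul_le_mul (hK _) (mul_le_mul (hhC _) (hhC _) (abs_nonneg _) hC0.le)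
            (by positivity) hK0)
    have hVh : ∫ y, V y * h y ∂ρ = - ∫ y, h y ^ 2 ∂ρ := by
      have : ∀ y, V y * h y = 2 * E * h y - h y ^ 2 := fun y => by simp only [hh]; ring
      simp_rw [this]
      rw [integral_sub (hhi.const_mul _) hh2i, integral_const_mul, hh0]
      ring
    have e2 : ∫ p, U p * h p.2 ∂(ρ.prod ρ) = - ∫ y, h y ^ 2 ∂ρ := by
      rw [integral_prod_symm _ hUh2, ← hVh]
      simp only [integral_mul_const, hVdef]
    have e1 : ∫ p, U p * h p.1 ∂(ρ.prod ρ) = - ∫ y, h y ^ 2 ∂ρ := by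
      rw [integral_prod _ hUh1, ← hVh]
      simp only [integral_mul_const, hVdef]
      simp_rw [fun x y => hsymm x y]
    have hW : meanEnergy U ρ' = E - t * ∫ y, h y ^ 2 ∂ρ + t ^ 2 * (D / 2) := by
      have hdm2 : Measurable fun p : X × X =>
          ENNReal.ofReal (1 + t * h p.1) * ENNReal.ofReal (1 + t * h p.2) := by fun_prop
      rw [meanEnergy, hρ', prod_withDensity hdm hdm,
        integral_withDensity_eq_integral_toReal_smul hdm2
          (ae_of_all _ fun _ => ENNReal.mul_lt_top (by simp) (by simp))]
      have : ∀ p : X × X, (ENNReal.ofReal (1 + t * h p.1) *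
          ENNReal.ofReal (1 + t * h p.2)).toReal • U p =
          U p + t * (U p * h p.1) + t * (U p * h p.2) + t ^ 2 * (U p * (h p.1 * h p.2)) := by
        intro p
        rw [ENNReal.toReal_mul, ENNReal.toReal_ofReal (hpos _), ENNReal.toReal_ofReal (hpos _),
          smul_eq_mul]
        ring
      simp_rw [this]
      have hi1 : Integrable (fun p => U p + t * (U p * h p.1)) (ρ.prod ρ) :=
        hUi.add (hUh1.const_mul t)
      have hi2 : Integrable (fun p => U p + t * (U p * h p.1) + t * (U p * h p.2)) (ρ.prod ρ) :=
        hi1.add (hUh2.const_mul t)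
      rw [integral_add hi2 (hUhh.const_mul _), integral_add hi1 (hUh2.const_mul t),
        integral_add hUi (hUh1.const_mul t), integral_const_mul, integral_const_mul,
        integral_const_mul, e1, e2, hE, meanEnergy]
      ring
    rw [hW]
    nlinarith

variable [IsProbabilityMeasure μ]

/-- Large deviation lower bound, up to and including measures at the critical energy level. -/
lemma eventually_exp_le_of_hasEntropyLT {U : X × X → ℝ} (hU : Measurable U) {K : ℝ}
    (hK : ∀ p, |U p| ≤ K) (hsymm : ∀ x y, U (x, y) = U (y, x)) {ε : ℝ} (hε : 0 < ε)
    (hρ : meanEnergy U ρ ≤ ε) {a : ℝ} (hent : HasEntropyLT μ ρ a) :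
    ∀ᶠ N : ℕ in atTop, Real.exp (-(N * a)) ≤ (Measure.pi fun _ : Fin N => μ).real
      {q | pairEnergy U q < (N : ℝ) ^ 2 * ε} := by
  obtain ⟨ρ', hp, ⟨f, hf, hρ', g, hg, hgi, hfg, ha⟩, hc⟩ : ∃ ρ' : Measure X,
      IsProbabilityMeasure ρ' ∧ HasEntropyLT μ ρ' a ∧ (meanEnergy U ρ' < ε ∨
        meanEnergy U ρ' = ε ∧ ∀ᵐ y ∂ρ', ∫ x, U (x, y) ∂ρ' = 2 * ε) := by
    obtain h | h := hρ.lt_or_eq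
    · exact ⟨ρ, inferInstance, hent, Or.inl h⟩
    · by_cases hV : ∀ᵐ y ∂ρ, ∫ x, U (x, y) ∂ρ = 2 * meanEnergy U ρ
      · exact ⟨ρ, inferInstance, hent, Or.inr ⟨h, h ▸ hV⟩⟩
      · obtain ⟨ρ', h1, h2, h3⟩ := exists_meanEnergy_lt_of_not_ae_const hU hK hsymm hent hV
        exact ⟨ρ', h1, h2, Or.inl (h ▸ h3)⟩
  obtain ⟨c, hc0, hc⟩ := exists_pos_le_measureReal_pairEnergy_lt hU hK hsymm hε hc
  exact eventually_exp_le_measureReal hf hρ' hg hgi hfg ha hc0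
    (fun N => measurableSet_lt (measurable_pairEnergy hU N) measurable_const) hc

end Density

section Entropy

variable {X : Type*} [MetricSpace X] [MeasurableSpace X]

/-- The Donsker–Varadhan functional of `ρ` with respect to `μ` is at most `h`, that is, the relative
entropy of `ρ` with respect to `μ` is at most `h`. -/
def EntropyLE (μ ρ : Measure X) (h : ℝ) : Prop :=
  ∀ φ : C(X, ℝ), ∫ x, φ x ∂ρ - Real.log (∫ x, Real.exp (φ x) ∂μ) ≤ h

variable {μ ρ : Measure X} [IsProbabilityMeasure μ]

lemma EntropyLE.nonneg {h : ℝ} (H : EntropyLE μ ρ h) : 0 ≤ h := by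
  simpa using H 0

lemma abs_exp_sub_exp_le {a b K : ℝ} (ha : a ≤ K) (hb : b ≤ K) :
    |Real.exp a - Real.exp b| ≤ Real.exp K * |a - b| := by
  wlog hab : b ≤ a generalizing a b
  · rw [abs_sub_comm, abs_sub_comm a]
    exact this hb ha (le_of_not_ge hab)
  rw [abs_of_nonneg (sub_nonneg.2 (Real.exp_le_exp.2 hab)), abs_of_nonneg (sub_nonneg.2 hab)]
  have h1 : Real.exp b = Real.exp a * Real.exp (b - a) := by rw [← Real.exp_add]; ring_nf
  have h2 := Real.add_one_le_exp (b - a)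
  have h3 := Real.exp_le_exp.2 ha
  have h4 := Real.exp_pos a
  nlinarith [mul_le_mul_of_nonneg_right h3 (sub_nonneg.2 hab)]

variable [CompactSpace X] [BorelSpace X] [IsProbabilityMeasure ρ]

/-- The Donsker–Varadhan inequality extends from continuous to bounded measurable functions. -/
lemma EntropyLE.exp_integral_sub_le {h : ℝ} (H : EntropyLE μ ρ h) {φ : X → ℝ} (hφ : Measurable φ)
    {K : ℝ} (hK : ∀ x, |φ x| ≤ K) :
    Real.exp (∫ x, φ x ∂ρ - h) ≤ ∫ x, Real.exp (φ x) ∂μ := by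
  obtain ⟨x0⟩ : Nonempty X := nonempty_of_isProbabilityMeasure ρ
  have hK0 : 0 ≤ K := (abs_nonneg _).trans (hK x0)
  have hφi (ν : Measure X) [IsFiniteMeasure ν] : Integrable φ ν :=
    Integrable.of_bound hφ.aestronglyMeasurable K (ae_of_all _ fun x => hK x)
  have key : ∀ δ > 0, Real.exp (∫ x, φ x ∂ρ - δ - h) ≤
      ∫ x, Real.exp (φ x) ∂μ + Real.exp K * δ := by
    intro δ hδ
    obtain ⟨ψ, hψ, hψi⟩ := (hφi (ρ + μ)).exists_boundedContinuous_integral_sub_le hδ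
    set χ : C(X, ℝ) := ⟨fun x => max (-K) (min K (ψ x)), by fun_prop⟩ with hχ
    have hχK (x : X) : χ x ≤ K := max_le (by linarith) (min_le_left _ _)
    have hχd (x : X) : |φ x - χ x| ≤ |φ x - ψ x| := by
      have h1 : φ x = max (-K) (min K (φ x)) := by
        rw [min_eq_right (abs_le.1 (hK x)).2, max_eq_right (abs_le.1 (hK x)).1]
      have h2 : χ x = max (-K) (min K (ψ x)) := rfl
      rw [h2]
      conv_lhs => rw [h1]
      exact (abs_max_sub_max_le_max _ _ _ _).trans (max_le (by simp) (by
        refine (abs_min_sub_min_le_max _ _ _ _).trans (max_le (by simp) le_rfl)))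
    have hχi (ν : Measure X) [IsFiniteMeasure ν] : Integrable χ ν :=
      χ.continuous.integrable_of_hasCompactSupport (HasCompactSupport.of_compactSpace _)
    have hei (ν : Measure X) [IsFiniteMeasure ν] : Integrable (fun x => Real.exp (χ x)) ν :=
      Continuous.integrable_of_hasCompactSupport (by fun_prop) (HasCompactSupport.of_compactSpace _)
    have hφei : Integrable (fun x => Real.exp (φ x)) μ :=
      Integrable.of_bound (Measurable.aestronglyMeasurable (by fun_prop)) (Real.exp K)
        (ae_of_all _ fun x => by
          rw [Real.norm_of_nonneg (Real.exp_pos _).le]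
          exact Real.exp_le_exp.2 (abs_le.1 (hK x)).2)
    have habs (ν : Measure X) [IsFiniteMeasure ν] : Integrable (fun x => |φ x - χ x|) ν :=
      ((hφi ν).sub (hχi ν)).abs
    have hsum : ∫ x, |φ x - χ x| ∂ρ + ∫ x, |φ x - χ x| ∂μ ≤ δ := by
      rw [← integral_add_measure (habs ρ) (habs μ)]
      refine (integral_mono (habs _) ((hφi _).sub hψi).abs hχd).trans hψ
    have hρ0 : 0 ≤ ∫ x, |φ x - χ x| ∂ρ := integral_nonneg fun _ => abs_nonneg _
    have hμ0 : 0 ≤ ∫ x, |φ x - χ x| ∂μ := integral_nonneg fun _ => abs_nonneg _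
    have h1 : ∫ x, φ x ∂ρ - δ ≤ ∫ x, χ x ∂ρ := by
      have : ∫ x, φ x ∂ρ - ∫ x, χ x ∂ρ ≤ ∫ x, |φ x - χ x| ∂ρ := by
        rw [← integral_sub (hφi ρ) (hχi ρ)]
        exact integral_mono ((hφi ρ).sub (hχi ρ)) (habs ρ) fun x => le_abs_self _
      linarith
    have h2 : ∫ x, Real.exp (χ x) ∂μ ≤ ∫ x, Real.exp (φ x) ∂μ + Real.exp K * δ := by
      have : ∫ x, Real.exp (χ x) ∂μ - ∫ x, Real.exp (φ x) ∂μ ≤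
          ∫ x, Real.exp K * |φ x - χ x| ∂μ := by
        rw [← integral_sub (hei μ) hφei]
        refine integral_mono ((hei μ).sub hφei) ((habs μ).const_mul _) fun x => ?_
        have := abs_exp_sub_exp_le (hχK x) (abs_le.1 (hK x)).2
        rw [abs_sub_comm (χ x)] at this
        exact (le_abs_self _).trans this
      rw [integral_const_mul] at this
      have : Real.exp K * ∫ x, |φ x - χ x| ∂μ ≤ Real.exp K * δ :=
        mul_le_mul_of_nonneg_left (by linarith) (Real.exp_pos _).le
      linarith
    have h3 : 0 < ∫ x, Real.exp (χ x) ∂μ := integral_exp_pos (hei μ)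
    refine le_trans ?_ h2
    rw [← Real.le_log_iff_exp_le h3]
    linarith [H χ]
  have l1 : Tendsto (fun δ : ℝ => Real.exp (∫ x, φ x ∂ρ - δ - h)) (nhdsWithin 0 (Ioi 0))
      (nhds (Real.exp (∫ x, φ x ∂ρ - h))) := by
    have hc : ContinuousAt (fun δ : ℝ => Real.exp (∫ x, φ x ∂ρ - δ - h)) 0 := by fun_prop
    have := hc.tendsto
    simp only [sub_zero] at this
    exact this.mono_left nhdsWithin_le_nhds
  have l2 : Tendsto (fun δ : ℝ => ∫ x, Real.exp (φ x) ∂μ + Real.exp K * δ)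
      (nhdsWithin 0 (Ioi 0)) (nhds (∫ x, Real.exp (φ x) ∂μ)) := by
    have hc : ContinuousAt (fun δ : ℝ => ∫ x, Real.exp (φ x) ∂μ + Real.exp K * δ) 0 := by fun_prop
    have := hc.tendsto
    simp only [mul_zero, add_zero] at this
    exact this.mono_left nhdsWithin_le_nhds
  exact le_of_tendsto_of_tendsto l1 l2 (by
    filter_upwards [self_mem_nhdsWithin] with δ hδ using key δ hδ)

lemma EntropyLE.absolutelyContinuous {h : ℝ} (H : EntropyLE μ ρ h) : ρ ≪ μ := by
  refine Measure.AbsolutelyContinuous.mk fun S hS hμS => ?_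
  by_contra hne
  have hpos : 0 < ρ.real S := ENNReal.toReal_pos hne (measure_ne_top _ _)
  obtain ⟨n, hn⟩ := exists_nat_gt (h / ρ.real S)
  rw [div_lt_iff₀ hpos] at hn
  have hφ : Measurable (S.indicator fun _ => (n : ℝ)) := measurable_const.indicator hS
  have := H.exp_integral_sub_le hφ (K := n) fun x => by
    by_cases hx : x ∈ S <;> simp [hx]
  rw [integral_indicator_const _ hS] at this
  have h1 : ∫ x, Real.exp (S.indicator (fun _ => (n : ℝ)) x) ∂μ = 1 := by
    rw [integral_congr_ae (g := fun _ => (1 : ℝ))]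
    · simp
    · filter_upwards [measure_eq_zero_iff_ae_notMem.1 hμS] with x hx
      simp [hx]
  rw [h1, Real.exp_le_one_iff, smul_eq_mul] at this
  linarith

/-- A bound on the Donsker–Varadhan functional produces a density of controlled entropy. -/
lemma EntropyLE.hasEntropyLT {h a : ℝ} (H : EntropyLE μ ρ h) (ha : h < a) : HasEntropyLT μ ρ a := by
  set f : X → ℝ := fun x => (ρ.rnDeriv μ x).toReal with hf
  have hfm : Measurable f := (Measure.measurable_rnDeriv ρ μ).ennreal_toReal
  have hf0 (x : X) : 0 ≤ f x := ENNReal.toReal_nonneg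
  have hρ : ρ = μ.withDensity fun x => ENNReal.ofReal (f x) := by
    conv_lhs => rw [← Measure.withDensity_rnDeriv_eq ρ μ H.absolutelyContinuous]
    refine withDensity_congr_ae ?_
    filter_upwards [Measure.rnDeriv_lt_top ρ μ] with x hx
    rw [hf, ENNReal.ofReal_toReal hx.ne]
  have hf1 : Integrable f μ ∧ ∫ x, f x ∂μ = 1 := by
    refine ⟨Measure.integrable_toReal_rnDeriv, ?_⟩
    rw [hf, Measure.integral_toReal_rnDeriv H.absolutelyContinuous]
    simp
  obtain ⟨κ, hκ0, hκ⟩ : ∃ κ : ℝ, 0 < κ ∧ h + κ < a := ⟨(a - h) / 2, by linarith, by linarith⟩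
  set g : X → ℝ := fun x => Real.log (f x + κ) with hg
  have hgm : Measurable g := (hfm.add_const κ).log
  have hgκ (x : X) : Real.log κ ≤ g x := Real.log_le_log hκ0 (by linarith [hf0 x])
  have hexpg (x : X) : Real.exp (g x) = f x + κ := Real.exp_log (by linarith [hf0 x])
  set φ : ℕ → X → ℝ := fun n x => min (g x) (Real.log κ + n) with hφ
  have hφm (n : ℕ) : Measurable (φ n) := hgm.min measurable_const
  have hφκ (n : ℕ) (x : X) : Real.log κ ≤ φ n x := le_min (hgκ x) (by simp)
  have hφb (n : ℕ) (x : X) : |φ n x| ≤ |Real.log κ| + n := by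
    rw [abs_le]
    constructor
    · have := neg_abs_le (Real.log κ)
      have := hφκ n x
      have : (0 : ℝ) ≤ n := n.cast_nonneg
      linarith
    · exact (min_le_right _ _).trans (by linarith [le_abs_self (Real.log κ)])
  have hφi (n : ℕ) : Integrable (φ n) ρ :=
    Integrable.of_bound (hφm n).aestronglyMeasurable _ (ae_of_all _ fun x => hφb n x)
  have hint (n : ℕ) : ∫ x, φ n x ∂ρ ≤ h + κ := by
    have h1 := H.exp_integral_sub_le (hφm n) (hφb n)
    have h2 : ∫ x, Real.exp (φ n x) ∂μ ≤ 1 + κ := by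
      have e : ∫ x, (f x + κ) ∂μ = 1 + κ := by
        rw [integral_add hf1.1 (integrable_const _), hf1.2]
        simp
      rw [← e]
      refine integral_mono_of_nonneg (ae_of_all _ fun x => (Real.exp_pos _).le)
        (hf1.1.add (integrable_const _)) (ae_of_all _ fun x => ?_)
      show Real.exp (φ n x) ≤ f x + κ
      rw [← hexpg x]
      exact Real.exp_le_exp.2 (min_le_left _ _)
    have h3 : Real.exp (∫ x, φ n x ∂ρ - h) ≤ Real.exp κ := by
      linarith [Real.add_one_le_exp κ]
    linarith [Real.exp_le_exp.1 h3]
  have hlim : Tendsto (fun n => ∫⁻ x, ENNReal.ofReal (φ n x - Real.log κ) ∂ρ) atTop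
      (nhds (∫⁻ x, ENNReal.ofReal (g x - Real.log κ) ∂ρ)) := by
    refine lintegral_tendsto_of_tendsto_of_monotone
      (fun n => Measurable.aemeasurable (by fun_prop)) (ae_of_all _ fun x m n hmn => ?_)
      (ae_of_all _ fun x => ?_)
    · refine ENNReal.ofReal_le_ofReal (sub_le_sub_right (min_le_min_left _ ?_) _)
      have : (m : ℝ) ≤ n := by exact_mod_cast hmn
      linarith
    · refine tendsto_const_nhds.congr' ?_
      obtain ⟨n, hn⟩ := exists_nat_ge (g x - Real.log κ)
      filter_upwards [eventually_ge_atTop n] with m hm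
      have : (n : ℝ) ≤ m := by exact_mod_cast hm
      rw [show φ m x = g x from min_eq_left (by linarith)]
  have hbound : ∫⁻ x, ENNReal.ofReal (g x - Real.log κ) ∂ρ ≤ ENNReal.ofReal (h + κ - Real.log κ) := by
    refine le_of_tendsto' hlim fun n => ?_
    have hi : Integrable (fun x => φ n x - Real.log κ) ρ := (hφi n).sub (integrable_const _)
    rw [← ofReal_integral_eq_lintegral_ofReal hi
      (ae_of_all _ fun x => sub_nonneg.2 (hφκ n x)), integral_sub (hφi n) (integrable_const _)]
    refine ENNReal.ofReal_le_ofReal ?_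
    simpa using hint n
  have hgi' : Integrable (fun x => g x - Real.log κ) ρ := by
    refine ⟨(hgm.sub_const _).aestronglyMeasurable, ?_⟩
    rw [hasFiniteIntegral_iff_ofReal (ae_of_all _ fun x => sub_nonneg.2 (hgκ x))]
    exact hbound.trans_lt ENNReal.ofReal_lt_top
  have hgi : Integrable g ρ := by
    refine (hgi'.add (integrable_const (Real.log κ))).congr (ae_of_all _ fun x => ?_)
    simp
  refine ⟨fun x => ENNReal.ofReal (f x), hfm.ennreal_ofReal, hρ, g, hgm, hgi, fun x => ?_, ?_⟩
  · rw [hexpg]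
    exact ENNReal.ofReal_le_ofReal (by linarith)
  · rw [← ofReal_integral_eq_lintegral_ofReal hgi' (ae_of_all _ fun x => sub_nonneg.2 (hgκ x)),
      ENNReal.ofReal_le_ofReal_iff', integral_sub hgi (integrable_const _)] at hbound
    have h0 : Real.log κ ≤ h + κ := by
      have := (integral_mono (integrable_const _) (hφi 0) (hφκ 0)).trans (hint 0)
      simpa using this
    obtain hb | hb := hbound <;> simp at hb <;> linarith

end Entropy

section Mixture

variable {X : Type*} [MeasurableSpace X] {N : ℕ}

/-- The uniform mixture of finitely many measures. -/
def mixture (ν : Fin N → Measure X) : Measure X :=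
  (N : ℝ≥0∞)⁻¹ • ∑ i, ν i

lemma isProbabilityMeasure_mixture (hN : N ≠ 0) (ν : Fin N → Measure X)
    [∀ i, IsProbabilityMeasure (ν i)] : IsProbabilityMeasure (mixture ν) := by
  constructor
  simp only [mixture, Measure.smul_apply, Measure.finsetSum_apply, measure_univ, smul_eq_mul,
    Finset.sum_const, Finset.card_univ, Fintype.card_fin, nsmul_eq_mul, mul_one]
  exact ENNReal.inv_mul_cancel (by simpa using hN) (by simp)

lemma integral_mixture (ν : Fin N → Measure X) {F : X → ℝ} (hF : ∀ i, Integrable F (ν i)) :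
    ∫ x, F x ∂(mixture ν) = (N : ℝ)⁻¹ * ∑ i, ∫ x, F x ∂(ν i) := by
  rw [mixture, integral_smul_measure, integral_finsetSum_measure fun i _ => hF i]
  simp

lemma sum_sum_eq_two_mul_add_diag {a : Fin N → Fin N → ℝ} (ha : ∀ i j, a i j = a j i) :
    ∑ i, ∑ j, a i j =
      2 * (∑ i : Fin N, ∑ j : Fin N, if (i : ℕ) < (j : ℕ) then a i j else 0) + ∑ i, a i i := by
  have h1 : (∑ i : Fin N, ∑ j : Fin N, if (i : ℕ) < (j : ℕ) then a i j else 0) =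
      ∑ i : Fin N, ∑ j : Fin N, if (j : ℕ) < (i : ℕ) then a i j else 0 := by
    rw [Finset.sum_comm]
    simp_rw [fun i j => ha i j]
  have h2 : ∑ i, a i i = ∑ i : Fin N, ∑ j : Fin N, if i = j then a i j else 0 := by simp
  rw [two_mul]
  conv_rhs => rw [h2]; arg 1; arg 2; rw [h1]
  simp_rw [← Finset.sum_add_distrib]
  refine Finset.sum_congr rfl fun i _ => Finset.sum_congr rfl fun j _ => ?_
  obtain h | h | h := lt_trichotomy i j
  · have h' : (i : ℕ) < j := h
    simp [h', h.ne, h'.not_gt]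
  · simp [h]
  · have h' : (j : ℕ) < i := h
    simp [h', h.ne', h'.not_gt]

/-- The mean-field energy of a mixture of measures localized near the points of a configuration is
controlled by the energy of that configuration. -/
lemma meanEnergy_mixture_le {U : X × X → ℝ} (hU : Measurable U) {K : ℝ} (hK : ∀ p, |U p| ≤ K)
    (hsymm : ∀ x y, U (x, y) = U (y, x)) (hN : N ≠ 0) (ν : Fin N → Measure X)
    [∀ i, IsProbabilityMeasure (ν i)] (q : Fin N → X) {η : ℝ}
    (hη : ∀ i j, ∫ x, ∫ y, U (x, y) ∂(ν j) ∂(ν i) ≤ U (q i, q j) + η) :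
    meanEnergy U (mixture ν) ≤ pairEnergy U q / N ^ 2 + K / (2 * N) + η / 2 := by
  have := isProbabilityMeasure_mixture hN ν
  have hb (ρ : Measure X) [IsProbabilityMeasure ρ] (x : X) : Integrable (fun y => U (x, y)) ρ :=
    Integrable.of_bound (Measurable.aestronglyMeasurable (by fun_prop)) K (ae_of_all _ fun y => hK _)
  have hm (ρ : Measure X) [IsProbabilityMeasure ρ] : Measurable fun x => ∫ y, U (x, y) ∂ρ :=
    (StronglyMeasurable.integral_prod_right' (ν := ρ) (f := U) hU.stronglyMeasurable).measurable
  have hbb (ρ ρ' : Measure X) [IsProbabilityMeasure ρ] [IsProbabilityMeasure ρ'] :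
      Integrable (fun x => ∫ y, U (x, y) ∂ρ) ρ' := by
    refine Integrable.of_bound (hm ρ).aestronglyMeasurable K (ae_of_all _ fun x => ?_)
    have := norm_integral_le_of_norm_le_const (μ := ρ) (f := fun y => U (x, y)) (C := K)
      (ae_of_all _ fun y => hK _)
    simpa using this
  have h1 : ∫ p, U p ∂((mixture ν).prod (mixture ν)) =
      (N : ℝ)⁻¹ * ((N : ℝ)⁻¹ * ∑ i, ∑ j, ∫ x, ∫ y, U (x, y) ∂(ν j) ∂(ν i)) := by
    rw [integral_prod _ (Integrable.of_bound hU.aestronglyMeasurable K (ae_of_all _ fun p => hK p))]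
    have e (x : X) : ∫ y, U (x, y) ∂(mixture ν) = (N : ℝ)⁻¹ * ∑ j, ∫ y, U (x, y) ∂(ν j) :=
      integral_mixture ν fun i => hb (ν i) x
    simp_rw [e]
    rw [integral_const_mul, integral_mixture ν fun i => integrable_finsetSum _ fun j _ => hbb _ _]
    congr 2
    refine Finset.sum_congr rfl fun i _ => ?_
    rw [integral_finsetSum _ fun j _ => hbb _ _]
  have h2 : ∑ i, ∑ j, ∫ x, ∫ y, U (x, y) ∂(ν j) ∂(ν i) ≤ 2 * pairEnergy U q + N * K + N ^ 2 * η := by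
    calc _ ≤ ∑ i, ∑ j, (U (q i, q j) + η) :=
          Finset.sum_le_sum fun i _ => Finset.sum_le_sum fun j _ => hη i j
      _ = 2 * pairEnergy U q + ∑ i, U (q i, q i) + N ^ 2 * η := by
          simp_rw [Finset.sum_add_distrib]
          rw [sum_sum_eq_two_mul_add_diag fun i j => hsymm (q i) (q j), pairEnergy]
          simp
          ring
      _ ≤ 2 * pairEnergy U q + N * K + N ^ 2 * η := by
          have : ∑ i, U (q i, q i) ≤ ∑ i : Fin N, K :=
            Finset.sum_le_sum fun i _ => (abs_le.1 (hK _)).2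
          simp at this
          linarith
  have hNpos : (0 : ℝ) < N := by exact_mod_cast Nat.pos_of_ne_zero hN
  rw [meanEnergy, h1]
  calc _ = (∑ i, ∑ j, ∫ x, ∫ y, U (x, y) ∂(ν j) ∂(ν i)) / (2 * N ^ 2) := by field_simp
    _ ≤ (2 * pairEnergy U q + N * K + N ^ 2 * η) / (2 * N ^ 2) := by gcongr
    _ = _ := by field_simp

end Mixture

section UpperBound

variable {X : Type*} [MetricSpace X] [CompactSpace X] [MeasurableSpace X] [BorelSpace X]
  {U : X × X → ℝ}

lemma continuous_meanEnergy (hU : Continuous U) :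
    Continuous fun ρ : ProbabilityMeasure X => meanEnergy U (ρ : Measure X) := by
  have h1 : Continuous fun ρ : ProbabilityMeasure X => ρ.prod ρ :=
    ProbabilityMeasure.continuous_prod.comp (continuous_id.prodMk continuous_id)
  exact ((ProbabilityMeasure.continuous_integral_continuousMap
    (⟨U, hU⟩ : C(X × X, ℝ))).comp h1).div_const 2

variable {μ : Measure X}

/-- If no measure of energy at most `ε` has entropy at most `h`, then finitely many test functions
witness this, with some room in the energy. -/
lemma exists_finset_of_forall_not_entropyLE (hU : Continuous U) {ε h : ℝ}
    (H : ∀ ρ : ProbabilityMeasure X, meanEnergy U (ρ : Measure X) ≤ ε → ¬ EntropyLE μ ρ h) :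
    ∃ δ > 0, ∃ s : Finset C(X, ℝ), ∀ ρ : ProbabilityMeasure X, meanEnergy U (ρ : Measure X) ≤ ε + δ →
      ∃ φ ∈ s, h < ∫ x, φ x ∂(ρ : Measure X) - Real.log (∫ x, Real.exp (φ x) ∂μ) := by
  let O : C(X, ℝ) ⊕ ℕ → Set (ProbabilityMeasure X) := Sum.elim
    (fun φ => {ρ | h < ∫ x, φ x ∂(ρ : Measure X) - Real.log (∫ x, Real.exp (φ x) ∂μ)})
    (fun n => {ρ | ε + 1 / ((n : ℝ) + 1) < meanEnergy U (ρ : Measure X)})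
  have hO : ∀ i, IsOpen (O i) := by
    rintro (φ | n)
    · exact isOpen_lt continuous_const
        ((ProbabilityMeasure.continuous_integral_continuousMap φ).sub continuous_const)
    · exact isOpen_lt continuous_const (continuous_meanEnergy hU)
  have hcover : univ ⊆ ⋃ i, O i := by
    intro ρ _
    rw [mem_iUnion]
    by_cases hρ : meanEnergy U (ρ : Measure X) ≤ ε
    · have := H ρ hρ
      simp only [EntropyLE, not_forall, not_le] at this
      obtain ⟨φ, hφ⟩ := this
      exact ⟨Sum.inl φ, hφ⟩
    · obtain ⟨n, hn⟩ := exists_nat_one_div_lt (sub_pos.2 (not_le.1 hρ))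
      refine ⟨Sum.inr n, ?_⟩
      show ε + 1 / ((n : ℝ) + 1) < meanEnergy U (ρ : Measure X)
      linarith
  obtain ⟨t, ht⟩ := isCompact_univ.elim_finite_subcover O hO hcover
  refine ⟨1 / ((t.toRight.sup id : ℕ) + 1), by positivity, t.toLeft, fun ρ hρ => ?_⟩
  obtain ⟨i, hi, hρi⟩ := mem_iUnion₂.1 (ht (mem_univ ρ))
  obtain φ | n := i
  · exact ⟨φ, Finset.mem_toLeft.2 hi, hρi⟩
  · have hn : n ≤ t.toRight.sup id := Finset.le_sup (f := id) (Finset.mem_toRight.2 hi)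
    have hn' : 1 / (((t.toRight.sup id : ℕ) : ℝ) + 1) ≤ 1 / ((n : ℝ) + 1) := by
      have : (n : ℝ) ≤ (t.toRight.sup id : ℕ) := by exact_mod_cast hn
      gcongr
    have hρi : ε + 1 / ((n : ℝ) + 1) < meanEnergy U (ρ : Measure X) := hρi
    linarith

variable [IsProbabilityMeasure μ]

lemma measureReal_pi_sum_ge_le (φ : C(X, ℝ)) (h : ℝ) (N : ℕ) :
    (Measure.pi fun _ : Fin N => μ).real
      {q | N * (h + Real.log (∫ x, Real.exp (φ x) ∂μ)) ≤ ∑ i, φ (q i)} ≤ Real.exp (-(N * h)) := by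
  have hei : Integrable (fun x => Real.exp (φ x)) μ :=
    Continuous.integrable_of_hasCompactSupport (by fun_prop) (HasCompactSupport.of_compactSpace _)
  have hZ : 0 < ∫ x, Real.exp (φ x) ∂μ := integral_exp_pos hei
  have hpi : Integrable (fun q : Fin N → X => ∏ i, Real.exp (φ (q i)))
      (Measure.pi fun _ : Fin N => μ) := Integrable.fintype_prod (f := fun _ x => Real.exp (φ x))
        fun _ => hei
  have hmarkov := mul_meas_ge_le_integral_of_nonneg
    (ae_of_all _ fun q : Fin N → X => Finset.prod_nonneg fun i _ => (Real.exp_pos (φ (q i))).le) hpi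
    (Real.exp (N * (h + Real.log (∫ x, Real.exp (φ x) ∂μ))))
  rw [integral_fintype_prod_eq_pow (fun x => Real.exp (φ x)), Fintype.card_fin] at hmarkov
  simp_rw [← Real.exp_sum, Real.exp_le_exp] at hmarkov
  rw [mul_add, Real.exp_add, ← Real.log_pow, Real.exp_log (by positivity)] at hmarkov
  rw [Real.exp_neg, ← one_div, le_div_iff₀' (Real.exp_pos _)]
  have : 0 < (∫ x, Real.exp (φ x) ∂μ) ^ N := by positivity
  simp only [mul_add, Real.log_pow] at hmarkov ⊢
  refine le_of_mul_le_mul_right ?_ this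
  linarith

/-- Large deviation upper bound. -/
lemma eventually_measureReal_le (hU : Continuous U) {K : ℝ} (hK : ∀ p, |U p| ≤ K)
    (hsymm : ∀ x y, U (x, y) = U (y, x)) {ε h δ : ℝ} (hδ : 0 < δ) {s : Finset C(X, ℝ)}
    (H : ∀ ρ : ProbabilityMeasure X, meanEnergy U (ρ : Measure X) ≤ ε + δ →
      ∃ φ ∈ s, h < ∫ x, φ x ∂(ρ : Measure X) - Real.log (∫ x, Real.exp (φ x) ∂μ)) :
    ∀ᶠ N : ℕ in atTop, (Measure.pi fun _ : Fin N => μ).real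
      {q | pairEnergy U q < (N : ℝ) ^ 2 * ε} ≤ s.card * Real.exp (-(N * h)) := by
  have hlim : Tendsto (fun N : ℕ => K / (2 * (N : ℝ))) atTop (nhds 0) :=
    tendsto_const_nhds.div_atTop (tendsto_natCast_atTop_atTop.const_mul_atTop two_pos)
  filter_upwards [eventually_ge_atTop 1, hlim.eventually_lt_const hδ] with N hN1 hNK
  have hN : N ≠ 0 := by omega
  have hNpos : (0 : ℝ) < N := by exact_mod_cast hN1
  have hsub : {q : Fin N → X | pairEnergy U q < (N : ℝ) ^ 2 * ε} ⊆
      ⋃ φ ∈ s, {q | N * (h + Real.log (∫ x, Real.exp (φ x) ∂μ)) ≤ ∑ i, φ (q i)} := by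
    intro q hq
    have hq : pairEnergy U q < (N : ℝ) ^ 2 * ε := hq
    set ν : Fin N → Measure X := fun i => Measure.dirac (q i) with hν
    have hprob := isProbabilityMeasure_mixture hN ν
    have hmE := meanEnergy_mixture_le hU.measurable hK hsymm hN ν q (η := 0)
      (fun i j => by simp [hν])
    have hq' : pairEnergy U q / N ^ 2 < ε := by
      rw [div_lt_iff₀ (by positivity)]
      linarith
    obtain ⟨φ, hφs, hφ⟩ := H ⟨mixture ν, hprob⟩ (by
      simp only [ProbabilityMeasure.coe_mk]
      linarith)
    refine mem_iUnion₂.2 ⟨φ, hφs, ?_⟩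
    have hφ : h < ∫ x, φ x ∂(mixture ν) - Real.log (∫ x, Real.exp (φ x) ∂μ) := hφ
    rw [integral_mixture ν fun i => φ.continuous.integrable_of_hasCompactSupport
      (HasCompactSupport.of_compactSpace _)] at hφ
    simp only [hν, integral_dirac] at hφ
    show N * (h + Real.log (∫ x, Real.exp (φ x) ∂μ)) ≤ ∑ i, φ (q i)
    have : h + Real.log (∫ x, Real.exp (φ x) ∂μ) ≤ (N : ℝ)⁻¹ * ∑ i, φ (q i) := by linarith
    calc _ ≤ N * ((N : ℝ)⁻¹ * ∑ i, φ (q i)) := by gcongr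
      _ = _ := by field_simp
  calc _ ≤ _ := measureReal_mono hsub (measure_ne_top _ _)
    _ ≤ _ := measureReal_biUnion_finset_le _ _
    _ ≤ ∑ φ ∈ s, Real.exp (-(N * h)) :=
      Finset.sum_le_sum fun φ _ => measureReal_pi_sum_ge_le φ h N
    _ = _ := by simp

end UpperBound

section FiniteEntropy

variable {X : Type*} [MetricSpace X] [CompactSpace X] [MeasurableSpace X] [BorelSpace X]
  {U : X × X → ℝ} {μ ρ : Measure X} [IsProbabilityMeasure μ] [IsProbabilityMeasure ρ]

lemma entropyLE_of_le_smul {C : ℝ≥0∞} (hC : C ≠ ∞) (hle : ρ ≤ C • μ) :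
    EntropyLE μ ρ (Real.log C.toReal) := by
  intro φ
  have hei (ν : Measure X) [IsFiniteMeasure ν] : Integrable (fun x => Real.exp (φ x)) ν :=
    Continuous.integrable_of_hasCompactSupport (by fun_prop) (HasCompactSupport.of_compactSpace _)
  have hφi : Integrable φ ρ :=
    φ.continuous.integrable_of_hasCompactSupport (HasCompactSupport.of_compactSpace _)
  have h1 : Real.exp (∫ x, φ x ∂ρ) ≤ ∫ x, Real.exp (φ x) ∂ρ :=
    convexOn_exp.map_integral_le Real.continuous_exp.continuousOn isClosed_univ (by simp) hφi (hei ρ)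
  have h2 : ∫ x, Real.exp (φ x) ∂ρ ≤ C.toReal * ∫ x, Real.exp (φ x) ∂μ := by
    rw [← smul_eq_mul, ← integral_smul_measure]
    exact integral_mono_measure hle (ae_of_all _ fun x => (Real.exp_pos _).le)
      ((hei μ).smul_measure hC)
  have hZ : 0 < ∫ x, Real.exp (φ x) ∂μ := integral_exp_pos (hei μ)
  have hpos : 0 < C.toReal * ∫ x, Real.exp (φ x) ∂μ := (Real.exp_pos _).trans_le (h1.trans h2)
  have h3 := (Real.le_log_iff_exp_le hpos).2 (h1.trans h2)
  rw [Real.log_mul (left_ne_zero_of_mul hpos.ne') hZ.ne'] at h3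
  linarith

/-- Any energy level above the energy of some measure is reached by a measure of finite entropy. -/
lemma exists_entropyLE_of_meanEnergy_lt [μ.IsOpenPosMeasure] (hU : Continuous U) {K : ℝ}
    (hK : ∀ p, |U p| ≤ K) (hsymm : ∀ x y, U (x, y) = U (y, x)) {ε : ℝ}
    (hρ : meanEnergy U ρ < ε) :
    ∃ h : ℝ, ∃ ρ' : ProbabilityMeasure X, meanEnergy U (ρ' : Measure X) ≤ ε ∧ EntropyLE μ ρ' h := by
  set E := meanEnergy U ρ with hE
  obtain ⟨η, hη0, hη⟩ : ∃ η : ℝ, 0 < η ∧ E + η < ε := ⟨(ε - E) / 2, by linarith, by linarith⟩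
  have hlim : Tendsto (fun N : ℕ => (K / 2 + |E|) / (N : ℝ)) atTop (nhds 0) :=
    tendsto_const_nhds.div_atTop tendsto_natCast_atTop_atTop
  obtain ⟨N, hN1, hNK⟩ := ((eventually_ge_atTop 1).and
    (hlim.eventually_lt_const (half_pos hη0))).exists
  have hN : N ≠ 0 := by omega
  have hNpos : (0 : ℝ) < N := by exact_mod_cast hN1
  obtain ⟨q, hq⟩ := exists_le_integral (Integrable.of_bound
    (measurable_pairEnergy hU.measurable N).aestronglyMeasurable (N ^ 2 * K)
    (ae_of_all (Measure.pi fun _ : Fin N => ρ) fun q => abs_pairEnergy_le hK q))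
  rw [integral_pairEnergy hU.measurable hK] at hq
  have huc : UniformContinuous U := CompactSpace.uniformContinuous_of_continuous hU
  obtain ⟨r, hr0, hr⟩ := Metric.uniformContinuous_iff.1 huc η hη0
  set ν : Fin N → Measure X := fun i => ProbabilityTheory.cond μ (Metric.ball (q i) r) with hν
  have hB (i : Fin N) : μ (Metric.ball (q i) r) ≠ 0 :=
    (Metric.measure_ball_pos μ (q i) hr0).ne'
  have hνp (i : Fin N) : IsProbabilityMeasure (ν i) :=
    ProbabilityTheory.cond_isProbabilityMeasure (hB i)
  have hprob := isProbabilityMeasure_mixture hN ν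
  have hνae (i : Fin N) : ∀ᵐ x ∂(ν i), x ∈ Metric.ball (q i) r :=
    ProbabilityTheory.ae_cond_mem measurableSet_ball
  have hmE := meanEnergy_mixture_le hU.measurable hK hsymm hN ν q (η := η) fun i j => by
    have hb (x : X) : |∫ y, U (x, y) ∂(ν j)| ≤ K := by
      have := norm_integral_le_of_norm_le_const (μ := ν j) (f := fun y => U (x, y)) (C := K)
        (ae_of_all _ fun y => hK _)
      simpa using this
    have hm : Measurable fun x => ∫ y, U (x, y) ∂(ν j) :=
      (StronglyMeasurable.integral_prod_right' (ν := ν j) (f := U)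
        hU.measurable.stronglyMeasurable).measurable
    have hle : ∀ᵐ x ∂(ν i), ∫ y, U (x, y) ∂(ν j) ≤ U (q i, q j) + η := by
      filter_upwards [hνae i] with x hx
      have : ∀ᵐ y ∂(ν j), U (x, y) ≤ U (q i, q j) + η := by
        filter_upwards [hνae j] with y hy
        have := hr (a := (x, y)) (b := (q i, q j)) (max_lt hx hy)
        rw [Real.dist_eq] at this
        linarith [(abs_lt.1 this).2]
      refine (integral_mono_ae (Integrable.of_bound (Continuous.aestronglyMeasurable (by fun_prop)) K
        (ae_of_all _ fun y => hK _)) (integrable_const _) this).trans ?_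
      simp
    refine (integral_mono_ae (Integrable.of_bound hm.aestronglyMeasurable K
        (ae_of_all _ fun y => hb _)) (integrable_const _) hle).trans ?_
    simp
  refine ⟨_, ⟨mixture ν, hprob⟩, ?_, entropyLE_of_le_smul (ρ := mixture ν)
    (C := (N : ℝ≥0∞)⁻¹ * ∑ i, (μ (Metric.ball (q i) r))⁻¹) ?_ ?_⟩
  · simp only [ProbabilityMeasure.coe_mk]
    have h1 : pairEnergy U q / N ^ 2 ≤ E + |E| / N := by
      rw [div_le_iff₀ (by positivity)]
      refine hq.trans ?_
      have : (E + |E| / N) * N ^ 2 = N * (N * E + |E|) := by field_simp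
      rw [this, mul_assoc]
      refine mul_le_mul_of_nonneg_left ?_ hNpos.le
      linarith [neg_abs_le E]
    have h2 : K / (2 * N) + |E| / N = (K / 2 + |E|) / N := by field_simp
    linarith
  · refine ENNReal.mul_ne_top (by simpa using hN) ?_
    exact ENNReal.sum_ne_top.2 fun i _ => ENNReal.inv_ne_top.2 (hB i)
  · rw [mixture, mul_smul, Finset.sum_smul]
    gcongr with i
    simp only [hν, ProbabilityTheory.cond]
    gcongr
    exact Measure.restrict_le_self

end FiniteEntropy

section Limit

variable {X : Type*} [MetricSpace X] [MeasurableSpace X]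

/-- The entropy bounds attained by measures of energy at most `ε`. -/
def entropyBounds (μ : Measure X) (U : X × X → ℝ) (ε : ℝ) : Set ℝ :=
  {h | ∃ ρ : ProbabilityMeasure X, meanEnergy U (ρ : Measure X) ≤ ε ∧ EntropyLE μ ρ h}

/-- The least entropy relative to `μ` of a measure of energy at most `ε`. -/
def minEntropy (μ : Measure X) (U : X × X → ℝ) (ε : ℝ) : ℝ :=
  sInf (entropyBounds μ U ε)

variable {μ : Measure X} {U : X × X → ℝ} {ε ε' h h' : ℝ}

lemma mem_entropyBounds_mono (hε : ε ≤ ε') (hh : h ≤ h') (H : h ∈ entropyBounds μ U ε) :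
    h' ∈ entropyBounds μ U ε' := by
  obtain ⟨ρ, hρ, hρh⟩ := H
  exact ⟨ρ, hρ.trans hε, fun φ => (hρh φ).trans hh⟩

variable [IsProbabilityMeasure μ]

lemma nonneg_of_mem_entropyBounds (H : h ∈ entropyBounds μ U ε) : 0 ≤ h := by
  obtain ⟨ρ, -, hρh⟩ := H
  exact hρh.nonneg

lemma bddBelow_entropyBounds : BddBelow (entropyBounds μ U ε) :=
  ⟨0, fun _ => nonneg_of_mem_entropyBounds⟩

lemma minEntropy_nonneg : 0 ≤ minEntropy μ U ε :=
  Real.sInf_nonneg fun _ => nonneg_of_mem_entropyBounds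

lemma notMem_entropyBounds_of_lt (H : h < minEntropy μ U ε) : h ∉ entropyBounds μ U ε :=
  fun hmem => H.not_ge (csInf_le bddBelow_entropyBounds hmem)

lemma minEntropy_anti (hne : (entropyBounds μ U ε).Nonempty) (hε : ε ≤ ε') :
    minEntropy μ U ε' ≤ minEntropy μ U ε :=
  csInf_le_csInf bddBelow_entropyBounds hne fun _ => mem_entropyBounds_mono hε le_rfl

variable [CompactSpace X] [BorelSpace X]

lemma exists_finset_of_lt_minEntropy (hU : Continuous U) (H : h < minEntropy μ U ε) :
    ∃ δ > 0, ∃ s : Finset C(X, ℝ), ∀ ρ : ProbabilityMeasure X, meanEnergy U (ρ : Measure X) ≤ ε + δ →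
      ∃ φ ∈ s, h < ∫ x, φ x ∂(ρ : Measure X) - Real.log (∫ x, Real.exp (φ x) ∂μ) :=
  exists_finset_of_forall_not_entropyLE hU fun ρ hρ hρh =>
    notMem_entropyBounds_of_lt H ⟨ρ, hρ, hρh⟩

lemma continuousWithinAt_minEntropy (hU : Continuous U) (hne : (entropyBounds μ U ε).Nonempty) :
    ContinuousWithinAt (minEntropy μ U) (Ici ε) ε := by
  refine tendsto_order.2 ⟨fun a ha => ?_, fun a ha => ?_⟩
  · obtain ⟨h, hah, hh⟩ := exists_between ha
    obtain ⟨δ, hδ, s, hs⟩ := exists_finset_of_lt_minEntropy hU hh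
    have hlt : ∀ᶠ ε' in nhdsWithin ε (Ici ε), ε' < ε + δ :=
      nhdsWithin_le_nhds (eventually_lt_nhds (by linarith))
    filter_upwards [hlt, self_mem_nhdsWithin] with ε' h1 h2
    obtain ⟨b, hb⟩ := hne
    refine hah.trans_le (le_csInf ⟨b, mem_entropyBounds_mono h2 le_rfl hb⟩ ?_)
    rintro c ⟨ρ, hρ, hρc⟩
    obtain ⟨φ, -, hφ⟩ := hs ρ (hρ.trans h1.le)
    exact hφ.le.trans (hρc φ)
  · filter_upwards [self_mem_nhdsWithin] with ε' h2
    exact (minEntropy_anti hne h2).trans_lt ha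

/-- Large deviation principle for the sublevel sets of the energy. -/
lemma tendsto_log_measureReal (hU : Continuous U) {K : ℝ} (hK : ∀ p, |U p| ≤ K)
    (hsymm : ∀ x y, U (x, y) = U (y, x)) (hε : 0 < ε) (hne : (entropyBounds μ U ε).Nonempty) :
    Tendsto (fun N : ℕ => (1 / (N : ℝ)) * Real.log ((Measure.pi fun _ : Fin N => μ).real
      {q | pairEnergy U q < (N : ℝ) ^ 2 * ε})) atTop (nhds (-minEntropy μ U ε)) := by
  have hlow {a : ℝ} (ha : minEntropy μ U ε < a) : ∀ᶠ N : ℕ in atTop, Real.exp (-(N * a)) ≤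
      (Measure.pi fun _ : Fin N => μ).real {q | pairEnergy U q < (N : ℝ) ^ 2 * ε} := by
    obtain ⟨h, ⟨ρ, hρ, hρh⟩, hha⟩ := exists_lt_of_csInf_lt hne ha
    exact eventually_exp_le_of_hasEntropyLT hU.measurable hK hsymm hε hρ (hρh.hasEntropyLT hha)
  refine tendsto_order.2 ⟨fun a ha => ?_, fun b hb => ?_⟩
  · obtain ⟨c, hc, hca⟩ := exists_between (lt_neg.1 ha)
    filter_upwards [hlow hc, eventually_gt_atTop 0] with N hN hN0
    have hNpos : (0 : ℝ) < N := by exact_mod_cast hN0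
    have h1 := (Real.le_log_iff_exp_le ((Real.exp_pos _).trans_le hN)).2 hN
    rw [one_div, ← div_eq_inv_mul, lt_div_iff₀ hNpos]
    nlinarith
  · obtain ⟨h, hbh, hh⟩ := exists_between (neg_lt.1 hb)
    obtain ⟨δ, hδ, s, hs⟩ := exists_finset_of_lt_minEntropy hU hh
    have hlim : Tendsto (fun N : ℕ => Real.log s.card / (N : ℝ)) atTop (nhds 0) :=
      tendsto_const_nhds.div_atTop tendsto_natCast_atTop_atTop
    filter_upwards [hlow (lt_add_one _), eventually_gt_atTop 0,
      eventually_measureReal_le hU hK hsymm hδ hs,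
      hlim.eventually_lt_const (show 0 < b + h by linarith)] with N hN hN0 hup hsN
    have hNpos : (0 : ℝ) < N := by exact_mod_cast hN0
    have hP := (Real.exp_pos _).trans_le hN
    have hcard : (s.card : ℝ) ≠ 0 := left_ne_zero_of_mul (hP.trans_le hup).ne'
    have h1 := Real.log_le_log hP hup
    rw [Real.log_mul hcard (Real.exp_pos _).ne', Real.log_exp] at h1
    rw [div_lt_iff₀ hNpos] at hsN
    rw [one_div, ← div_eq_inv_mul, div_lt_iff₀ hNpos]
    linarith

end Limit

section Transfer

lemma map_comap_val {E : Type*} [MeasurableSpace E] {S : Set E} (hS : MeasurableSet S)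
    {m : Measure E} (hm : m Sᶜ = 0) : (m.comap (Subtype.val : S → E)).map Subtype.val = m := by
  rw [map_comap_subtype_coe hS]
  exact Measure.restrict_eq_self_of_ae_mem (measure_eq_zero_iff_ae_notMem.1 hm |>.mono fun x hx => by
    simpa using hx)

lemma isProbabilityMeasure_comap_val {E : Type*} [MeasurableSpace E] {S : Set E}
    (hS : MeasurableSet S) {m : Measure E} [IsProbabilityMeasure m] (hm : m Sᶜ = 0) :
    IsProbabilityMeasure (m.comap (Subtype.val : S → E)) := by
  constructor
  have h := congrArg (fun ν : Measure E => ν univ) (map_comap_val hS hm)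
  simpa [Measure.map_apply measurable_subtype_coe MeasurableSet.univ] using h

variable {Λ : Set Euc}

lemma piNormLeb_eq_pi [IsFiniteMeasure (ProbabilityTheory.cond (volume : Measure Euc) Λ)] (N : ℕ) :
    piNormLeb Λ N = Measure.pi fun _ : Fin N => ProbabilityTheory.cond volume Λ := by
  refine (Measure.pi_eq fun s _ => ?_).symm
  rw [piNormLeb, volume_pi, Measure.restrict_pi_pi]
  simp [ProbabilityTheory.cond, Measure.pi_pi, Finset.prod_mul_distrib, ENNReal.inv_pow]

lemma cond_compl_closure (hΛopen : IsOpen Λ) :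
    ProbabilityTheory.cond volume Λ (closure Λ)ᶜ = 0 := by
  have : Λ ∩ (closure Λ)ᶜ = ∅ := by
    rw [← sdiff_eq, sdiff_eq_empty]
    exact subset_closure
  rw [ProbabilityTheory.cond_apply hΛopen.measurableSet]
  simp [this]

lemma isOpenPosMeasure_comap_cond (hΛopen : IsOpen Λ) (hfin : volume Λ ≠ ∞) :
    ((ProbabilityTheory.cond volume Λ).comap (Subtype.val : closure Λ → Euc)).IsOpenPosMeasure := by
  refine ⟨fun O hO hne => ?_⟩
  obtain ⟨V, hV, rfl⟩ := isOpen_induced_iff.1 hO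
  obtain ⟨⟨x, hx⟩, hxV⟩ := hne
  have hne' : (V ∩ Λ).Nonempty := mem_closure_iff.1 hx V hV hxV
  rw [← Measure.map_apply measurable_subtype_coe hV.measurableSet,
    map_comap_val isClosed_closure.measurableSet (cond_compl_closure hΛopen),
    ProbabilityTheory.cond_apply hΛopen.measurableSet, inter_comm]
  exact mul_ne_zero (ENNReal.inv_ne_zero.2 hfin)
    ((hV.inter hΛopen).measure_pos volume hne').ne'

lemma pairing_map_val {S : Set Euc} (hS : MeasurableSet S) (U : Euc → Euc → ℝ) (ρ : Measure S)
    [IsProbabilityMeasure ρ] {W : S × S → ℝ} (hW : ∀ p, W p = U p.1 p.2)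
    (hWi : Integrable W (ρ.prod ρ)) :
    pairing U (ρ.map Subtype.val) (ρ.map Subtype.val) = meanEnergy W ρ := by
  have he := MeasurableEmbedding.subtype_coe hS
  rw [pairing, meanEnergy, he.integral_map, integral_prod _ hWi, ← integral_div]
  refine integral_congr_ae (ae_of_all _ fun x => ?_)
  simp only [he.integral_map, hW, integral_div]

end Transfer

end MeanFieldLDP

open MeanFieldLDP

theorem statement9
    (Λ : Set Euc) (hΛne : Λ.Nonempty) (hΛopen : IsOpen Λ)
    (hΛbdd : Bornology.IsBounded Λ) (hΛconn : IsConnected Λ)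
    (U : Euc → Euc → ℝ)
    (hUnonneg : ∀ x ∈ closure Λ, ∀ y ∈ closure Λ, 0 ≤ U x y)
    (hUsymm : ∀ x ∈ closure Λ, ∀ y ∈ closure Λ, U x y = U y x)
    (hUcont : ContinuousOn (fun p : Euc × Euc => U p.1 p.2) (closure Λ ×ˢ closure Λ))
    (hεg : 0 < groundEnergy U Λ) :
    ∃ sbarI : ℝ → ℝ,
      (∀ ε : ℝ, groundEnergy U Λ < ε →
        Tendsto (fun N : ℕ =>
            (1 / (N : ℝ)) *
              Real.log ((piNormLeb Λ N
                {q : Fin N → Euc | interaction U N q < (N : ℝ) ^ 2 * ε}).toReal))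
          atTop (nhds (sbarI ε))) ∧
      (∀ ε : ℝ, groundEnergy U Λ < ε → sbarI ε ≤ 0) ∧
      MonotoneOn sbarI (Ioi (groundEnergy U Λ)) ∧
      ∀ ε ∈ Ioi (groundEnergy U Λ), ContinuousWithinAt sbarI (Ici ε) ε := by
  set m : Measure Euc := ProbabilityTheory.cond volume Λ with hm
  have hfin : volume Λ ≠ ∞ := hΛbdd.measure_lt_top.ne
  have hpos : volume Λ ≠ 0 := (hΛopen.measure_pos volume hΛne).ne'
  have hmp : IsProbabilityMeasure m :=
    ProbabilityTheory.cond_isProbabilityMeasure_of_finite hpos hfin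
  have hcl : MeasurableSet (closure Λ) := isClosed_closure.measurableSet
  have hmc : m (closure Λ)ᶜ = 0 := cond_compl_closure hΛopen
  have hcomp : CompactSpace (closure Λ) := isCompact_iff_compactSpace.1 hΛbdd.isCompact_closure
  set μ : Measure (closure Λ) := m.comap Subtype.val with hμ
  have hμp : IsProbabilityMeasure μ := isProbabilityMeasure_comap_val hcl hmc
  have hμo : μ.IsOpenPosMeasure := isOpenPosMeasure_comap_cond hΛopen hfin
  set W : closure Λ × closure Λ → ℝ := fun p => U p.1 p.2 with hWdef
  have hW : Continuous W := hUcont.comp_continuous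
    (f := fun p : closure Λ × closure Λ => ((p.1 : Euc), (p.2 : Euc))) (by fun_prop)
    fun p => ⟨p.1.2, p.2.2⟩
  obtain ⟨K, hK⟩ := isCompact_univ.exists_bound_of_continuousOn hW.continuousOn
  have hK : ∀ p, |W p| ≤ K := fun p => hK p (mem_univ p)
  have hsymm : ∀ x y, W (x, y) = W (y, x) := fun x y => hUsymm x x.2 y y.2
  have hmeas (ε : ℝ) (N : ℕ) :
      (piNormLeb Λ N {q : Fin N → Euc | interaction U N q < (N : ℝ) ^ 2 * ε}).toReal =
        (Measure.pi fun _ : Fin N => μ).real {q | pairEnergy W q < (N : ℝ) ^ 2 * ε} := by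
    have hF : MeasurableEmbedding fun (q : Fin N → closure Λ) i => (q i : Euc) :=
      (Continuous.isClosedEmbedding (by fun_prop) fun q q' h =>
        funext fun i => Subtype.ext (congrFun h i)).measurableEmbedding
    have hmap : m = μ.map Subtype.val := (map_comap_val hcl hmc).symm
    have : SigmaFinite (μ.map (Subtype.val : closure Λ → Euc)) := by
      rw [← hmap]
      infer_instance
    rw [piNormLeb_eq_pi, ← hm, hmap,
      ← Measure.pi_map_pi (f := fun _ => Subtype.val) fun _ => measurable_subtype_coe.aemeasurable,
      hF.map_apply]
    rfl
  have hne {ε : ℝ} (hε : groundEnergy U Λ < ε) : (entropyBounds μ W ε).Nonempty := by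
    have hset : {e : ℝ | ∃ ρ : Measure Euc, IsProbOn Λ ρ ∧ e = pairing U ρ ρ}.Nonempty := by
      by_contra hempty
      rw [groundEnergy, not_nonempty_iff_eq_empty.1 hempty, Real.sInf_empty] at hεg
      exact hεg.false
    obtain ⟨e, ⟨ρ, ⟨hρp, hρc⟩, rfl⟩, he⟩ := exists_lt_of_csInf_lt hset hε
    have hp := isProbabilityMeasure_comap_val hcl hρc
    rw [← map_comap_val hcl hρc, pairing_map_val hcl U _ (fun _ => rfl)
      (Integrable.of_bound hW.aestronglyMeasurable K (ae_of_all _ hK))] at he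
    exact exists_entropyLE_of_meanEnergy_lt hW hK hsymm he
  refine ⟨fun ε => -minEntropy μ W ε, fun ε hε => ?_, fun ε _ => neg_nonpos.2 minEntropy_nonneg,
    fun ε hε ε' _ h => neg_le_neg (minEntropy_anti (hne hε) h),
    fun ε hε => (continuousWithinAt_minEntropy hW (hne hε)).neg⟩
  simp_rw [hmeas]
  exact tendsto_log_measureReal hW hK hsymm (hεg.trans hε) (hne hε)
end
end

section
/- Assume hypotheses (H1)–(H4) on U. For θ > 0 define the canonical thermodynamic potential Φ_N(1/(Nθ)) := ln[ (|Λ|^N/N!)·(2πθ)^{3N/2}·∫_{Λ^N} exp(−I_N(q)/(Nθ)) λ^⊗N(dq) ] (this is the logarithm of the canonical partition function (1/N!)∫ exp(−H_N/(Nθ)) dp dq for the Hamiltonian H_N(p,q) = N·Σ_{1≤i≤N}½|p_i|² + I_N(q)). Then for every θ > 0 the asymptotic expansion Φ_N(1/(Nθ)) = −N·ln N + N·φ(θ) + o(N) holds as N → ∞, where φ(θ) := sup_{ε > ε_g} ( −ε/θ + s(ε) ) and s(ε) := −min_{f ∈ 𝔄_ε} ℋ(f) is the system-specific microcanonical entropy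 per particle. -/
open MeasureTheory Real Filter Set
open scoped BigOperators ENNReal

noncomputable section

/-- Interaction energy `I_N(q) = ∑_{i<j} U(q_i, q_j)` (extended-real valued). -/
def interactionE (U : Euc → Euc → ℝ≥0∞) (N : ℕ) (q : Fin N → Euc) : ℝ≥0∞ :=
  ∑ i : Fin N, ∑ j : Fin N, if (i : ℕ) < (j : ℕ) then U (q i) (q j) else 0

/-- The bilinear pairing `⟨ρ,ρ'⟩ = ∬ ½ U(x,y) ρ(dx) ρ'(dy)`. -/
def pairingE (U : Euc → Euc → ℝ≥0∞) (ρ ρ' : Measure Euc) : ℝ≥0∞ :=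
  ∫⁻ x, ∫⁻ y, U x y / 2 ∂ρ' ∂ρ

/-- `ε_g`, the infimum of `⟨ρ,ρ⟩` over Borel probability measures on `cl(Λ)`. -/
def groundEnergyE (U : Euc → Euc → ℝ≥0∞) (Λ : Set Euc) : ℝ≥0∞ :=
  ⨅ ρ ∈ {ρ : Measure Euc | IsProbOn Λ ρ}, pairingE U ρ ρ

/-- Hypotheses (H1)–(H4) on the effective pair interaction `U`. -/
structure HypUE (U : Euc → Euc → ℝ≥0∞) (Λ : Set Euc) : Prop where
  /-- (H1) Symmetry. -/
  symm : ∀ x ∈ closure Λ, ∀ y ∈ closure Λ, U x y = U y x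
  /-- (H2) Lower semicontinuity on `cl(Λ)×cl(Λ)`. -/
  lsc : LowerSemicontinuousOn (fun p : Euc × Euc => U p.1 p.2) (closure Λ ×ˢ closure Λ)
  /-- (H3) Sublevel set regularity. -/
  sublevel : ∀ δ : ℝ, 0 < δ →
    0 < volume {p : Euc × Euc | p.1 ∈ Λ ∧ p.2 ∈ Λ ∧
      U p.1 p.2 < (⨅ x ∈ closure Λ, ⨅ y ∈ closure Λ, U x y) + ENNReal.ofReal δ}
  /-- (H4) Local square integrability. -/
  locL2 : ∀ x ∈ Λ, ∃ r : ℝ, 0 < r ∧ (∫⁻ y in Metric.ball x r ∩ Λ, (U x y) ^ 2) < ⊤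

/-- Boltzmann's microcanonical entropy
`S_N(E) = ln[(2π/N)^{3N/2} (N! Γ(3N/2))⁻¹ ∫_{Λ^N} (E − I_N(q))₊^{3N/2−1} dq]`. -/
def mcEntropyE (U : Euc → Euc → ℝ≥0∞) (Λ : Set Euc) (N : ℕ) (E : ℝ) : ℝ :=
  Real.log ((2 * π / N) ^ ((3 * (N : ℝ)) / 2) *
      ((N.factorial : ℝ) * Real.Gamma (3 * (N : ℝ) / 2))⁻¹ *
    ∫ q : Fin N → Euc in Set.univ.pi fun _ => Λ,
      ((ENNReal.ofReal E - interactionE U N q).toReal) ^ ((3 * (N : ℝ)) / 2 - 1) ∂volume)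

/-- Boltzmann's H functional `ℋ(f) = ∬ f ln(f/e)`. -/
def Hfun (f : Euc × Euc → ℝ) : ℝ :=
  ∫ z : Euc × Euc, f z * (Real.log (f z) - 1)

/-- The energy functional
`ℰ(f) = ∬ ½|p|² f + ∬∬ ½U(q,q̃) f(p,q) f(p̃,q̃)` (extended-real valued). -/
def Efun (U : Euc → Euc → ℝ≥0∞) (f : Euc × Euc → ℝ) : ℝ≥0∞ :=
  (∫⁻ z : Euc × Euc, ENNReal.ofReal (‖z.1‖ ^ 2 / 2 * f z)) +
  ∫⁻ z : Euc × Euc, ∫⁻ w : Euc × Euc,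
    ENNReal.ofReal (f z) * ENNReal.ofReal (f w) * (U z.2 w.2 / 2)

/-- The constraint set `𝔄_ε`: probability densities `f` on `ℝ³×Λ` with `f·|ln f|`
integrable and `ℰ(f) = ε`. -/
def Adm (U : Euc → Euc → ℝ≥0∞) (Λ : Set Euc) (ε : ℝ) (f : Euc × Euc → ℝ) : Prop :=
  Measurable f ∧ (∀ z, 0 ≤ f z) ∧ (∀ z : Euc × Euc, z.2 ∉ Λ → f z = 0) ∧
  Integrable f ∧ (∫ z : Euc × Euc, f z) = 1 ∧
  Integrable (fun z : Euc × Euc => f z * |Real.log (f z)|) ∧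
  Efun U f = ENNReal.ofReal ε


attribute [local instance] Classical.propDecidable

/-- `negExp t a = exp(−t·a)` for `a ∈ [0,∞]`, with the value `0` at `a = ∞`. -/
def negExp (t : ℝ) (a : ℝ≥0∞) : ℝ :=
  if a = ⊤ then 0 else Real.exp (-(t * a.toReal))

/-- The canonical thermodynamic potential
`Φ_N(1/(Nθ)) = ln[(|Λ|^N/N!)·(2πθ)^{3N/2}·∫_{Λ^N} exp(−I_N(q)/(Nθ)) λ^⊗N(dq)]`. -/
def canonPot (U : Euc → Euc → ℝ≥0∞) (Λ : Set Euc) (N : ℕ) (θ : ℝ) : ℝ :=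
  Real.log (((volume Λ).toReal ^ N / (N.factorial : ℝ)) *
      (2 * π * θ) ^ ((3 * (N : ℝ)) / 2) *
    ∫ q, negExp (((N : ℝ) * θ)⁻¹) (interactionE U N q) ∂(piNormLeb Λ N))

theorem tendsto_log_sub_log_factorial_div :
    Tendsto (fun N : ℕ => Real.log N - Real.log (N.factorial : ℝ) / N) atTop (nhds 1) := by
  have hst : Tendsto (fun N : ℕ => Real.log (Stirling.stirlingSeq N) / N) atTop (nhds 0) :=
    ((Real.continuousAt_log (by positivity)).tendsto.comp
      Stirling.tendsto_stirlingSeq_sqrt_pi).div_atTop tendsto_natCast_atTop_atTop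
  have hlog : Tendsto (fun N : ℕ => Real.log N / N) atTop (nhds 0) :=
    Real.isLittleO_log_id_atTop.tendsto_div_nhds_zero.comp tendsto_natCast_atTop_atTop
  have hc : Tendsto (fun N : ℕ => Real.log 2 / (N : ℝ)) atTop (nhds 0) :=
    tendsto_const_nhds.div_atTop tendsto_natCast_atTop_atTop
  have key := ((hst.add (hlog.const_mul (1 / 2))).add (hc.const_mul (1 / 2))).const_sub 1
  simp only [mul_zero, add_zero, sub_zero] at key
  refine key.congr' ?_
  filter_upwards [eventually_ge_atTop 1] with N hN
  have hN' : (0 : ℝ) < N := by exact_mod_cast hN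
  rw [Stirling.log_stirlingSeq_formula, Real.log_mul two_ne_zero hN'.ne',
    Real.log_div hN'.ne' (Real.exp_pos 1).ne', Real.log_exp]
  field_simp
  ring

section DonskerVaradhan

variable {X : Type*} [MetricSpace X] [CompactSpace X] [MeasurableSpace X] [BorelSpace X]

theorem exp_le_exp_add_mul_abs_sub {a b B : ℝ} (hb : b ≤ B) :
    Real.exp b ≤ Real.exp a + Real.exp B * |a - b| := by
  have h1 : a - b + 1 ≤ Real.exp (a - b) := Real.add_one_le_exp _
  have h2 : Real.exp a = Real.exp b * Real.exp (a - b) := by rw [← Real.exp_add]; ring_nf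
  have h3 : Real.exp b ≤ Real.exp B := Real.exp_le_exp.2 hb
  have h4 := neg_abs_le (a - b)
  have h5 := Real.exp_pos b
  have h6 := abs_nonneg (a - b)
  nlinarith [mul_le_mul_of_nonneg_right h3 h6, mul_le_mul_of_nonneg_left h1 h5.le,
    mul_le_mul_of_nonneg_left h4 h5.le]

theorem abs_sub_clamp_le {a b B : ℝ} (ha : |a| ≤ B) : |a - max (-B) (min B b)| ≤ |a - b| := by
  obtain ⟨h1, h2⟩ := abs_le.1 ha
  rcases max_cases (-B) (min B b) with h | h <;> rcases min_cases B b with h' | h' <;>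
    rcases abs_cases (a - b) with h'' | h'' <;> rw [abs_le] <;> constructor <;> linarith

theorem integral_le_of_continuous_test {μ ν : Measure X} [IsProbabilityMeasure μ]
    [IsProbabilityMeasure ν] {M : ℝ}
    (H : ∀ φ : C(X, ℝ), ∫ x, φ x ∂μ - Real.log (∫ x, Real.exp (φ x) ∂ν) ≤ M)
    {φ : X → ℝ} (hφ : Measurable φ) {B : ℝ} (hB : ∀ x, |φ x| ≤ B) :
    ∫ x, φ x ∂μ - Real.log (∫ x, Real.exp (φ x) ∂ν) ≤ M := by
  have hφi (ρ : Measure X) [IsFiniteMeasure ρ] : Integrable φ ρ :=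
    Integrable.of_bound hφ.aestronglyMeasurable B (ae_of_all _ hB)
  have hei : Integrable (fun x => Real.exp (φ x)) ν :=
    Integrable.of_bound (by fun_prop) (Real.exp B) (ae_of_all _ fun x => by
      simpa using (abs_le.1 (hB x)).2)
  have hlow : Real.exp (-B) ≤ ∫ x, Real.exp (φ x) ∂ν := by
    have := integral_mono (μ := ν) (integrable_const (Real.exp (-B))) hei
      (fun x => Real.exp_le_exp.2 (abs_le.1 (hB x)).1)
    simpa using this
  have hpos : 0 < ∫ x, Real.exp (φ x) ∂ν := (Real.exp_pos _).trans_le hlow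
  refine le_of_forall_pos_le_add fun δ hδ => ?_
  set ε : ℝ := δ / (1 + Real.exp B / ∫ x, Real.exp (φ x) ∂ν) with hε
  have hεpos : 0 < ε := by positivity
  obtain ⟨g, hg, hgi⟩ := (hφi (μ + ν)).exists_boundedContinuous_lintegral_sub_le
    (ε := ENNReal.ofReal ε) (by simpa using hεpos)
  let ψ : C(X, ℝ) := ⟨fun x => max (-B) (min B (g x)), by fun_prop⟩
  have hψB (x : X) : ψ x ≤ B :=
    max_le (by linarith [abs_nonneg (φ x), hB x]) (min_le_left _ _)
  have hψi (ρ : Measure X) [IsFiniteMeasure ρ] (χ : C(X, ℝ)) : Integrable χ ρ :=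
    χ.continuous.integrable_of_hasCompactSupport (HasCompactSupport.of_compactSpace _)
  have hd (ρ : Measure X) [IsFiniteMeasure ρ] : Integrable (fun x => |φ x - ψ x|) ρ :=
    ((hφi ρ).sub (hψi _ ψ)).abs
  have hdg : Integrable (fun x => φ x - g x) (μ + ν) := (hφi _).sub hgi
  have hsub : ∫ x, |φ x - ψ x| ∂(μ + ν) ≤ ε := by
    have h1 : ∫ x, |φ x - ψ x| ∂(μ + ν) ≤ ∫ x, ‖φ x - g x‖ ∂(μ + ν) :=
      integral_mono (hd _) hdg.norm
        (fun x => abs_sub_clamp_le (hB x))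
    refine h1.trans ?_
    rw [integral_norm_eq_lintegral_enorm hdg.aestronglyMeasurable]
    exact ENNReal.toReal_le_of_le_ofReal hεpos.le hg
  rw [integral_add_measure (hd _) (hd _)] at hsub
  have n1 : 0 ≤ ∫ x, |φ x - ψ x| ∂μ := integral_nonneg fun _ => abs_nonneg _
  have n2 : 0 ≤ ∫ x, |φ x - ψ x| ∂ν := integral_nonneg fun _ => abs_nonneg _
  have h1 : ∫ x, φ x ∂μ ≤ ∫ x, ψ x ∂μ + ε := by
    have := integral_mono ((hφi μ).sub (hψi _ ψ)) (hd _)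
      (fun x => le_abs_self _)
    simp only [Pi.sub_apply] at this
    rw [integral_sub (hφi μ) (hψi _ ψ)] at this
    linarith
  have h2 : ∫ x, Real.exp (ψ x) ∂ν ≤ ∫ x, Real.exp (φ x) ∂ν + Real.exp B * ε := by
    have := integral_mono (hψi ν ⟨fun x => Real.exp (ψ x), by fun_prop⟩)
      (hei.add ((hd ν).const_mul (Real.exp B)))
      (fun x => exp_le_exp_add_mul_abs_sub (hψB x))
    simp only [Pi.add_apply, ContinuousMap.coe_mk] at this
    rw [integral_add hei ((hd ν).const_mul (Real.exp B)),
      integral_const_mul] at this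
    have h3 := mul_le_mul_of_nonneg_left (show ∫ x, |φ x - ψ x| ∂ν ≤ ε by linarith)
      (Real.exp_pos B).le
    linarith
  have hψpos : 0 < ∫ x, Real.exp (ψ x) ∂ν :=
    integral_exp_pos (hψi ν ⟨fun x => Real.exp (ψ x), by fun_prop⟩)
  have h3 : Real.log (∫ x, Real.exp (ψ x) ∂ν) ≤ Real.log (∫ x, Real.exp (φ x) ∂ν)
      + Real.exp B * ε / ∫ x, Real.exp (φ x) ∂ν := by
    refine (Real.log_le_log hψpos h2).trans ?_
    have : (∫ x, Real.exp (φ x) ∂ν) + Real.exp B * ε = (∫ x, Real.exp (φ x) ∂ν) *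
        (1 + Real.exp B * ε / ∫ x, Real.exp (φ x) ∂ν) := by field_simp
    rw [this, Real.log_mul hpos.ne' (by positivity)]
    gcongr
    have := Real.log_le_sub_one_of_pos
      (show 0 < 1 + Real.exp B * ε / ∫ x, Real.exp (φ x) ∂ν by positivity)
    linarith
  have h4 : ε + Real.exp B * ε / (∫ x, Real.exp (φ x) ∂ν) = δ := by
    rw [hε]; field_simp
  have := H ψ
  linarith

end DonskerVaradhan

section DonskerVaradhan

variable {X : Type*} [MeasurableSpace X]

theorem mul_log_min_add_nonneg {x : ℝ} (hx : 0 ≤ x) {n : ℕ} (hn : 3 ≤ n) :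
    0 ≤ x * Real.log (min x n + 1 / (n : ℝ)) + 1 - x := by
  have hn' : (3 : ℝ) ≤ n := by exact_mod_cast hn
  have hpos : 0 < 1 / (n : ℝ) := by positivity
  rcases hx.eq_or_lt with rfl | hx0
  · simp
  rcases le_total x n with h | h
  · rw [min_eq_left h]
    have h1 := InformationTheory.klFun_nonneg hx
    rw [InformationTheory.klFun_apply] at h1
    have h2 : Real.log x ≤ Real.log (x + 1 / (n : ℝ)) := Real.log_le_log hx0 (by linarith)
    nlinarith
  · rw [min_eq_right h]
    have h2 : 1 ≤ Real.log (n + 1 / (n : ℝ)) := by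
      rw [Real.le_log_iff_exp_le (by positivity)]
      linarith [Real.exp_one_lt_d9]
    nlinarith

theorem klDiv_le_of_bounded_test {μ ν : Measure X} [IsProbabilityMeasure μ]
    [IsProbabilityMeasure ν] {M : ℝ}
    (H : ∀ φ : X → ℝ, Measurable φ → ∀ B : ℝ, (∀ x, |φ x| ≤ B) →
      ∫ x, φ x ∂μ - Real.log (∫ x, Real.exp (φ x) ∂ν) ≤ M) :
    InformationTheory.klDiv μ ν ≤ ENNReal.ofReal M := by
  have hac : μ ≪ ν := by
    refine Measure.AbsolutelyContinuous.mk fun s hs hνs => ?_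
    by_contra hne
    have hpos : 0 < μ.real s := ENNReal.toReal_pos hne (measure_ne_top _ _)
    obtain ⟨n, hn⟩ := exists_nat_gt (M / μ.real s)
    have h1 := H (s.indicator fun _ => (n : ℝ)) (measurable_const.indicator hs) n (fun x => by
      by_cases hx : x ∈ s <;> simp [hx])
    have h2 : ∫ x, Real.exp (s.indicator (fun _ => (n : ℝ)) x) ∂ν = 1 := by
      have : (fun x => Real.exp (s.indicator (fun _ => (n : ℝ)) x)) =ᵐ[ν] fun _ => 1 := by
        filter_upwards [measure_eq_zero_iff_ae_notMem.1 hνs] with x hx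
        simp [hx]
      simp [integral_congr_ae this]
    rw [h2, integral_indicator_const _ hs, Real.log_one, smul_eq_mul] at h1
    rw [div_lt_iff₀ hpos] at hn
    linarith
  set ρ : X → ℝ := fun x => (μ.rnDeriv ν x).toReal with hρ
  have hρm : Measurable ρ := (Measure.measurable_rnDeriv μ ν).ennreal_toReal
  have hρ0 (x : X) : 0 ≤ ρ x := ENNReal.toReal_nonneg
  have hρi : Integrable ρ ν := Measure.integrable_toReal_rnDeriv
  have hρ1 : ∫ x, ρ x ∂ν = 1 := by
    rw [Measure.integral_toReal_rnDeriv hac]; simp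
  set φ : ℕ → X → ℝ := fun n x => Real.log (min (ρ x) n + 1 / (n : ℝ)) with hφ
  have hφm (n : ℕ) : Measurable (φ n) := by fun_prop
  have hbound (n : ℕ) (hn : 3 ≤ n) :
      ∫⁻ x, ENNReal.ofReal (ρ x * φ n x + 1 - ρ x) ∂ν ≤ ENNReal.ofReal (M + 1 / (n : ℝ)) := by
    have hn' : (3 : ℝ) ≤ n := by exact_mod_cast hn
    have hpos : 0 < 1 / (n : ℝ) := by positivity
    have hφb (x : X) : |φ n x| ≤ |Real.log (1 / (n : ℝ))| + |Real.log (n + 1 / (n : ℝ))| := by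
      have h0 : 0 ≤ min (ρ x) n := le_min (hρ0 x) (by positivity)
      have h1 : Real.log (1 / (n : ℝ)) ≤ φ n x := Real.log_le_log hpos (by linarith)
      have h2 : φ n x ≤ Real.log (n + 1 / (n : ℝ)) :=
        Real.log_le_log (by linarith) (by gcongr; exact min_le_right _ _)
      rw [abs_le]
      constructor <;> linarith [neg_abs_le (Real.log (1 / (n : ℝ))),
        le_abs_self (Real.log (n + 1 / (n : ℝ))), abs_nonneg (Real.log (1 / (n : ℝ))),
        abs_nonneg (Real.log (n + 1 / (n : ℝ)))]
    have hH := H (φ n) (hφm n) _ hφb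
    have hexp : ∫ x, Real.exp (φ n x) ∂ν ≤ 1 + 1 / (n : ℝ) := by
      have : ∫ x, Real.exp (φ n x) ∂ν ≤ ∫ x, (ρ x + 1 / (n : ℝ)) ∂ν := by
        refine integral_mono_of_nonneg (ae_of_all _ fun x => (Real.exp_pos _).le)
          (hρi.add (integrable_const _)) (ae_of_all _ fun x => ?_)
        have h0 : 0 ≤ min (ρ x) n := le_min (hρ0 x) (by positivity)
        simp only [hφ]
        rw [Real.exp_log (by linarith)]
        gcongr
        exact min_le_left _ _
      rwa [integral_add hρi (integrable_const _), hρ1, integral_const, probReal_univ,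
        one_smul] at this
    have hexppos : 0 < ∫ x, Real.exp (φ n x) ∂ν := by
      refine integral_exp_pos (Integrable.of_bound (by fun_prop)
        (Real.exp (|Real.log (1 / (n : ℝ))| + |Real.log (n + 1 / (n : ℝ))|))
        (ae_of_all _ fun x => ?_))
      simpa using (abs_le.1 (hφb x)).2
    have hlog := Real.log_le_sub_one_of_pos hexppos
    have hφi : Integrable (φ n) μ :=
      Integrable.of_bound (hφm n).aestronglyMeasurable _ (ae_of_all _ hφb)
    have hρφi : Integrable (fun x => ρ x * φ n x) ν := by
      simpa [hρ] using (integrable_rnDeriv_smul_iff hac).2 hφi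
    have hρφ : ∫ x, ρ x * φ n x ∂ν = ∫ x, φ n x ∂μ := by
      simpa [hρ] using integral_rnDeriv_smul hac (f := φ n)
    have hadd : Integrable (fun x => ρ x * φ n x + 1) ν := hρφi.add (integrable_const _)
    have hsub : Integrable (fun x => ρ x * φ n x + 1 - ρ x) ν := hadd.sub hρi
    have hI : ∫ x, (ρ x * φ n x + 1 - ρ x) ∂ν = ∫ x, φ n x ∂μ := by
      rw [integral_sub hadd hρi,
        integral_add hρφi (integrable_const _), hρφ, hρ1]
      simp
    rw [← ofReal_integral_eq_lintegral_ofReal hsub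
      (ae_of_all _ fun x => mul_log_min_add_nonneg (hρ0 x) hn)]
    refine ENNReal.ofReal_le_ofReal ?_
    rw [hI]
    linarith
  rw [InformationTheory.klDiv_eq_lintegral_klFun_of_ac hac]
  have hlim (x : X) : Tendsto (fun n : ℕ => ENNReal.ofReal (ρ x * φ n x + 1 - ρ x)) atTop
      (nhds (ENNReal.ofReal (InformationTheory.klFun (ρ x)))) := by
    refine (ENNReal.continuous_ofReal.tendsto _).comp ?_
    rw [InformationTheory.klFun_apply]
    refine ((Tendsto.add_const _ ?_)).sub_const _
    rcases (hρ0 x).eq_or_lt with h | h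
    · simp [← h]
    · refine Tendsto.const_mul _ ((Real.continuousAt_log h.ne').tendsto.comp ?_)
      have h1 : Tendsto (fun n : ℕ => ρ x + 1 / (n : ℝ)) atTop (nhds (ρ x)) := by
        simpa using tendsto_one_div_atTop_nhds_zero_nat.const_add (ρ x)
      refine h1.congr' ?_
      obtain ⟨m, hm⟩ := exists_nat_ge (ρ x)
      filter_upwards [eventually_ge_atTop m] with n hn
      rw [min_eq_left (hm.trans (by exact_mod_cast hn))]
  calc ∫⁻ x, ENNReal.ofReal (InformationTheory.klFun (ρ x)) ∂ν
      = ∫⁻ x, liminf (fun n : ℕ => ENNReal.ofReal (ρ x * φ n x + 1 - ρ x)) atTop ∂ν := by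
        simp_rw [(hlim _).liminf_eq]
    _ ≤ liminf (fun n : ℕ => ∫⁻ x, ENNReal.ofReal (ρ x * φ n x + 1 - ρ x) ∂ν) atTop :=
        lintegral_liminf_le fun n => by fun_prop
    _ ≤ liminf (fun n : ℕ => ENNReal.ofReal (M + 1 / (n : ℝ))) atTop :=
        liminf_le_liminf (by filter_upwards [eventually_ge_atTop 3] with n hn using hbound n hn)
    _ = ENNReal.ofReal M := by
        refine Tendsto.liminf_eq ((ENNReal.continuous_ofReal.tendsto _).comp ?_)
        simpa using tendsto_one_div_atTop_nhds_zero_nat.const_add M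

end DonskerVaradhan

section LowerSemicontinuous

variable {Y : Type*} [MetricSpace Y] [CompactSpace Y] [MeasurableSpace Y] [BorelSpace Y]

theorem lintegral_le_of_continuous_minorants [Nonempty Y] {V : Y → ℝ≥0∞}
    (hV : LowerSemicontinuous V) {μ : Measure Y} [IsProbabilityMeasure μ] {M : ℝ}
    (H : ∀ W : C(Y, ℝ), (∀ y, 0 ≤ W y) → (∀ y, ENNReal.ofReal (W y) ≤ V y) →
      ∫ y, W y ∂μ ≤ M) :
    ∫⁻ y, V y ∂μ ≤ ENNReal.ofReal M := by
  set F : ℕ → Y → Y → ℝ := fun n y z => (min (V z) n).toReal + n * dist y z with hF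
  have hF0 (n : ℕ) (y z : Y) : 0 ≤ F n y z := by positivity
  have hbdd (n : ℕ) (y : Y) : BddBelow (range (F n y)) := ⟨0, by rintro _ ⟨z, rfl⟩; exact hF0 n y z⟩
  have hlip (n : ℕ) : LipschitzWith n fun y => ⨅ z, F n y z := by
    refine LipschitzWith.of_le_add_mul n fun y y' => ?_
    rw [← sub_le_iff_le_add]
    refine le_ciInf fun z => ?_
    have h1 : (⨅ z, F n y z) ≤ F n y z := ciInf_le (hbdd n y) z
    have h2 : F n y z ≤ F n y' z + n * dist y y' := by
      simp only [hF]
      have := mul_le_mul_of_nonneg_left (dist_triangle y y' z) (Nat.cast_nonneg (α := ℝ) n)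
      linarith
    simp only [NNReal.coe_natCast]
    linarith
  set W : ℕ → C(Y, ℝ) := fun n => ⟨fun y => ⨅ z, F n y z, (hlip n).continuous⟩ with hW
  have hW0 (n : ℕ) (y : Y) : 0 ≤ W n y := le_ciInf fun z => hF0 n y z
  have hWV (n : ℕ) (y : Y) : ENNReal.ofReal (W n y) ≤ V y := by
    have h1 : W n y ≤ F n y y := ciInf_le (hbdd n y) y
    exact (ENNReal.ofReal_le_of_le_toReal (a := W n y) (b := min (V y) n)
      (by simpa [hF] using h1)).trans (min_le_left _ _)
  have hlim (y : Y) : V y ≤ liminf (fun n => ENNReal.ofReal (W n y)) atTop := by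
    refine le_of_forall_lt fun a ha => ?_
    obtain ⟨b, hab, hbV⟩ := exists_between ha
    refine hab.trans_le (le_liminf_of_le (by isBoundedDefault) ?_)
    have hb : b ≠ ⊤ := (hbV.trans_le le_top).ne
    obtain ⟨r, hr, hball⟩ := Metric.eventually_nhds_iff.1 (hV y b hbV)
    obtain ⟨m, hm⟩ := exists_nat_ge (max b.toReal (b.toReal / r))
    filter_upwards [eventually_ge_atTop m] with n hn
    have hmn : (m : ℝ) ≤ n := by exact_mod_cast hn
    rw [← ENNReal.ofReal_toReal hb]
    refine ENNReal.ofReal_le_ofReal (le_ciInf fun z => ?_)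
    by_cases hz : dist z y < r
    · have h1 : b ≤ min (V z) n := le_min (hball hz).le (by
        rw [← ENNReal.ofReal_toReal hb, ← ENNReal.ofReal_natCast]
        exact ENNReal.ofReal_le_ofReal (((le_max_left _ _).trans hm).trans hmn))
      have h2 : b.toReal ≤ (min (V z) n).toReal :=
        ENNReal.toReal_mono (ne_top_of_le_ne_top (ENNReal.natCast_ne_top n) (min_le_right _ _)) h1
      have h3 : (0 : ℝ) ≤ n * dist y z := by positivity
      simp only [hF]
      linarith
    · have h1 : b.toReal ≤ n * r := by
        rw [← div_le_iff₀ hr]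
        exact ((le_max_right _ _).trans hm).trans hmn
      have h2 : (n : ℝ) * r ≤ n * dist y z := by
        rw [dist_comm]; gcongr; exact not_lt.1 hz
      have h3 : 0 ≤ (min (V z) n).toReal := ENNReal.toReal_nonneg
      simp only [hF]
      linarith
  have hWi (n : ℕ) : Integrable (W n) μ :=
    (W n).continuous.integrable_of_hasCompactSupport (HasCompactSupport.of_compactSpace _)
  calc ∫⁻ y, V y ∂μ ≤ ∫⁻ y, liminf (fun n => ENNReal.ofReal (W n y)) atTop ∂μ :=
        lintegral_mono hlim
    _ ≤ liminf (fun n => ∫⁻ y, ENNReal.ofReal (W n y) ∂μ) atTop :=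
        lintegral_liminf_le fun n => ((W n).continuous.measurable).ennreal_ofReal
    _ ≤ liminf (fun _ : ℕ => ENNReal.ofReal M) atTop := by
        refine liminf_le_liminf (Eventually.of_forall fun n => ?_)
        rw [← ofReal_integral_eq_lintegral_ofReal (hWi n) (ae_of_all _ (hW0 n))]
        exact ENNReal.ofReal_le_ofReal (H _ (hW0 n) (hWV n))
    _ = ENNReal.ofReal M := liminf_const _

end LowerSemicontinuous

section UpperBound

variable {X : Type*} [MetricSpace X] [CompactSpace X]

theorem sum_sum_lt_add_self_of_symm {N : ℕ} {a : Fin N → Fin N → ℝ≥0∞}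
    (ha : ∀ i j, a i j = a j i) :
    (∑ i, ∑ j, if i ≠ j then a i j else 0) =
      (∑ i : Fin N, ∑ j : Fin N, if (i : ℕ) < (j : ℕ) then a i j else 0) +
      ∑ i : Fin N, ∑ j : Fin N, if (i : ℕ) < (j : ℕ) then a i j else 0 := by
  conv_rhs => arg 2; rw [Finset.sum_comm]
  simp_rw [← Finset.sum_add_distrib]
  refine Finset.sum_congr rfl fun i _ => Finset.sum_congr rfl fun j _ => ?_
  rcases lt_trichotomy (i : ℕ) j with h | h | h
  · have : i ≠ j := fun e => by simp [e] at h
    simp [this, h, h.not_gt]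
  · simp [Fin.ext h]
  · have : i ≠ j := fun e => by simp [e] at h
    simp [this, h, h.not_gt, ha i j]

theorem negExp_le_exp_of_le {t b : ℝ} (ht : 0 ≤ t) {a : ℝ≥0∞} (h : a ≠ ⊤ → b ≤ a.toReal) :
    negExp t a ≤ Real.exp (-(t * b)) := by
  unfold negExp
  split_ifs with ha
  · positivity
  · exact Real.exp_le_exp.2 (neg_le_neg (mul_le_mul_of_nonneg_left (h ha) ht))

theorem sum_le_two_mul_toReal_interaction {V : X × X → ℝ≥0∞} (hs : ∀ x y, V (x, y) = V (y, x))
    {W : C(X × X, ℝ)} (hW0 : ∀ z, 0 ≤ W z) (hWV : ∀ z, ENNReal.ofReal (W z) ≤ V z)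
    {N : ℕ} (x : Fin N → X)
    (hI : (∑ i : Fin N, ∑ j : Fin N, if (i : ℕ) < (j : ℕ) then V (x i, x j) else 0) ≠ ⊤) :
    (∑ i, ∑ j, W (x i, x j)) - N * ‖W‖ ≤
      2 * (∑ i : Fin N, ∑ j : Fin N, if (i : ℕ) < (j : ℕ) then V (x i, x j) else 0).toReal := by
  set I := ∑ i : Fin N, ∑ j : Fin N, if (i : ℕ) < (j : ℕ) then V (x i, x j) else 0
  have h1 : ENNReal.ofReal (∑ i, ∑ j, if i ≠ j then W (x i, x j) else 0) ≤ I + I := by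
    rw [← sum_sum_lt_add_self_of_symm (fun i j => hs (x i) (x j)),
      ENNReal.ofReal_sum_of_nonneg fun i _ => Finset.sum_nonneg fun j _ => by
        split_ifs <;> simp [hW0]]
    refine Finset.sum_le_sum fun i _ => ?_
    rw [ENNReal.ofReal_sum_of_nonneg fun j _ => by split_ifs <;> simp [hW0]]
    refine Finset.sum_le_sum fun j _ => ?_
    split_ifs <;> simp [hWV]
  have h2 := ENNReal.ofReal_le_iff_le_toReal (ENNReal.add_ne_top.2 ⟨hI, hI⟩) |>.1 h1
  rw [ENNReal.toReal_add hI hI] at h2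
  have h3 : (∑ i, ∑ j, W (x i, x j)) - N * ‖W‖ ≤
      ∑ i, ∑ j, if i ≠ j then W (x i, x j) else 0 := by
    have h4 : (N : ℝ) * ‖W‖ = ∑ _i : Fin N, ‖W‖ := by simp
    rw [h4, ← Finset.sum_sub_distrib]
    refine Finset.sum_le_sum fun i _ => ?_
    rw [sub_le_iff_le_add]
    have h5 : ∑ j, W (x i, x j) =
        (∑ j, if i ≠ j then W (x i, x j) else 0) + ∑ j, if i = j then W (x i, x j) else 0 := by
      rw [← Finset.sum_add_distrib]
      refine Finset.sum_congr rfl fun j _ => ?_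
      by_cases h : i = j <;> simp [h]
    rw [h5, Finset.sum_ite_eq]
    simpa using (le_abs_self _).trans (W.norm_coe_le_norm (x i, x i))
  linarith

variable [MeasurableSpace X] [BorelSpace X]

theorem exists_finite_tests {V : X × X → ℝ≥0∞} (hV : LowerSemicontinuous V)
    {m : Measure X} [IsProbabilityMeasure m] {τ : ℝ} (hτ : 0 < τ) {c : ℝ}
    (h : ∀ ν : Measure X, IsProbabilityMeasure ν → InformationTheory.klDiv ν m ≠ ⊤ →
      ∫⁻ z, V z ∂(ν.prod ν) ≠ ⊤ →
      -(τ * (∫⁻ z, V z ∂(ν.prod ν)).toReal) - (InformationTheory.klDiv ν m).toReal ≤ c)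
    {δ : ℝ} (hδ : 0 < δ) :
    ∃ t : Finset (C(X × X, ℝ) × C(X, ℝ)),
      (∀ p ∈ t, (∀ z, 0 ≤ p.1 z) ∧ ∀ z, ENNReal.ofReal (p.1 z) ≤ V z) ∧
      ∀ ν : ProbabilityMeasure X, ∃ p ∈ t,
        -c - δ < τ * ∫ z, p.1 z ∂((ν : Measure X).prod ν) + ∫ x, p.2 x ∂(ν : Measure X)
          - Real.log (∫ x, Real.exp (p.2 x) ∂m) := by
  set adm : Set (C(X × X, ℝ) × C(X, ℝ)) :=
    {p | (∀ z, 0 ≤ p.1 z) ∧ ∀ z, ENNReal.ofReal (p.1 z) ≤ V z} with hadm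
  set Ψ : C(X × X, ℝ) × C(X, ℝ) → ProbabilityMeasure X → ℝ := fun p ν =>
    τ * ∫ z, p.1 z ∂((ν : Measure X).prod ν) + ∫ x, p.2 x ∂(ν : Measure X)
          - Real.log (∫ x, Real.exp (p.2 x) ∂m) with hΨ
  have hcont (p : C(X × X, ℝ) × C(X, ℝ)) : Continuous (Ψ p) := by
    have h1 : Continuous fun ν : ProbabilityMeasure X => ν.prod ν :=
      ProbabilityMeasure.continuous_prod.comp (continuous_id.prodMk continuous_id)
    have h2 := (ProbabilityMeasure.continuous_integral_continuousMap p.1).comp h1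
    have h3 := ProbabilityMeasure.continuous_integral_continuousMap p.2
    exact ((h2.const_mul τ).add h3).sub continuous_const
  have hex (ν : ProbabilityMeasure X) : ∃ p ∈ adm, -c - δ < Ψ p ν := by
    by_contra! hcon
    have : Nonempty X := (ν : Measure X).nonempty_of_neZero
    have key (W : C(X × X, ℝ)) (hW0 : ∀ z, 0 ≤ W z) (hWV : ∀ z, ENNReal.ofReal (W z) ≤ V z) :
        InformationTheory.klDiv (ν : Measure X) m ≠ ⊤ ∧
        (InformationTheory.klDiv (ν : Measure X) m).toReal ≤
          -c - δ - τ * ∫ z, W z ∂((ν : Measure X).prod ν) := by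
      have h0 := hcon (W, 0) ⟨hW0, hWV⟩
      have hle : InformationTheory.klDiv (ν : Measure X) m ≤
          ENNReal.ofReal (-c - δ - τ * ∫ z, W z ∂((ν : Measure X).prod ν)) := by
        refine klDiv_le_of_bounded_test fun φ hφ B hB => ?_
        refine integral_le_of_continuous_test (fun ψ => ?_) hφ hB
        have := hcon (W, ψ) ⟨hW0, hWV⟩
        simp only [hΨ] at this
        linarith
      simp [hΨ] at h0
      exact ⟨ne_top_of_le_ne_top ENNReal.ofReal_ne_top hle,
        ENNReal.toReal_le_of_le_ofReal (by linarith) hle⟩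
    have hk := key 0 (fun _ => le_rfl) (fun _ => by simp)
    have hVle : ∫⁻ z, V z ∂((ν : Measure X).prod ν) ≤ ENNReal.ofReal
        ((-c - δ - (InformationTheory.klDiv (ν : Measure X) m).toReal) / τ) := by
      refine lintegral_le_of_continuous_minorants hV fun W hW0 hWV => ?_
      rw [le_div_iff₀ hτ]
      linarith [(key W hW0 hWV).2]
    have h1 := h ν inferInstance hk.1 (ne_top_of_le_ne_top ENNReal.ofReal_ne_top hVle)
    have h2 := ENNReal.toReal_le_of_le_ofReal
      (div_nonneg (by simpa using hk.2) hτ.le) hVle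
    rw [le_div_iff₀ hτ] at h2
    linarith
  obtain ⟨t, ht, hcov⟩ := isCompact_univ.elim_finite_subcover_image (b := adm)
    (c := fun p => {ν | -c - δ < Ψ p ν})
    (fun p _ => isOpen_lt continuous_const (hcont p))
    (fun ν _ => by simpa using hex ν)
  refine ⟨hcov.1.toFinset, fun p hp => ht (by simpa using hp), fun ν => ?_⟩
  simpa using hcov.2 (mem_univ ν)

/-- The empirical measure of a nonempty finite configuration. -/
def empirical {N : ℕ} (hN : 1 ≤ N) (x : Fin N → X) : ProbabilityMeasure X :=
  ⟨(N : ℝ≥0∞)⁻¹ • ∑ i, Measure.dirac (x i), ⟨by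
    simp [ENNReal.inv_mul_cancel (by positivity : (N : ℝ≥0∞) ≠ 0)]⟩⟩

theorem integral_empirical {N : ℕ} (hN : 1 ≤ N) (x : Fin N → X) (f : X → ℝ) :
    ∫ y, f y ∂(empirical hN x : Measure X) = (N : ℝ)⁻¹ * ∑ i, f (x i) := by
  have : (empirical hN x : Measure X) = (N : ℝ≥0∞)⁻¹ • ∑ i, Measure.dirac (x i) := rfl
  rw [this, integral_smul_measure,
    integral_finsetSum_measure fun i _ => integrable_dirac (by simp)]
  simp

theorem exists_integral_negExp_le {V : X × X → ℝ≥0∞} (hV : LowerSemicontinuous V)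
    (hs : ∀ x y, V (x, y) = V (y, x))
    {m : Measure X} [IsProbabilityMeasure m] {θ : ℝ} (hθ : 0 < θ) {c : ℝ}
    (h : ∀ ν : Measure X, IsProbabilityMeasure ν → InformationTheory.klDiv ν m ≠ ⊤ →
      ∫⁻ z, V z ∂(ν.prod ν) ≠ ⊤ →
      -((2 * θ)⁻¹ * (∫⁻ z, V z ∂(ν.prod ν)).toReal)
        - (InformationTheory.klDiv ν m).toReal ≤ c)
    {δ : ℝ} (hδ : 0 < δ) :
    ∃ C : ℝ, ∀ N : ℕ, 1 ≤ N →
      ∫ x : Fin N → X, negExp (((N : ℝ) * θ)⁻¹)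
        (∑ i : Fin N, ∑ j : Fin N, if (i : ℕ) < (j : ℕ) then V (x i, x j) else 0)
          ∂(Measure.pi fun _ => m) ≤ C * Real.exp (N * (c + δ)) := by
  obtain ⟨t, ht, hcov⟩ := exists_finite_tests hV (by positivity : 0 < (2 * θ)⁻¹) h hδ
  refine ⟨∑ p ∈ t, Real.exp ((2 * θ)⁻¹ * ‖p.1‖), fun N hN => ?_⟩
  have hN0 : (0 : ℝ) < N := by exact_mod_cast hN
  set Z : C(X × X, ℝ) × C(X, ℝ) → ℝ := fun p => ∫ x, Real.exp (p.2 x) ∂m with hZ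
  have hei (p : C(X × X, ℝ) × C(X, ℝ)) : Integrable (fun x => Real.exp (p.2 x)) m :=
    (Real.continuous_exp.comp p.2.continuous).integrable_of_hasCompactSupport
      (HasCompactSupport.of_compactSpace _)
  have hZpos (p : C(X × X, ℝ) × C(X, ℝ)) : 0 < Z p := integral_exp_pos (hei p)
  set G : C(X × X, ℝ) × C(X, ℝ) → (Fin N → X) → ℝ := fun p x =>
    Real.exp ((2 * θ)⁻¹ * ‖p.1‖) * Real.exp (N * (c + δ)) * ((Z p) ^ N)⁻¹ *
      ∏ i, Real.exp (p.2 (x i)) with hG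
  have hGi (p : C(X × X, ℝ) × C(X, ℝ)) : Integrable (G p) (Measure.pi fun _ : Fin N => m) :=
    (Integrable.fintype_prod (μ := fun _ : Fin N => m) (f := fun _ x => Real.exp (p.2 x))
      fun _ => hei p).const_mul _
  have hG0 (p : C(X × X, ℝ) × C(X, ℝ)) (x : Fin N → X) : 0 ≤ G p x := by
    have := hZpos p
    positivity
  have hpt (x : Fin N → X) : negExp (((N : ℝ) * θ)⁻¹)
      (∑ i : Fin N, ∑ j : Fin N, if (i : ℕ) < (j : ℕ) then V (x i, x j) else 0) ≤
      ∑ p ∈ t, G p x := by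
    obtain ⟨p, hp, hlt⟩ := hcov (empirical hN x)
    refine le_trans ?_ (Finset.single_le_sum (fun q _ => hG0 q x) hp)
    refine (negExp_le_exp_of_le (by positivity) fun hI =>
      (div_le_iff₀' two_pos).2
        (sum_le_two_mul_toReal_interaction hs (ht p hp).1 (ht p hp).2 x hI)).trans ?_
    have hpi : Integrable (fun z => p.1 z)
        ((empirical hN x : Measure X).prod (empirical hN x : Measure X)) :=
      p.1.continuous.integrable_of_hasCompactSupport (HasCompactSupport.of_compactSpace _)
    rw [integral_prod _ hpi] at hlt
    simp_rw [integral_empirical] at hlt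
    have hrw : G p x = Real.exp ((2 * θ)⁻¹ * ‖p.1‖ + N * (c + δ) - N * Real.log (Z p) +
        ∑ i, p.2 (x i)) := by
      rw [Real.exp_add, Real.exp_sub, Real.exp_add, Real.exp_sum, Real.exp_nat_mul (Real.log _),
        Real.exp_log (hZpos p), div_eq_mul_inv]
    rw [hrw, Real.exp_le_exp]
    rw [← Finset.mul_sum] at hlt
    have h2 := mul_lt_mul_of_pos_left hlt hN0
    have h3 : (N : ℝ) * ((2 * θ)⁻¹ * ((N : ℝ)⁻¹ * ((N : ℝ)⁻¹ * ∑ i, ∑ j, p.1 (x i, x j))) +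
        (N : ℝ)⁻¹ * ∑ i, p.2 (x i) - Real.log (Z p)) =
        ((N : ℝ) * θ)⁻¹ * ((∑ i, ∑ j, p.1 (x i, x j)) / 2) + ∑ i, p.2 (x i)
          - N * Real.log (Z p) := by
      field_simp
    have h4 : ((N : ℝ) * θ)⁻¹ * (((∑ i, ∑ j, p.1 (x i, x j)) - N * ‖p.1‖) / 2) =
        ((N : ℝ) * θ)⁻¹ * ((∑ i, ∑ j, p.1 (x i, x j)) / 2) - (2 * θ)⁻¹ * ‖p.1‖ := by
      field_simp
    rw [h3] at h2
    rw [h4]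
    linarith
  have hInt (p : C(X × X, ℝ) × C(X, ℝ)) : ∫ x, G p x ∂(Measure.pi fun _ : Fin N => m) =
      Real.exp ((2 * θ)⁻¹ * ‖p.1‖) * Real.exp (N * (c + δ)) := by
    simp only [hG]
    rw [integral_const_mul, integral_fintype_prod_eq_pow (μ := m) (fun x => Real.exp (p.2 x)),
      Fintype.card_fin, mul_assoc, inv_mul_cancel₀ (pow_ne_zero _ (hZpos p).ne'), mul_one]
  calc _ ≤ ∫ x, ∑ p ∈ t, G p x ∂(Measure.pi fun _ : Fin N => m) :=
        integral_mono_of_nonneg (ae_of_all _ fun x => by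
          simp only [negExp, Pi.zero_apply]; split_ifs <;> positivity)
          (integrable_finsetSum _ fun p _ => hGi p) (ae_of_all _ hpt)
    _ = _ := by
        rw [integral_finsetSum _ fun p _ => hGi p, Finset.sum_mul]
        exact Finset.sum_congr rfl fun p _ => hInt p

end UpperBound

section LowerBound

variable {Ω : Type*} [MeasurableSpace Ω]

theorem iIndepFun_pi_eval {ι : Type*} [Fintype ι] (μ : Measure Ω) [IsProbabilityMeasure μ]
    {β : Type*} [MeasurableSpace β] (f : ι → Ω → β) (hf : ∀ i, Measurable (f i)) :
    ProbabilityTheory.iIndepFun (fun i (z : ι → Ω) => f i (z i)) (Measure.pi fun _ => μ) :=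
  ProbabilityTheory.iIndepFun_pi fun i => (hf i).aemeasurable

theorem lintegral_prod_pi {ι : Type*} [Fintype ι] (m : Measure Ω) [IsProbabilityMeasure m]
    (f : ι → Ω → ℝ≥0∞) (hf : ∀ i, Measurable (f i)) :
    ∫⁻ z, ∏ i, f i (z i) ∂(Measure.pi fun _ : ι => m) = ∏ i, ∫⁻ x, f i x ∂m := by
  rw [ProbabilityTheory.lintegral_prod_eq_prod_lintegral_of_indepFun Finset.univ _
    (iIndepFun_pi_eval m f hf) fun i => (hf i).comp (measurable_pi_apply i)]
  exact Finset.prod_congr rfl fun i _ =>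
    (measurePreserving_eval (fun _ : ι => m) i).lintegral_comp (hf i)

theorem pi_eq_withDensity_prod_rnDeriv {ι : Type*} [Fintype ι] {μ m : Measure Ω}
    [IsProbabilityMeasure μ] [IsProbabilityMeasure m] (h : μ ≪ m) :
    (Measure.pi fun _ : ι => μ) =
      (Measure.pi fun _ : ι => m).withDensity fun z => ∏ i, μ.rnDeriv m (z i) := by
  refine Measure.pi_eq fun s hs => ?_
  rw [withDensity_apply _ (MeasurableSet.univ_pi hs),
    ← lintegral_indicator (MeasurableSet.univ_pi hs)]
  have : (univ.pi s).indicator (fun z : ι → Ω => ∏ i, μ.rnDeriv m (z i)) =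
      fun z => ∏ i, (s i).indicator (μ.rnDeriv m) (z i) := by
    ext z
    by_cases hz : z ∈ univ.pi s
    · rw [indicator_of_mem hz]
      exact Finset.prod_congr rfl fun i _ => (indicator_of_mem (hz i (mem_univ i)) _).symm
    · rw [indicator_of_notMem hz]
      simp only [mem_univ_pi, not_forall] at hz
      obtain ⟨i, hi⟩ := hz
      exact (Finset.prod_eq_zero (Finset.mem_univ i) (indicator_of_notMem hi _)).symm
  rw [this, lintegral_prod_pi m _ fun i => (Measure.measurable_rnDeriv μ m).indicator (hs i)]
  refine Finset.prod_congr rfl fun i _ => ?_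
  rw [lintegral_indicator (hs i), Measure.setLIntegral_rnDeriv h]

theorem map_pair_pi {ι : Type*} [Fintype ι] (μ : Measure Ω) [IsProbabilityMeasure μ] {i j : ι}
    (hij : i ≠ j) :
    (Measure.pi fun _ : ι => μ).map (fun z => (z i, z j)) = μ.prod μ := by
  have h := (iIndepFun_pi_eval μ (fun (_ : ι) x => x) fun _ => measurable_id).indepFun hij
  rw [ProbabilityTheory.indepFun_iff_map_prod_eq_prod_map_map
    (measurable_pi_apply i).aemeasurable (measurable_pi_apply j).aemeasurable] at h
  rw [h, (measurePreserving_eval (fun _ : ι => μ) i).map_eq,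
    (measurePreserving_eval (fun _ : ι => μ) j).map_eq]

theorem measurable_pair_sum {V : Ω × Ω → ℝ≥0∞} (hV : Measurable V) (N : ℕ) :
    Measurable fun z : Fin N → Ω =>
      ∑ i : Fin N, ∑ j : Fin N, if (i : ℕ) < (j : ℕ) then V (z i, z j) else 0 := by
  refine Finset.measurable_sum _ fun i _ => Finset.measurable_sum _ fun j _ => ?_
  split_ifs
  · exact hV.comp ((measurable_pi_apply i).prodMk (measurable_pi_apply j))
  · exact measurable_const

theorem lintegral_pair_sum_le {V : Ω × Ω → ℝ≥0∞} (hV : Measurable V) (N : ℕ) (μ : Measure Ω)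
    [IsProbabilityMeasure μ] :
    2 * ∫⁻ z, (∑ i : Fin N, ∑ j : Fin N, if (i : ℕ) < (j : ℕ) then V (z i, z j) else 0)
      ∂(Measure.pi fun _ => μ) ≤ N * N * ∫⁻ p, V p ∂(μ.prod μ) := by
  have hm (i j : Fin N) : Measurable fun z : Fin N → Ω =>
      if (i : ℕ) < (j : ℕ) then V (z i, z j) else 0 := by
    split_ifs
    · exact hV.comp ((measurable_pi_apply i).prodMk (measurable_pi_apply j))
    · exact measurable_const
  rw [lintegral_finsetSum _ fun i _ => Finset.measurable_sum _ fun j _ => hm i j]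
  simp_rw [lintegral_finsetSum _ fun j _ => hm _ j]
  have h1 (i j : Fin N) : ∫⁻ z, (if (i : ℕ) < (j : ℕ) then V (z i, z j) else 0)
      ∂(Measure.pi fun _ : Fin N => μ) =
      if (i : ℕ) < (j : ℕ) then ∫⁻ p, V p ∂(μ.prod μ) else 0 := by
    split_ifs with h
    · have hij : i ≠ j := fun e => by simp [e] at h
      rw [← map_pair_pi μ hij, lintegral_map hV
        ((measurable_pi_apply i).prodMk (measurable_pi_apply j))]
    · simp
  simp_rw [h1]
  rw [two_mul, ← sum_sum_lt_add_self_of_symm fun _ _ => rfl]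
  calc _ ≤ ∑ _i : Fin N, ∑ _j : Fin N, ∫⁻ p, V p ∂(μ.prod μ) :=
        Finset.sum_le_sum fun i _ => Finset.sum_le_sum fun j _ => by split_ifs <;> simp
    _ = _ := by simp [mul_assoc]

theorem negExp_nonneg (t : ℝ) (a : ℝ≥0∞) : 0 ≤ negExp t a := by
  unfold negExp
  split_ifs <;> positivity

theorem negExp_le_one {t : ℝ} (ht : 0 ≤ t) (a : ℝ≥0∞) : negExp t a ≤ 1 := by
  simpa using negExp_le_exp_of_le ht (b := 0) (a := a) fun _ => ENNReal.toReal_nonneg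

theorem measurable_negExp (t : ℝ) : Measurable (negExp t) :=
  Measurable.ite (measurableSet_singleton ⊤) measurable_const (by fun_prop)

theorem exp_le_integral_negExp {V : Ω × Ω → ℝ≥0∞} (hV : Measurable V)
    {μ m : Measure Ω} [IsProbabilityMeasure μ] [IsProbabilityMeasure m]
    (hK : InformationTheory.klDiv μ m ≠ ⊤) (hE : ∫⁻ p, V p ∂(μ.prod μ) ≠ ⊤)
    {θ : ℝ} (hθ : 0 < θ) {N : ℕ} (hN : 1 ≤ N) :
    Real.exp (N * (-((2 * θ)⁻¹ * (∫⁻ p, V p ∂(μ.prod μ)).toReal)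
        - (InformationTheory.klDiv μ m).toReal)) ≤
      ∫ z : Fin N → Ω, negExp (((N : ℝ) * θ)⁻¹)
        (∑ i : Fin N, ∑ j : Fin N, if (i : ℕ) < (j : ℕ) then V (z i, z j) else 0)
          ∂(Measure.pi fun _ => m) := by
  obtain ⟨hac, hllr⟩ := InformationTheory.klDiv_ne_top_iff.1 hK
  have hKeq := InformationTheory.toReal_klDiv_of_measure_eq hac (by simp)
  have hN0 : (0 : ℝ) < N := by exact_mod_cast hN
  set v := ∫⁻ p, V p ∂(μ.prod μ)
  set I : (Fin N → Ω) → ℝ≥0∞ := fun z =>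
    ∑ i : Fin N, ∑ j : Fin N, if (i : ℕ) < (j : ℕ) then V (z i, z j) else 0 with hI
  set P : Measure (Fin N → Ω) := Measure.pi fun _ => μ with hP
  set Q : Measure (Fin N → Ω) := Measure.pi fun _ => m with hQ
  set D : (Fin N → Ω) → ℝ≥0∞ := fun z => ∏ i, μ.rnDeriv m (z i) with hD
  have hDm : Measurable D := Finset.measurable_prod _ fun i _ =>
    (Measure.measurable_rnDeriv μ m).comp (measurable_pi_apply i)
  have hPD : P = Q.withDensity D := pi_eq_withDensity_prod_rnDeriv hac
  have hIm : Measurable I := measurable_pair_sum hV N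
  have hIle : 2 * ∫⁻ z, I z ∂P ≤ N * N * v := lintegral_pair_sum_le hV N μ
  have hNv : (N : ℝ≥0∞) * N * v ≠ ⊤ := by finiteness
  have hItop : ∫⁻ z, I z ∂P ≠ ⊤ := fun h => by simp [h, hNv] at hIle
  have hIae : ∀ᵐ z ∂P, I z < ⊤ := ae_lt_top hIm hItop
  have hIr : 2 * ∫ z, (I z).toReal ∂P ≤ N * N * v.toReal := by
    rw [integral_toReal hIm.aemeasurable hIae]
    simpa using ENNReal.toReal_mono hNv hIle
  have hIi : Integrable (fun z => (I z).toReal) P :=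
    integrable_toReal_of_lintegral_ne_top hIm.aemeasurable hItop
  have hlli (i : Fin N) : Integrable (fun z : Fin N → Ω => llr μ m (z i)) P :=
    integrable_comp_eval (μ := fun _ : Fin N => μ) hllr
  have hllE (i : Fin N) : ∫ z : Fin N → Ω, llr μ m (z i) ∂P =
      (InformationTheory.klDiv μ m).toReal := by
    rw [hKeq]
    exact integral_comp_eval (μ := fun _ : Fin N => μ) hllr.aestronglyMeasurable
  set X : (Fin N → Ω) → ℝ := fun z =>
    -(((N : ℝ) * θ)⁻¹ * (I z).toReal) - ∑ i, llr μ m (z i) with hX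
  have hXi : Integrable X P :=
    (hIi.const_mul _).neg.sub (integrable_finsetSum _ fun i _ => hlli i)
  set c := ∫ z, X z ∂P with hc
  have hcle : N * (-((2 * θ)⁻¹ * v.toReal) - (InformationTheory.klDiv μ m).toReal) ≤ c := by
    have h1 : c = -(((N : ℝ) * θ)⁻¹ * ∫ z, (I z).toReal ∂P) -
        N * (InformationTheory.klDiv μ m).toReal := by
      rw [hc]
      simp only [hX]
      rw [integral_sub (f := fun z => -(((N : ℝ) * θ)⁻¹ * (I z).toReal)) (hIi.const_mul _).neg
        (integrable_finsetSum _ fun i _ => hlli i), integral_neg, integral_const_mul, integral_finsetSum _ fun i _ => hlli i]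
      simp [hllE]
    have h2 : ((N : ℝ) * θ)⁻¹ * ∫ z, (I z).toReal ∂P ≤ N * ((2 * θ)⁻¹ * v.toReal) := by
      calc ((N : ℝ) * θ)⁻¹ * ∫ z, (I z).toReal ∂P
          ≤ ((N : ℝ) * θ)⁻¹ * (N * N * v.toReal / 2) := by gcongr; linarith
        _ = _ := by field_simp
    rw [h1]
    linarith
  refine (Real.exp_le_exp.2 hcle).trans ?_
  have hYi : Integrable (fun z => Real.exp c * (1 + X z - c)) P :=
    (((integrable_const 1).add hXi).sub (integrable_const c)).const_mul _
  have hYE : ∫ z, Real.exp c * (1 + X z - c) ∂P = Real.exp c := by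
    rw [integral_const_mul, integral_sub (f := fun z => 1 + X z) ((integrable_const 1).add hXi)
      (integrable_const c), integral_add (integrable_const 1) hXi]
    simp [← hc]
  have hDtop : ∀ᵐ z ∂Q, D z < ⊤ := by
    refine ae_lt_top hDm ?_
    have := measure_univ (μ := P)
    rw [hPD, withDensity_apply _ MeasurableSet.univ, Measure.restrict_univ] at this
    simp [this]
  rw [← hYE]
  rw [hPD] at hYi hIae ⊢
  rw [integrable_withDensity_iff_integrable_smul' hDm hDtop] at hYi
  rw [integral_withDensity_eq_integral_toReal_smul hDm hDtop]
  rw [ae_withDensity_iff hDm] at hIae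
  refine integral_mono_ae hYi (Integrable.of_bound
    ((measurable_negExp _).comp hIm).aestronglyMeasurable 1 (ae_of_all _ fun z => by
      rw [Real.norm_of_nonneg (negExp_nonneg _ _)]
      exact negExp_le_one (by positivity) _)) ?_
  filter_upwards [hIae, hDtop] with z hz hzt
  by_cases hz0 : D z = 0
  · simpa [hz0] using negExp_nonneg _ _
  · have hDpos : 0 < (D z).toReal := ENNReal.toReal_pos hz0 hzt.ne
    have hlog : Real.log (D z).toReal = ∑ i, llr μ m (z i) := by
      simp only [hD, ENNReal.toReal_prod]
      rw [Real.log_prod fun i _ => ?_]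
      · rfl
      · intro h
        apply hDpos.ne'
        simp only [hD, ENNReal.toReal_prod]
        exact Finset.prod_eq_zero (Finset.mem_univ i) h
    have h1 : Real.exp c * (1 + X z - c) ≤ Real.exp (X z) := by
      have := Real.add_one_le_exp (X z - c)
      calc Real.exp c * (1 + X z - c) ≤ Real.exp c * Real.exp (X z - c) := by gcongr; linarith
        _ = _ := by rw [← Real.exp_add]; ring_nf
    simp only [smul_eq_mul]
    unfold negExp
    rw [if_neg (hz hz0).ne]
    calc (D z).toReal * (Real.exp c * (1 + X z - c)) ≤ (D z).toReal * Real.exp (X z) := by gcongr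
      _ = _ := by
        simp only [hX]
        rw [← hlog, Real.exp_sub, Real.exp_log hDpos]
        field_simp
        rfl

end LowerBound

section PhaseSpace

/-- The normalized Lebesgue measure on `Λ`. -/
def normLeb (Λ : Set Euc) : Measure Euc := (volume Λ)⁻¹ • volume.restrict Λ

theorem isProbabilityMeasure_normLeb {Λ : Set Euc} (h0 : volume Λ ≠ 0) (htop : volume Λ ≠ ⊤) :
    IsProbabilityMeasure (normLeb Λ) :=
  ⟨by simp [normLeb, ENNReal.inv_mul_cancel h0 htop]⟩

/-- The Maxwellian momentum density at temperature `θ`. -/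
def maxwellDensity (θ : ℝ) (p : Euc) : ℝ :=
  (2 * π * θ) ^ (-(3 : ℝ) / 2) * Real.exp (-(2 * θ)⁻¹ * ‖p‖ ^ 2)

/-- The Maxwellian momentum distribution at temperature `θ`. -/
def maxwell (θ : ℝ) : Measure Euc :=
  volume.withDensity fun p => ENNReal.ofReal (maxwellDensity θ p)

theorem maxwellDensity_pos {θ : ℝ} (hθ : 0 < θ) (p : Euc) : 0 < maxwellDensity θ p := by
  unfold maxwellDensity
  positivity

@[fun_prop]
theorem measurable_maxwellDensity (θ : ℝ) : Measurable (maxwellDensity θ) := by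
  unfold maxwellDensity
  fun_prop

theorem integrable_exp_neg_mul_norm_sq {b : ℝ} (hb : 0 < b) :
    Integrable fun p : Euc => Real.exp (-b * ‖p‖ ^ 2) := by
  by_contra h
  have h1 := GaussianFourier.integral_rexp_neg_mul_sq_norm (V := Euc) hb
  rw [integral_undef h] at h1
  exact (by positivity : 0 < (π / b) ^ (Module.finrank ℝ Euc / 2 : ℝ)).ne h1

theorem integral_maxwellDensity {θ : ℝ} (hθ : 0 < θ) : ∫ p, maxwellDensity θ p = 1 := by
  simp only [maxwellDensity]
  rw [integral_const_mul,
    GaussianFourier.integral_rexp_neg_mul_sq_norm (V := Euc) (by positivity : 0 < (2 * θ)⁻¹)]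
  have h1 : π / (2 * θ)⁻¹ = 2 * π * θ := by field_simp
  have h2 : (Module.finrank ℝ Euc / 2 : ℝ) = 3 / 2 := by simp [Euc]
  rw [h1, h2, ← Real.rpow_add (by positivity)]
  norm_num

theorem isProbabilityMeasure_maxwell {θ : ℝ} (hθ : 0 < θ) : IsProbabilityMeasure (maxwell θ) := by
  refine ⟨?_⟩
  rw [maxwell, withDensity_apply _ MeasurableSet.univ, Measure.restrict_univ,
    ← ofReal_integral_eq_lintegral_ofReal _ (ae_of_all _ fun p => (maxwellDensity_pos hθ p).le),
    integral_maxwellDensity hθ, ENNReal.ofReal_one]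
  exact (integrable_exp_neg_mul_norm_sq (by positivity)).const_mul _

theorem lintegral_norm_sq_maxwell_ne_top {θ : ℝ} (hθ : 0 < θ) :
    ∫⁻ p, ENNReal.ofReal (‖p‖ ^ 2 / 2) ∂(maxwell θ) ≠ ⊤ := by
  set b := (2 * θ)⁻¹ with hb
  have hb0 : 0 < b := by positivity
  have hInt : Integrable fun p : Euc =>
      (2 * π * θ) ^ (-(3 : ℝ) / 2) * b⁻¹ * Real.exp (-(b / 2) * ‖p‖ ^ 2) :=
    (integrable_exp_neg_mul_norm_sq (by positivity)).const_mul _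
  rw [maxwell, lintegral_withDensity_eq_lintegral_mul _ (by fun_prop) (by fun_prop)]
  refine ne_top_of_le_ne_top hInt.lintegral_lt_top.ne (lintegral_mono fun p => ?_)
  simp only [Pi.mul_apply]
  rw [← ENNReal.ofReal_mul (maxwellDensity_pos hθ p).le]
  refine ENNReal.ofReal_le_ofReal ?_
  have hk : 0 < (2 * π * θ) ^ (-(3 : ℝ) / 2) := by positivity
  rw [maxwellDensity, ← hb]
  set k := (2 * π * θ) ^ (-(3 : ℝ) / 2)
  have h1 : Real.exp (-b * ‖p‖ ^ 2) =
      Real.exp (-(b / 2) * ‖p‖ ^ 2) * Real.exp (-(b / 2 * ‖p‖ ^ 2)) := by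
    rw [← Real.exp_add]; ring_nf
  have h2 : b / 2 * ‖p‖ ^ 2 * Real.exp (-(b / 2 * ‖p‖ ^ 2)) ≤ 1 := by
    rw [Real.exp_neg, ← div_eq_mul_inv, div_le_one (Real.exp_pos _)]
    linarith [Real.add_one_le_exp (b / 2 * ‖p‖ ^ 2)]
  rw [h1]
  calc _ = k * b⁻¹ * Real.exp (-(b / 2) * ‖p‖ ^ 2) *
        (b / 2 * ‖p‖ ^ 2 * Real.exp (-(b / 2 * ‖p‖ ^ 2))) := by field_simp
    _ ≤ k * b⁻¹ * Real.exp (-(b / 2) * ‖p‖ ^ 2) * 1 := by gcongr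
    _ = _ := mul_one _

theorem lintegral_norm_sq_maxwell_ne_zero {θ : ℝ} (hθ : 0 < θ) :
    ∫⁻ p, ENNReal.ofReal (‖p‖ ^ 2 / 2) ∂(maxwell θ) ≠ 0 := by
  have := isProbabilityMeasure_maxwell hθ
  intro h
  rw [lintegral_eq_zero_iff (by fun_prop)] at h
  have h1 : ∀ᵐ p ∂(maxwell θ), p ≠ 0 :=
    (withDensity_absolutelyContinuous _ _).ae_le (compl_mem_ae_iff.2 (measure_singleton 0))
  obtain ⟨p, hp, hp'⟩ := (h.and h1).exists
  simp only [Pi.zero_apply, ENNReal.ofReal_eq_zero] at hp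
  have : 0 < ‖p‖ := norm_pos_iff.2 hp'
  have : 0 < ‖p‖ ^ 2 / 2 := by positivity
  linarith

theorem normLeb_eq_withDensity {Λ : Set Euc} (hΛ : MeasurableSet Λ) (h0 : volume Λ ≠ 0)
    (htop : volume Λ ≠ ⊤) : normLeb Λ = volume.withDensity
      fun q => ENNReal.ofReal (Λ.indicator (fun _ => (volume Λ).toReal⁻¹) q) := by
  have h1 : (fun q => ENNReal.ofReal (Λ.indicator (fun _ => (volume Λ).toReal⁻¹) q)) =
      Λ.indicator fun _ => (volume Λ)⁻¹ := by
    ext q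
    by_cases hq : q ∈ Λ
    · simp [hq, ENNReal.ofReal_inv_of_pos (ENNReal.toReal_pos h0 htop), ENNReal.ofReal_toReal htop]
    · simp [hq]
  rw [h1, withDensity_indicator hΛ, withDensity_const, normLeb]

theorem maxwell_prod_withDensity {θ : ℝ} (hθ : 0 < θ) {ρ : Euc → ℝ} (hρ : Measurable ρ) :
    (maxwell θ).prod (volume.withDensity fun q => ENNReal.ofReal (ρ q)) =
      volume.withDensity fun z : Euc × Euc => ENNReal.ofReal (maxwellDensity θ z.1 * ρ z.2) := by
  rw [maxwell, prod_withDensity (by fun_prop) (by fun_prop)]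
  congr 1
  ext z
  rw [ENNReal.ofReal_mul (maxwellDensity_pos hθ _).le]

end PhaseSpace

section FreeEnergy

variable {Λ : Set Euc} {θ : ℝ} {f : Euc × Euc → ℝ}

/-- The law on phase space with density `f`. -/
def phaseLaw (f : Euc × Euc → ℝ) : Measure (Euc × Euc) :=
  volume.withDensity fun z => ENNReal.ofReal (f z)

theorem phaseLaw_univ (f : Euc × Euc → ℝ) : phaseLaw f univ = ∫⁻ z, ENNReal.ofReal (f z) := by
  rw [phaseLaw, withDensity_apply _ MeasurableSet.univ, Measure.restrict_univ]

theorem integrable_of_isProbabilityMeasure_phaseLaw (hf : Measurable f) (hf0 : ∀ z, 0 ≤ f z)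
    [h : IsProbabilityMeasure (phaseLaw f)] : Integrable f ∧ ∫ z, f z = 1 := by
  have h1 : ∫⁻ z, ENNReal.ofReal (f z) = 1 := by rw [← phaseLaw_univ, measure_univ]
  refine ⟨(lintegral_ofReal_ne_top_iff_integrable hf.aestronglyMeasurable
    (ae_of_all _ hf0)).1 (by simp [h1]), ?_⟩
  rw [integral_eq_lintegral_of_nonneg_ae (ae_of_all _ hf0) hf.aestronglyMeasurable, h1,
    ENNReal.toReal_one]

theorem isProbabilityMeasure_phaseLaw (hf0 : ∀ z, 0 ≤ f z) (hi : Integrable f)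
    (h1 : ∫ z, f z = 1) : IsProbabilityMeasure (phaseLaw f) := by
  refine ⟨?_⟩
  rw [phaseLaw_univ, ← ofReal_integral_eq_lintegral_ofReal hi (ae_of_all _ hf0), h1,
    ENNReal.ofReal_one]

theorem lintegral_phaseLaw (hf : Measurable f) {L : Euc × Euc → ℝ≥0∞} (hL : Measurable L) :
    ∫⁻ z, L z ∂(phaseLaw f) = ∫⁻ z, ENNReal.ofReal (f z) * L z := by
  rw [phaseLaw, lintegral_withDensity_eq_lintegral_mul _ (by fun_prop) hL]
  rfl

theorem integral_phaseLaw (hf : Measurable f) (hf0 : ∀ z, 0 ≤ f z) (L : Euc × Euc → ℝ) :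
    ∫ z, L z ∂(phaseLaw f) = ∫ z, f z * L z := by
  rw [phaseLaw, integral_withDensity_eq_integral_toReal_smul (by fun_prop)
    (ae_of_all _ fun _ => ENNReal.ofReal_lt_top)]
  simp [ENNReal.toReal_ofReal (hf0 _)]

theorem integrable_phaseLaw_iff (hf : Measurable f) (hf0 : ∀ z, 0 ≤ f z) (L : Euc × Euc → ℝ) :
    Integrable L (phaseLaw f) ↔ Integrable fun z => f z * L z := by
  rw [phaseLaw, integrable_withDensity_iff_integrable_smul' (by fun_prop)
    (ae_of_all _ fun _ => ENNReal.ofReal_lt_top)]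
  simp [ENNReal.toReal_ofReal (hf0 _)]

theorem llr_phaseLaw (hΛ : MeasurableSet Λ) (h0 : volume Λ ≠ 0) (htop : volume Λ ≠ ⊤)
    (hθ : 0 < θ) (hf : Measurable f) (hfΛ : ∀ z : Euc × Euc, z.2 ∉ Λ → f z = 0) :
    phaseLaw f ≪ (maxwell θ).prod (normLeb Λ) ∧
    llr (phaseLaw f) ((maxwell θ).prod (normLeb Λ)) =ᵐ[phaseLaw f] fun z =>
      Real.log (f z) + θ⁻¹ * (‖z.1‖ ^ 2 / 2) +
        (3 / 2 * Real.log (2 * π * θ) + Real.log (volume Λ).toReal) := by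
  have hv : 0 < (volume Λ).toReal := ENNReal.toReal_pos h0 htop
  have := isProbabilityMeasure_maxwell hθ
  have := isProbabilityMeasure_normLeb h0 htop
  set m := (maxwell θ).prod (normLeb Λ) with hm
  set g : Euc × Euc → ℝ := fun z =>
    maxwellDensity θ z.1 * Λ.indicator (fun _ => (volume Λ).toReal⁻¹) z.2 with hg
  have hind : Measurable (Λ.indicator fun _ => (volume Λ).toReal⁻¹) := measurable_const.indicator hΛ
  have hgm : Measurable g := by fun_prop
  have hgpos (z : Euc × Euc) (hz : z.2 ∈ Λ) : 0 < g z := by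
    have := maxwellDensity_pos hθ z.1
    simp only [hg, indicator_of_mem hz]
    positivity
  have hmg : m = volume.withDensity fun z => ENNReal.ofReal (g z) := by
    rw [hm, normLeb_eq_withDensity hΛ h0 htop, maxwell_prod_withDensity hθ hind]
  have hP : phaseLaw f = m.withDensity fun z => ENNReal.ofReal (f z / g z) := by
    rw [hmg, ← withDensity_mul _ (by fun_prop) (by fun_prop), phaseLaw]
    congr 1
    ext z
    by_cases hz : z.2 ∈ Λ
    · rw [Pi.mul_apply, ← ENNReal.ofReal_mul (hgpos z hz).le,
        mul_div_cancel₀ _ (hgpos z hz).ne']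
    · simp [hfΛ z hz]
  have hac : phaseLaw f ≪ m := by rw [hP]; exact withDensity_absolutelyContinuous _ _
  refine ⟨hac, ?_⟩
  have h1 : (phaseLaw f).rnDeriv m =ᵐ[phaseLaw f] fun z => ENNReal.ofReal (f z / g z) := by
    refine hac.ae_le ?_
    rw [hP]
    exact Measure.rnDeriv_withDensity m (by fun_prop)
  have h2 : ∀ᵐ z ∂(phaseLaw f), 0 < f z := by
    rw [phaseLaw, ae_withDensity_iff (by fun_prop)]
    exact ae_of_all _ fun z hz => by simpa using hz
  filter_upwards [h1, h2] with z hz1 hz2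
  have hz : z.2 ∈ Λ := by
    by_contra h
    exact hz2.ne' (hfΛ z h)
  rw [llr_def]
  simp only
  rw [hz1, ENNReal.toReal_ofReal (div_nonneg hz2.le (hgpos z hz).le),
    Real.log_div hz2.ne' (hgpos z hz).ne']
  simp only [hg, indicator_of_mem hz, maxwellDensity]
  rw [Real.log_mul (by positivity) (by positivity), Real.log_mul (by positivity) (by positivity),
    Real.log_exp, Real.log_rpow (by positivity), Real.log_inv]
  field_simp
  ring

/-- Total mass and momentum contributions to the free energy of a density at temperature `θ`. -/
def refPotential (Λ : Set Euc) (θ : ℝ) : ℝ :=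
  Real.log (volume Λ).toReal + 3 / 2 * Real.log (2 * π * θ) + 1

theorem klDiv_phaseLaw (hΛ : MeasurableSet Λ) (h0 : volume Λ ≠ 0) (htop : volume Λ ≠ ⊤)
    (hθ : 0 < θ) (hf : Measurable f) (hf0 : ∀ z, 0 ≤ f z)
    (hfΛ : ∀ z : Euc × Euc, z.2 ∉ Λ → f z = 0) (hP : IsProbabilityMeasure (phaseLaw f))
    (hkin : ∫⁻ z : Euc × Euc, ENNReal.ofReal (‖z.1‖ ^ 2 / 2 * f z) ≠ ⊤) :
    (InformationTheory.klDiv (phaseLaw f) ((maxwell θ).prod (normLeb Λ)) ≠ ⊤ ↔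
      Integrable fun z => f z * |Real.log (f z)|) ∧
    (InformationTheory.klDiv (phaseLaw f) ((maxwell θ).prod (normLeb Λ)) ≠ ⊤ →
      (InformationTheory.klDiv (phaseLaw f) ((maxwell θ).prod (normLeb Λ))).toReal =
        Hfun f + θ⁻¹ * (∫⁻ z : Euc × Euc, ENNReal.ofReal (‖z.1‖ ^ 2 / 2 * f z)).toReal +
          refPotential Λ θ) := by
  have := isProbabilityMeasure_maxwell hθ
  have := isProbabilityMeasure_normLeb h0 htop
  obtain ⟨hac, hllr⟩ := llr_phaseLaw hΛ h0 htop hθ hf hfΛ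
  obtain ⟨hfi, hf1⟩ := integrable_of_isProbabilityMeasure_phaseLaw hf hf0
  set B := 3 / 2 * Real.log (2 * π * θ) + Real.log (volume Λ).toReal with hB
  have hk0 (z : Euc × Euc) : 0 ≤ ‖z.1‖ ^ 2 / 2 * f z := mul_nonneg (by positivity) (hf0 z)
  have hkm : AEStronglyMeasurable (fun z : Euc × Euc => ‖z.1‖ ^ 2 / 2 * f z) volume := by
    apply Measurable.aestronglyMeasurable; fun_prop
  have hki : Integrable fun z : Euc × Euc => ‖z.1‖ ^ 2 / 2 * f z :=
    (lintegral_ofReal_ne_top_iff_integrable hkm (ae_of_all _ hk0)).1 hkin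
  have hkE := integral_eq_lintegral_of_nonneg_ae (ae_of_all _ hk0) hkm
  have hrest : Integrable fun z => θ⁻¹ * (‖z.1‖ ^ 2 / 2 * f z) + B * f z :=
    (hki.const_mul _).add (hfi.const_mul _)
  have hsplit : (fun z => f z * (Real.log (f z) + θ⁻¹ * (‖z.1‖ ^ 2 / 2) + B)) =
      fun z => f z * Real.log (f z) + (θ⁻¹ * (‖z.1‖ ^ 2 / 2 * f z) + B * f z) := by
    ext z; ring
  have hflog : (Integrable fun z => f z * |Real.log (f z)|) ↔
      Integrable fun z => f z * Real.log (f z) := by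
    rw [← integrable_norm_iff (f := fun z => f z * Real.log (f z))
      (by apply Measurable.aestronglyMeasurable; fun_prop)]
    simp only [norm_mul, Real.norm_eq_abs, abs_of_nonneg (hf0 _)]
  have hiff : InformationTheory.klDiv (phaseLaw f) ((maxwell θ).prod (normLeb Λ)) ≠ ⊤ ↔
      Integrable fun z => f z * Real.log (f z) := by
    rw [InformationTheory.klDiv_ne_top_iff, and_iff_right hac, integrable_congr hllr,
      integrable_phaseLaw_iff hf hf0, hsplit, integrable_add_iff_integrable_left' hrest]
  refine ⟨hiff.trans hflog.symm, fun h => ?_⟩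
  rw [InformationTheory.toReal_klDiv_of_measure_eq hac (by simp), integral_congr_ae hllr,
    integral_phaseLaw hf hf0, hsplit, integral_add (hiff.1 h) hrest,
    integral_add (hki.const_mul _) (hfi.const_mul _), integral_const_mul, integral_const_mul,
    hkE, hf1, Hfun]
  have h2 : (fun z => f z * (Real.log (f z) - 1)) = fun z => f z * Real.log (f z) - f z := by
    ext z; ring
  rw [h2, integral_sub (hiff.1 h) hfi, hf1, refPotential, hB]
  ring

end FreeEnergy

section Interaction

variable {U : Euc → Euc → ℝ≥0∞} {Λ : Set Euc}

/-- The pair interaction, set to zero outside `cl(Λ) × cl(Λ)`. -/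
def cutoff (U : Euc → Euc → ℝ≥0∞) (Λ : Set Euc) : Euc × Euc → ℝ≥0∞ :=
  (closure Λ ×ˢ closure Λ).indicator fun p => U p.1 p.2

theorem cutoff_of_mem {x y : Euc} (hx : x ∈ closure Λ) (hy : y ∈ closure Λ) :
    cutoff U Λ (x, y) = U x y :=
  indicator_of_mem (mk_mem_prod hx hy) _

theorem LowerSemicontinuousOn.measurable_indicator {X : Type*} [TopologicalSpace X]
    [MeasurableSpace X] [BorelSpace X] {s : Set X} (hs : IsClosed s) {V : X → ℝ≥0∞}
    (hV : LowerSemicontinuousOn V s) : Measurable (s.indicator V) := by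
  have h : LowerSemicontinuous fun x => if x ∈ s then V x else ⊤ := by
    intro x y hy
    by_cases hx : x ∈ s
    · simp only [hx, if_true] at hy
      have := eventually_nhdsWithin_iff.1 (hV x hx y hy)
      filter_upwards [this] with z hz
      split_ifs with h
      · exact hz h
      · exact hy.trans_le le_top
    · simp only [hx, if_false] at hy
      filter_upwards [hs.isOpen_compl.mem_nhds hx] with z hz
      simpa [show z ∉ s from hz] using hy
  have h2 : s.indicator V = s.indicator fun x => if x ∈ s then V x else ⊤ := by
    ext x
    by_cases hx : x ∈ s <;> simp [hx]
  rw [h2]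
  exact h.measurable.indicator hs.measurableSet

theorem measurable_cutoff
    (hU : LowerSemicontinuousOn (fun p : Euc × Euc => U p.1 p.2) (closure Λ ×ˢ closure Λ)) :
    Measurable (cutoff U Λ) :=
  hU.measurable_indicator (isClosed_closure.prod isClosed_closure)

theorem pairingE_eq_lintegral_cutoff (hV : Measurable (cutoff U Λ)) {μ : Measure Euc}
    [IsProbabilityMeasure μ] (hμ : ∀ᵐ x ∂μ, x ∈ closure Λ) :
    pairingE U μ μ = (∫⁻ p, cutoff U Λ p ∂(μ.prod μ)) / 2 := by
  rw [lintegral_prod _ hV.aemeasurable, div_eq_mul_inv, ← lintegral_mul_const _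
    hV.lintegral_prod_right', pairingE]
  refine lintegral_congr_ae ?_
  filter_upwards [hμ] with x hx
  have hVx : Measurable fun y => cutoff U Λ (x, y) := hV.comp measurable_prodMk_left
  rw [← lintegral_mul_const _ hVx]
  refine lintegral_congr_ae ?_
  filter_upwards [hμ] with y hy
  rw [cutoff_of_mem hx hy, div_eq_mul_inv]

theorem Efun_eq (hV : Measurable (cutoff U Λ)) {f : Euc × Euc → ℝ} (hf : Measurable f)
    (hfΛ : ∀ z : Euc × Euc, z.2 ∉ Λ → f z = 0) [IsProbabilityMeasure (phaseLaw f)] :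
    Efun U f = (∫⁻ z : Euc × Euc, ENNReal.ofReal (‖z.1‖ ^ 2 / 2 * f z)) +
      (∫⁻ p, cutoff U Λ p ∂(((phaseLaw f).map Prod.snd).prod ((phaseLaw f).map Prod.snd))) / 2 := by
  have hfo : Measurable fun z => ENNReal.ofReal (f z) := by fun_prop
  have := Measure.isProbabilityMeasure_map (μ := phaseLaw f) measurable_snd.aemeasurable
  rw [Efun]
  congr 1
  rw [lintegral_prod _ hV.aemeasurable, div_eq_mul_inv, ← lintegral_mul_const _
    hV.lintegral_prod_right', lintegral_map (by
      exact (hV.lintegral_prod_right').mul_const _) measurable_snd]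
  have hin : Measurable fun z : Euc × Euc =>
      (∫⁻ y, cutoff U Λ (z.2, y) ∂((phaseLaw f).map Prod.snd)) * 2⁻¹ :=
    ((hV.lintegral_prod_right').mul_const _).comp measurable_snd
  rw [lintegral_phaseLaw hf hin]
  refine lintegral_congr fun z => ?_
  have hVz : Measurable fun y => cutoff U Λ (z.2, y) := hV.comp measurable_prodMk_left
  have hVw : Measurable fun w : Euc × Euc => cutoff U Λ (z.2, w.2) := hVz.comp measurable_snd
  have hfw : Measurable fun w : Euc × Euc => ENNReal.ofReal (f w) * cutoff U Λ (z.2, w.2) :=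
    hfo.mul hVw
  by_cases hz : z.2 ∈ Λ
  · rw [lintegral_map hVz measurable_snd, lintegral_phaseLaw hf hVw,
      ← lintegral_mul_const _ hfw, ← lintegral_const_mul _ (hfw.mul_const _)]
    refine lintegral_congr fun w => ?_
    by_cases hw : w.2 ∈ Λ
    · rw [cutoff_of_mem (subset_closure hz) (subset_closure hw), div_eq_mul_inv]
      ring
    · simp [hfΛ w hw]
  · simp [hfΛ z hz]

end Interaction

section Variational

variable {U : Euc → Euc → ℝ≥0∞} {Λ : Set Euc} {θ : ℝ}

theorem klDiv_prod_left_eq {Ω Ω' : Type*} [MeasurableSpace Ω] [MeasurableSpace Ω']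
    (γ : Measure Ω') [IsProbabilityMeasure γ] (μ ν : Measure Ω) [IsProbabilityMeasure μ]
    [IsProbabilityMeasure ν] :
    InformationTheory.klDiv (γ.prod μ) (γ.prod ν) = InformationTheory.klDiv μ ν := by
  refine le_antisymm ?_ ?_
  · have h := InformationTheory.klDiv_map_le (μ.prod γ) (ν.prod γ) measurable_swap
    rwa [Measure.prod_swap, Measure.prod_swap, ← Measure.compProd_const (μ := μ) (ν := γ),
      ← Measure.compProd_const (μ := ν) (ν := γ), InformationTheory.klDiv_compProd_left] at h
  · have h := InformationTheory.klDiv_map_le (γ.prod μ) (γ.prod ν) measurable_snd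
    simpa [Measure.map_snd_prod] using h

theorem exists_law_of_adm (hΛ : MeasurableSet Λ) (h0 : volume Λ ≠ 0) (htop : volume Λ ≠ ⊤)
    (hV : Measurable (cutoff U Λ)) (hθ : 0 < θ) {ε : ℝ} (hε : 0 < ε) {f : Euc × Euc → ℝ}
    (hf : Adm U Λ ε f) :
    ∃ μ : Measure Euc, IsProbabilityMeasure μ ∧
      InformationTheory.klDiv μ (normLeb Λ) ≠ ⊤ ∧ ∫⁻ p, cutoff U Λ p ∂(μ.prod μ) ≠ ⊤ ∧
      -ε / θ - Hfun f ≤ refPotential Λ θ +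
        (-((2 * θ)⁻¹ * (∫⁻ p, cutoff U Λ p ∂(μ.prod μ)).toReal)
          - (InformationTheory.klDiv μ (normLeb Λ)).toReal) := by
  obtain ⟨hfm, hf0, hfΛ, hfi, hf1, hflog, hfE⟩ := hf
  have := isProbabilityMeasure_maxwell hθ
  have := isProbabilityMeasure_normLeb h0 htop
  have hP := isProbabilityMeasure_phaseLaw hf0 hfi hf1
  rw [Efun_eq hV hfm hfΛ] at hfE
  set μ := (phaseLaw f).map Prod.snd with hμ
  set v := ∫⁻ p, cutoff U Λ p ∂(μ.prod μ)
  set K := ∫⁻ z : Euc × Euc, ENNReal.ofReal (‖z.1‖ ^ 2 / 2 * f z)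
  have hsum : K + v / 2 ≠ ⊤ := hfE ▸ ENNReal.ofReal_ne_top
  obtain ⟨hK, hv2⟩ := ENNReal.add_ne_top.1 hsum
  have hv : v ≠ ⊤ := fun h => hv2 (by simp [h, ENNReal.top_div])
  obtain ⟨h1, h2⟩ := klDiv_phaseLaw hΛ h0 htop hθ hfm hf0 hfΛ hP hK
  have hkl := h1.2 hflog
  have hle := InformationTheory.klDiv_map_le (phaseLaw f) ((maxwell θ).prod (normLeb Λ))
    measurable_snd
  rw [Measure.map_snd_prod, measure_univ, one_smul, ← hμ] at hle
  refine ⟨μ, Measure.isProbabilityMeasure_map measurable_snd.aemeasurable,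
    ne_top_of_le_ne_top hkl hle, hv, ?_⟩
  have h3 := ENNReal.toReal_mono hkl hle
  rw [h2 hkl] at h3
  have h4 : K.toReal + v.toReal / 2 = ε := by
    have := congrArg ENNReal.toReal hfE
    rwa [ENNReal.toReal_add hK hv2, ENNReal.toReal_ofReal hε.le, ENNReal.toReal_div,
      ENNReal.toReal_ofNat] at this
  have h5 : -ε / θ = -(θ⁻¹ * K.toReal) - (2 * θ)⁻¹ * v.toReal := by
    rw [← h4]
    field_simp
    ring
  rw [h5]
  linarith

theorem exists_adm_of_law (hΛ : MeasurableSet Λ) (h0 : volume Λ ≠ 0) (htop : volume Λ ≠ ⊤)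
    (hV : Measurable (cutoff U Λ)) (hθ : 0 < θ) {μ : Measure Euc} [IsProbabilityMeasure μ]
    (hkl : InformationTheory.klDiv μ (normLeb Λ) ≠ ⊤)
    (hv : ∫⁻ p, cutoff U Λ p ∂(μ.prod μ) ≠ ⊤) :
    ∃ (ε : ℝ) (f : Euc × Euc → ℝ), groundEnergyE U Λ < ENNReal.ofReal ε ∧ Adm U Λ ε f ∧
      -ε / θ - Hfun f = refPotential Λ θ +
        (-((2 * θ)⁻¹ * (∫⁻ p, cutoff U Λ p ∂(μ.prod μ)).toReal)
          - (InformationTheory.klDiv μ (normLeb Λ)).toReal) := by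
  have := isProbabilityMeasure_maxwell hθ
  have := isProbabilityMeasure_normLeb h0 htop
  have hac := (InformationTheory.klDiv_ne_top_iff.1 hkl).1
  set r := μ.rnDeriv (normLeb Λ) with hr
  have hrm : Measurable r := Measure.measurable_rnDeriv _ _
  set ρ : Euc → ℝ := Λ.indicator fun q => (volume Λ).toReal⁻¹ * (r q).toReal with hρ
  have hρm : Measurable ρ := (hrm.ennreal_toReal.const_mul _).indicator hΛ
  have hρ0 (q : Euc) : 0 ≤ ρ q := indicator_nonneg (fun q _ => by positivity) q
  have hμρ : μ = volume.withDensity fun q => ENNReal.ofReal (ρ q) := by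
    have h1 : μ = (normLeb Λ).withDensity fun q => ENNReal.ofReal (r q).toReal := by
      have : SigmaFinite (normLeb Λ) := inferInstance
      have : μ.HaveLebesgueDecomposition (normLeb Λ) :=
        Measure.haveLebesgueDecomposition_of_sigmaFinite _ _
      refine (Measure.withDensity_rnDeriv_eq μ (normLeb Λ) hac).symm.trans
        (withDensity_congr_ae ?_)
      filter_upwards [Measure.rnDeriv_lt_top μ (normLeb Λ)] with q hq
      rw [ENNReal.ofReal_toReal hq.ne]
    rw [h1, normLeb_eq_withDensity hΛ h0 htop, ← withDensity_mul _ (by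
      have : Measurable (Λ.indicator fun _ => (volume Λ).toReal⁻¹) := measurable_const.indicator hΛ
      fun_prop) (by fun_prop)]
    congr 1
    ext q
    by_cases hq : q ∈ Λ
    · simp only [Pi.mul_apply, hρ, indicator_of_mem hq]
      rw [ENNReal.ofReal_mul (by positivity)]
    · simp [hρ, hq]
  set f : Euc × Euc → ℝ := fun z => maxwellDensity θ z.1 * ρ z.2 with hf
  have hfm : Measurable f := by fun_prop
  have hf0 (z : Euc × Euc) : 0 ≤ f z := mul_nonneg (maxwellDensity_pos hθ _).le (hρ0 _)
  have hfΛ (z : Euc × Euc) (hz : z.2 ∉ Λ) : f z = 0 := by simp [hf, hρ, hz]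
  have hPf : phaseLaw f = (maxwell θ).prod μ := by
    conv_rhs => rw [hμρ, maxwell_prod_withDensity hθ hρm]
    rfl
  have hP : IsProbabilityMeasure (phaseLaw f) := hPf ▸ inferInstance
  obtain ⟨hfi, hf1⟩ := integrable_of_isProbabilityMeasure_phaseLaw hfm hf0
  have hmap : (phaseLaw f).map Prod.snd = μ := by simp [hPf, Measure.map_snd_prod]
  have hKeq : ∫⁻ z : Euc × Euc, ENNReal.ofReal (‖z.1‖ ^ 2 / 2 * f z) =
      ∫⁻ p, ENNReal.ofReal (‖p‖ ^ 2 / 2) ∂(maxwell θ) := by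
    have h1 : (phaseLaw f).map Prod.fst = maxwell θ := by simp [hPf, Measure.map_fst_prod]
    rw [← h1, lintegral_map (by fun_prop) measurable_fst, lintegral_phaseLaw hfm (by fun_prop)]
    refine lintegral_congr fun z => ?_
    rw [mul_comm, ENNReal.ofReal_mul (hf0 z)]
  have hE := Efun_eq hV hfm hfΛ
  rw [hmap] at hE
  set v := ∫⁻ p, cutoff U Λ p ∂(μ.prod μ) with hvdef
  set K := ∫⁻ z : Euc × Euc, ENNReal.ofReal (‖z.1‖ ^ 2 / 2 * f z)
  have hK : K ≠ ⊤ := hKeq ▸ lintegral_norm_sq_maxwell_ne_top hθ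
  have hK0 : K ≠ 0 := hKeq ▸ lintegral_norm_sq_maxwell_ne_zero hθ
  have hv2 : v / 2 ≠ ⊤ := ENNReal.div_ne_top hv two_ne_zero
  have hsum : K + v / 2 ≠ ⊤ := ENNReal.add_ne_top.2 ⟨hK, hv2⟩
  obtain ⟨h1, h2⟩ := klDiv_phaseLaw hΛ h0 htop hθ hfm hf0 hfΛ hP hK
  have hkleq : InformationTheory.klDiv (phaseLaw f) ((maxwell θ).prod (normLeb Λ)) =
      InformationTheory.klDiv μ (normLeb Λ) := by
    rw [hPf, klDiv_prod_left_eq]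
  rw [hkleq] at h1 h2
  have hμΛ : ∀ᵐ q ∂μ, q ∈ closure Λ := by
    refine hac.ae_le (Measure.ae_smul_measure ?_ _)
    filter_upwards [ae_restrict_mem hΛ] with q hq using subset_closure hq
  refine ⟨(K + v / 2).toReal, f, ?_, ⟨hfm, hf0, hfΛ, hfi, hf1, h1.1 hkl, ?_⟩, ?_⟩
  · rw [ENNReal.ofReal_toReal hsum]
    calc groundEnergyE U Λ ≤ pairingE U μ μ := iInf₂_le μ ⟨inferInstance, hμΛ⟩
      _ = v / 2 := pairingE_eq_lintegral_cutoff hV hμΛ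
      _ < K + v / 2 := by
        rw [add_comm]
        exact ENNReal.lt_add_right hv2 hK0
  · rw [hE, ENNReal.ofReal_toReal hsum]
  · have h3 := h2 hkl
    have h4 : -(K.toReal + v.toReal / 2) / θ = -(θ⁻¹ * K.toReal) - (2 * θ)⁻¹ * v.toReal := by
      field_simp
      ring
    rw [ENNReal.toReal_add hK hv2, ENNReal.toReal_div, ENNReal.toReal_ofNat, h4]
    linarith

end Variational

section FiniteLaw

variable {U : Euc → Euc → ℝ≥0∞} {Λ : Set Euc}

theorem klDiv_normLeb_ne_top {D : Set Euc} (hD : MeasurableSet D) (hDΛ : D ⊆ Λ)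
    (hD0 : volume D ≠ 0) (htop : volume Λ ≠ ⊤) :
    InformationTheory.klDiv (normLeb D) (normLeb Λ) ≠ ⊤ := by
  have hΛ0 : volume Λ ≠ 0 := fun h => hD0 (measure_mono_null hDΛ h)
  have hDtop : volume D ≠ ⊤ := measure_ne_top_of_subset hDΛ htop
  have := isProbabilityMeasure_normLeb hD0 hDtop
  have := isProbabilityMeasure_normLeb hΛ0 htop
  set c : ℝ≥0∞ := volume Λ / volume D
  have hc : normLeb D = (normLeb Λ).withDensity (D.indicator fun _ => c) := by
    rw [withDensity_indicator hD, withDensity_const, normLeb, normLeb, Measure.restrict_smul,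
      Measure.restrict_restrict hD, inter_eq_self_of_subset_left hDΛ, smul_smul]
    congr 1
    rw [mul_comm, ← mul_div_assoc, ENNReal.inv_mul_cancel hΛ0 htop, one_div]
  have hac : normLeb D ≪ normLeb Λ := hc ▸ withDensity_absolutelyContinuous _ _
  refine InformationTheory.klDiv_ne_top hac ?_
  have hr : (normLeb D).rnDeriv (normLeb Λ) =ᵐ[normLeb Λ] D.indicator fun _ => c := by
    rw [hc]
    exact Measure.rnDeriv_withDensity _ (measurable_const.indicator hD)
  have hmem : ∀ᵐ x ∂(normLeb D), x ∈ D := Measure.ae_smul_measure (ae_restrict_mem hD) _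
  refine (integrable_const (Real.log c.toReal)).congr ?_
  filter_upwards [hac.ae_le hr, hmem] with x hx hxD
  rw [llr, hx, indicator_of_mem hxD]

theorem exists_law_lintegral_ne_top (hΛ : MeasurableSet Λ) (h0 : volume Λ ≠ 0)
    (htop : volume Λ ≠ ⊤) (hV : Measurable (cutoff U Λ))
    (hU : ∀ x ∈ Λ, ∃ r : ℝ, 0 < r ∧ (∫⁻ y in Metric.ball x r ∩ Λ, (U x y) ^ 2) < ⊤) :
    ∃ μ : Measure Euc, IsProbabilityMeasure μ ∧
      InformationTheory.klDiv μ (normLeb Λ) ≠ ⊤ ∧ ∫⁻ p, cutoff U Λ p ∂(μ.prod μ) ≠ ⊤ := by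
  set g : ℕ → Euc → ℝ≥0∞ := fun k x => ∫⁻ y in Λ,
    {p : Euc × Euc | dist p.1 p.2 < 1 / (k + 1)}.indicator (fun p => cutoff U Λ p ^ 2) (x, y)
    with hg
  have hgm (k : ℕ) : Measurable (g k) :=
    (((hV.pow_const 2).indicator (measurableSet_lt (by fun_prop) (by fun_prop)))
      |>.lintegral_prod_right')
  have hcov : Λ ⊆ ⋃ k : ℕ, Λ ∩ {x | g k x ≤ k} := by
    intro x hx
    obtain ⟨r, hr, hlt⟩ := hU x hx
    obtain ⟨k₁, hk₁⟩ := exists_nat_one_div_lt hr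
    obtain ⟨k₂, hk₂⟩ := ENNReal.exists_nat_gt hlt.ne
    refine mem_iUnion.2 ⟨max k₁ k₂, hx, ?_⟩
    refine le_trans ?_ (hk₂.le.trans (by exact_mod_cast le_max_right k₁ k₂))
    simp only [hg]
    rw [← lintegral_indicator hΛ,
      ← lintegral_indicator (Metric.isOpen_ball.measurableSet.inter hΛ)]
    refine lintegral_mono fun y => ?_
    by_cases hy : y ∈ Λ
    · rw [indicator_of_mem hy]
      refine indicator_apply_le' (fun h => ?_) fun _ => zero_le
      have hyr : y ∈ Metric.ball x r := by
        have h1 : dist x y < 1 / (((max k₁ k₂ : ℕ) : ℝ) + 1) := h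
        have h2 : 1 / (((max k₁ k₂ : ℕ) : ℝ) + 1) ≤ 1 / ((k₁ : ℝ) + 1) :=
          one_div_le_one_div_of_le (by positivity)
            (by gcongr; exact_mod_cast le_max_left k₁ k₂)
        rw [Metric.mem_ball, dist_comm]
        linarith
      rw [indicator_of_mem (mem_inter hyr hy),
        cutoff_of_mem (subset_closure hx) (subset_closure hy)]
    · rw [indicator_of_notMem hy]
      exact zero_le
  obtain ⟨k, hk⟩ : ∃ k : ℕ, volume (Λ ∩ {x | g k x ≤ k}) ≠ 0 := by
    by_contra! h
    exact h0 (measure_mono_null hcov (measure_iUnion_null h))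
  have hk0 : (0 : ℝ) < 1 / (2 * ((k : ℝ) + 1)) := by positivity
  obtain ⟨n, hn⟩ : ∃ n : ℕ, volume ((Λ ∩ {x | g k x ≤ k}) ∩
      Metric.ball (TopologicalSpace.denseSeq Euc n) (1 / (2 * ((k : ℝ) + 1)))) ≠ 0 := by
    by_contra! h
    refine hk (measure_mono_null (fun x hx => ?_) (measure_iUnion_null h))
    obtain ⟨n, hn⟩ := (TopologicalSpace.denseRange_denseSeq Euc).exists_dist_lt x hk0
    exact mem_iUnion.2 ⟨n, hx, hn⟩
  set D := (Λ ∩ {x | g k x ≤ k}) ∩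
    Metric.ball (TopologicalSpace.denseSeq Euc n) (1 / (2 * ((k : ℝ) + 1)))
  have hDm : MeasurableSet D :=
    (hΛ.inter (measurableSet_le (hgm k) measurable_const)).inter Metric.isOpen_ball.measurableSet
  have hDΛ : D ⊆ Λ := fun x hx => hx.1.1
  have hDtop : volume D ≠ ⊤ := measure_ne_top_of_subset hDΛ htop
  have := isProbabilityMeasure_normLeb hn hDtop
  refine ⟨normLeb D, inferInstance, klDiv_normLeb_ne_top hDm hDΛ hn htop, ?_⟩
  have hbound : ∀ x ∈ D, ∫⁻ y, cutoff U Λ (x, y) ∂(normLeb D) ≤ (volume D)⁻¹ * (volume D + k) := by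
    intro x hx
    rw [normLeb, lintegral_smul_measure, smul_eq_mul]
    gcongr
    calc ∫⁻ y in D, cutoff U Λ (x, y)
        ≤ ∫⁻ y in D, (1 + cutoff U Λ (x, y) ^ 2) := by
          refine lintegral_mono fun y => ?_
          rcases le_total (cutoff U Λ (x, y)) 1 with h | h
          · exact h.trans le_self_add
          · exact (le_self_pow₀ h two_ne_zero).trans le_add_self
      _ = volume D + ∫⁻ y in D, cutoff U Λ (x, y) ^ 2 := by
          rw [lintegral_add_left measurable_const]
          simp
      _ ≤ volume D + g k x := by
          gcongr
          refine le_trans (setLIntegral_mono_ae' hDm (ae_of_all _ fun y hy => ?_))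
            (lintegral_mono_set hDΛ)
          have hxy : (x, y) ∈ {p : Euc × Euc | dist p.1 p.2 < 1 / ((k : ℝ) + 1)} := by
            have h1 := hx.2
            have h2 := hy.2
            rw [Metric.mem_ball] at h1 h2
            have h3 := dist_triangle_right x y (TopologicalSpace.denseSeq Euc n)
            have h4 : 1 / (2 * ((k : ℝ) + 1)) + 1 / (2 * ((k : ℝ) + 1)) = 1 / ((k : ℝ) + 1) := by
              field_simp
              norm_num
            rw [mem_ofPred_eq]
            linarith
          rw [indicator_of_mem hxy]
      _ ≤ volume D + k := by
          gcongr
          exact hx.1.2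
  rw [lintegral_prod _ hV.aemeasurable]
  refine ne_top_of_le_ne_top (b := (volume D)⁻¹ * (volume D + k)) ?_ ?_
  · exact ENNReal.mul_ne_top (ENNReal.inv_ne_top.2 hn)
      (ENNReal.add_ne_top.2 ⟨hDtop, ENNReal.natCast_ne_top k⟩)
  · have hmem : ∀ᵐ x ∂(normLeb D), x ∈ D := Measure.ae_smul_measure (ae_restrict_mem hDm) _
    refine (lintegral_mono_ae (hmem.mono hbound)).trans ?_
    simp

end FiniteLaw

section Transfer

variable {U : Euc → Euc → ℝ≥0∞} {Λ : Set Euc} {θ : ℝ}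

theorem piNormLeb_eq_pi (h0 : volume Λ ≠ 0) (htop : volume Λ ≠ ⊤) (N : ℕ) :
    piNormLeb Λ N = Measure.pi fun _ => normLeb Λ := by
  have := isProbabilityMeasure_normLeb h0 htop
  refine (Measure.pi_eq fun s hs => ?_).symm
  rw [piNormLeb, Measure.smul_apply, Measure.restrict_apply (MeasurableSet.univ_pi hs),
    ← pi_inter_distrib, volume_pi_pi]
  simp only [normLeb, Measure.smul_apply, smul_eq_mul, Measure.restrict_apply (hs _),
    Finset.prod_mul_distrib, Finset.prod_const, Finset.card_univ, Fintype.card_fin]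
  rw [ENNReal.inv_pow]

theorem integral_negExp_piNormLeb (hΛ : MeasurableSet Λ) (h0 : volume Λ ≠ 0)
    (htop : volume Λ ≠ ⊤) (t : ℝ) (N : ℕ) :
    ∫ q, negExp t (interactionE U N q) ∂(piNormLeb Λ N) =
      ∫ q : Fin N → Euc, negExp t (∑ i : Fin N, ∑ j : Fin N,
        if (i : ℕ) < (j : ℕ) then cutoff U Λ (q i, q j) else 0)
        ∂(Measure.pi fun _ => normLeb Λ) := by
  have := isProbabilityMeasure_normLeb h0 htop
  rw [piNormLeb_eq_pi h0 htop]
  refine integral_congr_ae ?_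
  have hmem : ∀ᵐ x ∂(normLeb Λ), x ∈ closure Λ :=
    Measure.ae_smul_measure
      ((ae_restrict_mem hΛ).mono fun x hx => subset_closure hx) _
  have hall : ∀ᵐ q : Fin N → Euc ∂(Measure.pi fun _ => normLeb Λ), ∀ i, q i ∈ closure Λ :=
    ae_all_iff.2 fun i => (Measure.tendsto_eval_ae_ae (i := i)).eventually hmem
  filter_upwards [hall] with q hq
  rw [interactionE]
  congr 1
  refine Finset.sum_congr rfl fun i _ => Finset.sum_congr rfl fun j _ => ?_
  rw [cutoff_of_mem (hq i) (hq j)]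

theorem integral_negExp_pi_map {X Y : Type*} [MeasurableSpace X] [MeasurableSpace Y] {g : X → Y}
    (hg : Measurable g) {m : Measure X} [IsProbabilityMeasure m] {V : Y × Y → ℝ≥0∞}
    (hV : Measurable V) (t : ℝ) (N : ℕ) :
    ∫ y : Fin N → Y, negExp t (∑ i : Fin N, ∑ j : Fin N,
        if (i : ℕ) < (j : ℕ) then V (y i, y j) else 0) ∂(Measure.pi fun _ => m.map g) =
      ∫ x : Fin N → X, negExp t (∑ i : Fin N, ∑ j : Fin N,
        if (i : ℕ) < (j : ℕ) then V (g (x i), g (x j)) else 0) ∂(Measure.pi fun _ => m) := by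
  have := Measure.isProbabilityMeasure_map (μ := m) hg.aemeasurable
  have hgN : Measurable fun (x : Fin N → X) (i : Fin N) => g (x i) :=
    measurable_pi_lambda _ fun i => hg.comp (measurable_pi_apply i)
  rw [← Measure.pi_map_pi fun _ => hg.aemeasurable]
  exact integral_map hgN.aemeasurable
    ((measurable_negExp t).comp (measurable_pair_sum hV N)).aestronglyMeasurable

theorem exists_integral_negExp_piNormLeb_le (hΛ : MeasurableSet Λ) (h0 : volume Λ ≠ 0)
    (hbdd : Bornology.IsBounded Λ) (hsymm : ∀ x ∈ closure Λ, ∀ y ∈ closure Λ, U x y = U y x)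
    (hlsc : LowerSemicontinuousOn (fun p : Euc × Euc => U p.1 p.2) (closure Λ ×ˢ closure Λ))
    (hθ : 0 < θ) {c : ℝ}
    (h : ∀ μ : Measure Euc, IsProbabilityMeasure μ →
      InformationTheory.klDiv μ (normLeb Λ) ≠ ⊤ → ∫⁻ p, cutoff U Λ p ∂(μ.prod μ) ≠ ⊤ →
      -((2 * θ)⁻¹ * (∫⁻ p, cutoff U Λ p ∂(μ.prod μ)).toReal)
        - (InformationTheory.klDiv μ (normLeb Λ)).toReal ≤ c) {δ : ℝ} (hδ : 0 < δ) :
    ∃ C : ℝ, ∀ N : ℕ, 1 ≤ N →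
      ∫ q, negExp (((N : ℝ) * θ)⁻¹) (interactionE U N q) ∂(piNormLeb Λ N) ≤
        C * Real.exp (N * (c + δ)) := by
  have htop : volume Λ ≠ ⊤ := hbdd.measure_lt_top.ne
  have := isProbabilityMeasure_normLeb h0 htop
  have hcpt : CompactSpace (closure Λ) := isCompact_iff_compactSpace.1 hbdd.isCompact_closure
  have hemb : MeasurableEmbedding (Subtype.val : closure Λ → Euc) :=
    MeasurableEmbedding.subtype_coe isClosed_closure.measurableSet
  have hval : Measurable (Subtype.val : closure Λ → Euc) := hemb.measurable
  set m : Measure (closure Λ) := (normLeb Λ).comap Subtype.val with hm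
  have hmem : ∀ᵐ x ∂(normLeb Λ), x ∈ closure Λ :=
    Measure.ae_smul_measure
      ((ae_restrict_mem hΛ).mono fun x hx => subset_closure hx) _
  have hmap : m.map Subtype.val = normLeb Λ := by
    rw [hm, map_comap_subtype_coe isClosed_closure.measurableSet,
      Measure.restrict_eq_self_of_ae_mem hmem]
  have hmprob : IsProbabilityMeasure m := by
    constructor
    have h1 := congrArg (fun ν => ν univ) hmap
    simpa [Measure.map_apply hval MeasurableSet.univ] using h1
  set V : closure Λ × closure Λ → ℝ≥0∞ := fun p => U p.1 p.2 with hVdef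
  have hV : LowerSemicontinuous V := by
    intro p y hy
    have h1 := hlsc (p.1, p.2) ⟨p.1.2, p.2.2⟩ y hy
    have h2 : Tendsto (fun q : closure Λ × closure Λ => ((q.1 : Euc), (q.2 : Euc)))
        (nhds p) (nhdsWithin (p.1, p.2) (closure Λ ×ˢ closure Λ)) :=
      tendsto_nhdsWithin_iff.2 ⟨(by fun_prop : Continuous fun q : closure Λ × closure Λ =>
        ((q.1 : Euc), (q.2 : Euc))).tendsto p, Eventually.of_forall fun q => ⟨q.1.2, q.2.2⟩⟩
    exact h2.eventually h1
  have hcm : Measurable (cutoff U Λ) := measurable_cutoff hlsc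
  obtain ⟨C, hC⟩ := exists_integral_negExp_le (m := m) (θ := θ) (c := c) hV
    (fun x y => hsymm x x.2 y y.2) hθ (fun ν hν hkl hInt => by
      have hprob : IsProbabilityMeasure (ν.map Subtype.val) :=
        Measure.isProbabilityMeasure_map hval.aemeasurable
      have hle := InformationTheory.klDiv_map_le ν m hval
      rw [hmap] at hle
      have heq : ∫⁻ p, cutoff U Λ p ∂((ν.map Subtype.val).prod (ν.map Subtype.val)) =
          ∫⁻ z, V z ∂(ν.prod ν) := by
        rw [Measure.map_prod_map _ _ hval hval, lintegral_map hcm (hval.prodMap hval)]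
        exact lintegral_congr fun z => cutoff_of_mem z.1.2 z.2.2
      have h1 := h (ν.map Subtype.val) hprob (ne_top_of_le_ne_top hkl hle) (heq ▸ hInt)
      rw [heq] at h1
      have h2 := ENNReal.toReal_mono hkl hle
      linarith) hδ
  refine ⟨C, fun N hN => le_of_eq_of_le ?_ (hC N hN)⟩
  rw [integral_negExp_piNormLeb hΛ h0 htop, ← hmap, integral_negExp_pi_map hval hcm]
  refine integral_congr_ae (ae_of_all _ fun x => congrArg _ ?_)
  refine Finset.sum_congr rfl fun i _ => Finset.sum_congr rfl fun j _ => ?_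
  rw [cutoff_of_mem (x i).2 (x j).2]

end Transfer

theorem tendsto_log_div_of_exp_bounds {J : ℕ → ℝ} {S : ℝ}
    (hlow : ∀ δ > 0, ∀ N : ℕ, 1 ≤ N → Real.exp (N * (S - δ)) ≤ J N)
    (hupp : ∀ δ > 0, ∃ C : ℝ, ∀ N : ℕ, 1 ≤ N → J N ≤ C * Real.exp (N * (S + δ))) :
    Tendsto (fun N : ℕ => Real.log (J N) / N) atTop (nhds S) := by
  refine tendsto_order.2 ⟨fun a ha => ?_, fun a ha => ?_⟩
  · filter_upwards [eventually_ge_atTop 1] with N hN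
    have hN0 : (0 : ℝ) < N := by exact_mod_cast hN
    have h1 := Real.log_le_log (Real.exp_pos _) (hlow ((S - a) / 2) (by linarith) N hN)
    rw [Real.log_exp] at h1
    rw [lt_div_iff₀ hN0]
    nlinarith
  · obtain ⟨C, hC⟩ := hupp ((a - S) / 2) (by linarith)
    have hlim := tendsto_const_div_atTop_nhds_zero_nat (𝕜 := ℝ) (Real.log C)
    filter_upwards [eventually_ge_atTop 1,
      hlim.eventually_lt_const (show (0 : ℝ) < (a - S) / 2 by linarith)] with N hN hlt
    have hN0 : (0 : ℝ) < N := by exact_mod_cast hN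
    have hJ : 0 < J N := (Real.exp_pos _).trans_le (hlow 1 one_pos N hN)
    have hC0 : 0 < C := pos_of_mul_pos_left (hJ.trans_le (hC N hN)) (Real.exp_pos _).le
    have h1 := Real.log_le_log hJ (hC N hN)
    rw [Real.log_mul hC0.ne' (Real.exp_pos _).ne', Real.log_exp] at h1
    rw [div_lt_iff₀ hN0] at hlt ⊢
    nlinarith

theorem canonPot_expansion {U : Euc → Euc → ℝ≥0∞} {Λ : Set Euc} {θ : ℝ} {N : ℕ}
    (h0 : volume Λ ≠ 0) (htop : volume Λ ≠ ⊤) (hθ : 0 < θ) (hN : 1 ≤ N)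
    (hJ : 0 < ∫ q, negExp (((N : ℝ) * θ)⁻¹) (interactionE U N q) ∂(piNormLeb Λ N)) :
    (canonPot U Λ N θ + (N : ℝ) * Real.log N) / (N : ℝ) =
      Real.log (volume Λ).toReal + 3 / 2 * Real.log (2 * π * θ) +
        (Real.log N - Real.log (N.factorial : ℝ) / N) +
        Real.log (∫ q, negExp (((N : ℝ) * θ)⁻¹) (interactionE U N q) ∂(piNormLeb Λ N)) / N := by
  have hN0 : (N : ℝ) ≠ 0 := by exact_mod_cast (show N ≠ 0 by omega)
  have hL : 0 < (volume Λ).toReal := ENNReal.toReal_pos h0 htop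
  have hF : (0 : ℝ) < N.factorial := by exact_mod_cast N.factorial_pos
  have hθ2 : 0 < 2 * π * θ := by positivity
  rw [canonPot, Real.log_mul (by positivity) hJ.ne', Real.log_mul (by positivity) (by positivity),
    Real.log_div (by positivity) hF.ne', Real.log_pow, Real.log_rpow hθ2]
  field_simp
  ring

theorem statement19
    (Λ : Set Euc) (hΛne : Λ.Nonempty) (hΛopen : IsOpen Λ)
    (hΛbdd : Bornology.IsBounded Λ) (hΛconn : IsConnected Λ)
    (U : Euc → Euc → ℝ≥0∞) (hU : HypUE U Λ)
    -- `s(ε) = −min_{f ∈ 𝔄_ε} ℋ(f)`, the system-specific microcanonical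
    -- entropy per particle
    (s : ℝ → ℝ)
    (hs : ∀ ε : ℝ, groundEnergyE U Λ < ENNReal.ofReal ε →
      ∃ f : Euc × Euc → ℝ, Adm U Λ ε f ∧
        (∀ g : Euc × Euc → ℝ, Adm U Λ ε g → Hfun f ≤ Hfun g) ∧
        s ε = -(Hfun f)) :
    ∀ θ : ℝ, 0 < θ →
      Tendsto (fun N : ℕ =>
          (canonPot U Λ N θ + (N : ℝ) * Real.log N) / (N : ℝ))
        atTop
        (nhds (sSup {y : ℝ | ∃ ε : ℝ,
          groundEnergyE U Λ < ENNReal.ofReal ε ∧ y = -ε / θ + s ε})) := by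
  intro θ hθ
  have hΛ := hΛopen.measurableSet
  have h0 : volume Λ ≠ 0 := (hΛopen.measure_pos volume hΛne).ne'
  have htop : volume Λ ≠ ⊤ := hΛbdd.measure_lt_top.ne
  have hV := measurable_cutoff hU.lsc
  have := isProbabilityMeasure_normLeb h0 htop
  set Y := {y : ℝ | ∃ ε : ℝ, groundEnergyE U Λ < ENNReal.ofReal ε ∧ y = -ε / θ + s ε}
  have hlaw : ∀ y ∈ Y, ∃ μ : Measure Euc, IsProbabilityMeasure μ ∧
      InformationTheory.klDiv μ (normLeb Λ) ≠ ⊤ ∧ ∫⁻ p, cutoff U Λ p ∂(μ.prod μ) ≠ ⊤ ∧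
      y ≤ refPotential Λ θ + (-((2 * θ)⁻¹ * (∫⁻ p, cutoff U Λ p ∂(μ.prod μ)).toReal)
          - (InformationTheory.klDiv μ (normLeb Λ)).toReal) := by
    rintro y ⟨ε, hε, rfl⟩
    obtain ⟨f, hf, -, hsf⟩ := hs ε hε
    rw [hsf, ← sub_eq_add_neg]
    exact exists_law_of_adm hΛ h0 htop hV hθ (ENNReal.ofReal_pos.1 (pos_of_gt hε)) hf
  have hbdd : BddAbove Y := by
    refine ⟨refPotential Λ θ, fun y hy => ?_⟩
    obtain ⟨μ, -, -, -, hle⟩ := hlaw y hy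
    have h1 : 0 ≤ (2 * θ)⁻¹ * (∫⁻ p, cutoff U Λ p ∂(μ.prod μ)).toReal := by positivity
    have h2 : 0 ≤ (InformationTheory.klDiv μ (normLeb Λ)).toReal := ENNReal.toReal_nonneg
    linarith
  have hupp : ∀ μ : Measure Euc, IsProbabilityMeasure μ →
      InformationTheory.klDiv μ (normLeb Λ) ≠ ⊤ → ∫⁻ p, cutoff U Λ p ∂(μ.prod μ) ≠ ⊤ →
      ∃ y ∈ Y, -((2 * θ)⁻¹ * (∫⁻ p, cutoff U Λ p ∂(μ.prod μ)).toReal)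
        - (InformationTheory.klDiv μ (normLeb Λ)).toReal ≤ y - refPotential Λ θ := by
    intro μ hμ hkl hv
    obtain ⟨ε, f, hε, hf, heq⟩ := exists_adm_of_law hΛ h0 htop hV hθ hkl hv
    obtain ⟨g, -, hmin, hsg⟩ := hs ε hε
    refine ⟨-ε / θ + s ε, ⟨ε, hε, rfl⟩, ?_⟩
    have := hmin f hf
    rw [hsg]
    linarith
  have hne : Y.Nonempty := by
    obtain ⟨μ, hμ, hkl, hv⟩ := exists_law_lintegral_ne_top hΛ h0 htop hV hU.locL2
    obtain ⟨y, hy, -⟩ := hupp μ hμ hkl hv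
    exact ⟨y, hy⟩
  set J : ℕ → ℝ := fun N =>
    ∫ q, negExp (((N : ℝ) * θ)⁻¹) (interactionE U N q) ∂(piNormLeb Λ N)
  have hlow : ∀ δ > 0, ∀ N : ℕ, 1 ≤ N →
      Real.exp (N * (sSup Y - refPotential Λ θ - δ)) ≤ J N := by
    intro δ hδ N hN
    obtain ⟨y, hy, hlt⟩ := exists_lt_of_lt_csSup hne (sub_lt_self (sSup Y) hδ)
    obtain ⟨μ, hμ, hkl, hv, hle⟩ := hlaw y hy
    refine le_trans (Real.exp_le_exp.2 ?_) ((exp_le_integral_negExp hV hkl hv hθ hN).trans_eq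
      (integral_negExp_piNormLeb hΛ h0 htop _ N).symm)
    exact mul_le_mul_of_nonneg_left (by linarith) N.cast_nonneg
  have hlim : Tendsto (fun N : ℕ => Real.log (J N) / N) atTop
      (nhds (sSup Y - refPotential Λ θ)) := by
    refine tendsto_log_div_of_exp_bounds hlow fun δ hδ => ?_
    refine exists_integral_negExp_piNormLeb_le hΛ h0 hΛbdd hU.symm hU.lsc hθ
      (fun μ hμ hkl hv => ?_) hδ
    obtain ⟨y, hy, hle⟩ := hupp μ hμ hkl hv
    linarith [le_csSup hbdd hy]
  have hsum := (tendsto_log_sub_log_factorial_div.const_add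
    (Real.log (volume Λ).toReal + 3 / 2 * Real.log (2 * π * θ))).add hlim
  rw [refPotential, add_sub_cancel] at hsum
  refine hsum.congr' ?_
  filter_upwards [eventually_ge_atTop 1] with N hN
  exact (canonPot_expansion h0 htop hθ hN
    ((Real.exp_pos _).trans_le (hlow 1 one_pos N hN))).symm
end
end
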